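/- The moduli space T_g^{trop,(3)} of 3-edge connected tropical trigonal curves of genus g ≥ 3 is connected through codimension 1: for any two maximal cells (corresponding to 3-ladders G_{T₁} and G_{T₂} over trees with g vertices) there is a sequence of maximal cells starting at the cell of G_{T₁} and ending at the cell of G_{T₂} in which any two consecutive maximal cells share a common codimension-1 face, obtained by contracting a single equivalence class of edges of the associated degree-3 harmonic morphism. -/

import Mathlib

open scoped Classical

/-!
Finite combinatorial (multi-)graphs, weighted graphs, harmonic morphisms of
graphs, stabilization, trigonal types and `3`-ladders.
-/

structure CGraph : Type 1 where
  V : Type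
  E : Type
  fV : Fintype V
  fE : Fintype E
  dV : DecidableEq V
  dE : DecidableEq E
  src : E → V
  tgt : E → V

attribute [instance] CGraph.fV CGraph.fE CGraph.dV CGraph.dE

namespace CGraph

def Incident (G : CGraph) (e : G.E) (v : G.V) : Prop :=
  G.src e = v ∨ G.tgt e = v

/-- Incidence multiplicity (a loop counts twice). -/
def incid (G : CGraph) (e : G.E) (v : G.V) : ℕ :=
  (if G.src e = v then 1 else 0) + (if G.tgt e = v then 1 else 0)

def valence (G : CGraph) (v : G.V) : ℕ := ∑ e : G.E, G.incid e v

def dSrc (G : CGraph) (x : G.E × Bool) : G.V := if x.2 then G.src x.1 else G.tgt x.1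
def dTgt (G : CGraph) (x : G.E × Bool) : G.V := if x.2 then G.tgt x.1 else G.src x.1

def IsWalk (G : CGraph) : List (G.E × Bool) → G.V → G.V → Prop
  | [], u, v => u = v
  | x :: xs, u, v => G.dSrc x = u ∧ IsWalk G xs (G.dTgt x) v

def Connected (G : CGraph) : Prop :=
  Nonempty G.V ∧ ∀ u v : G.V, ∃ L, IsWalk G L u v

def ThreeEdgeConnected (G : CGraph) : Prop :=
  ∀ S : Finset G.E, S.card ≤ 2 → ∀ u v : G.V,
    ∃ L, IsWalk G L u v ∧ ∀ x ∈ L, x.1 ∉ S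

def IsTree (G : CGraph) : Prop :=
  Connected G ∧ Fintype.card G.E + 1 = Fintype.card G.V

/-- A weightless graph is stable iff each vertex has valence at least `3`. -/
def IsStable0 (G : CGraph) : Prop := ∀ v : G.V, 3 ≤ valence G v

/-- The unordered pair of endpoints of an edge. -/
def endsOf (G : CGraph) (e : G.E) : Sym2 G.V := s(G.src e, G.tgt e)

end CGraph

/-- The genus of a weighted graph: first Betti number plus total weight. -/
def wgenus (G : CGraph) (w : G.V → ℕ) : ℕ :=
  Fintype.card G.E + 1 + (∑ v : G.V, w v) - Fintype.card G.V

/-- The weightless graph `G^w`, obtained by attaching `w v` loops at each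
vertex `v`. -/
def withLoops (G : CGraph) (w : G.V → ℕ) : CGraph where
  V := G.V
  E := G.E ⊕ Σ v : G.V, Fin (w v)
  fV := inferInstance
  fE := inferInstance
  dV := inferInstance
  dE := inferInstance
  src := fun e => match e with
    | Sum.inl e => G.src e
    | Sum.inr q => q.1
  tgt := fun e => match e with
    | Sum.inl e => G.tgt e
    | Sum.inr q => q.1

/-! ### Isomorphisms and stabilization -/

def sameEndsMapC (G H : CGraph) (f : G.V → H.V) (e : G.E) (e' : H.E) : Prop :=
  (f (G.src e) = H.src e' ∧ f (G.tgt e) = H.tgt e') ∨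
  (f (G.src e) = H.tgt e' ∧ f (G.tgt e) = H.src e')

structure CIso (G H : CGraph) where
  vEquiv : G.V ≃ H.V
  eEquiv : G.E ≃ H.E
  ends : ∀ e, sameEndsMapC G H (fun v => vEquiv v) e (eEquiv e)

/-- Bundled weighted graph. -/
structure WGraph : Type 1 where
  G : CGraph
  w : G.V → ℕ

/-- Isomorphism of weighted graphs. -/
def WGIso (X Y : WGraph) : Prop :=
  ∃ i : CIso X.G Y.G, ∀ v, Y.w (i.vEquiv v) = X.w v

def IsStableW (X : WGraph) : Prop :=
  ∀ v, X.w v = 0 → 3 ≤ CGraph.valence X.G v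

/-- Contraction of a leaf edge (removal of a valence-one vertex and its edge). -/
def LeafStep0 (G H : CGraph) : Prop :=
  ∃ (v₀ : G.V) (e₀ : G.E), CGraph.valence G v₀ = 1 ∧ CGraph.Incident G e₀ v₀ ∧
    ∃ (fv : H.V ≃ {v : G.V // v ≠ v₀}) (fe : H.E ≃ {e : G.E // e ≠ e₀}),
      ∀ e : H.E, sameEndsMapC H G (fun v => (fv v).1) e (fe e).1

/-- Suppression of a valence-two vertex (contraction of one of its edges). -/
def SeriesStep0 (G H : CGraph) : Prop :=
  ∃ (v₀ : G.V) (e₁ e₂ : G.E) (u₁ u₂ : G.V),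
    e₁ ≠ e₂ ∧ CGraph.valence G v₀ = 2 ∧ u₁ ≠ v₀ ∧ u₂ ≠ v₀ ∧
    ({G.src e₁, G.tgt e₁} : Set G.V) = {v₀, u₁} ∧
    ({G.src e₂, G.tgt e₂} : Set G.V) = {v₀, u₂} ∧
    ∃ (fv : H.V ≃ {v : G.V // v ≠ v₀}) (ebar : H.E)
      (fe : {e : H.E // e ≠ ebar} ≃ {e : G.E // e ≠ e₁ ∧ e ≠ e₂}),
      ({(fv (H.src ebar)).1, (fv (H.tgt ebar)).1} : Set G.V) = {u₁, u₂} ∧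
      ∀ e : {e : H.E // e ≠ ebar}, sameEndsMapC H G (fun v => (fv v).1) e.1 (fe e).1

def Step0 (G H : CGraph) : Prop :=
  LeafStep0 G H ∨ SeriesStep0 G H ∨ Nonempty (CIso G H)

/-- `G` stabilizes to `H` (weightless stabilization: iteratively contract
leaves and suppress valence-two vertices). -/
def StabReduces0 (G H : CGraph) : Prop := Relation.ReflTransGen Step0 G H

/-! ### Harmonic morphisms of graphs -/

structure CMorphism (G T : CGraph) where
  vMap : G.V → T.V
  eMap : G.E → T.E ⊕ T.V
  mu : G.E → ℕ
  mu_zero : ∀ e, mu e = 0 ↔ ∃ v', eMap e = Sum.inr v'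
  contract_ok : ∀ e v', eMap e = Sum.inr v' →
    vMap (G.src e) = v' ∧ vMap (G.tgt e) = v'
  edge_ok : ∀ e e', eMap e = Sum.inl e' → sameEndsMapC G T vMap e e'

namespace CMorphism

variable {G T : CGraph}

noncomputable def locDeg (φ : CMorphism G T) (v : G.V) (e' : T.E) : ℕ :=
  ∑ e : G.E, if φ.eMap e = Sum.inl e' then φ.mu e * CGraph.incid G e v else 0

def Harmonic (φ : CMorphism G T) : Prop :=
  ∀ (v : G.V) (e₁ e₂ : T.E),
    CGraph.Incident T e₁ (φ.vMap v) → CGraph.Incident T e₂ (φ.vMap v) →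
      locDeg φ v e₁ = locDeg φ v e₂

def Nondegenerate (φ : CMorphism G T) : Prop :=
  ∀ v : G.V, ∃ e' : T.E, CGraph.Incident T e' (φ.vMap v) ∧ 1 ≤ locDeg φ v e'

def HasDegree (φ : CMorphism G T) (d : ℕ) : Prop :=
  ∀ e' : T.E, (∑ e : G.E, if φ.eMap e = Sum.inl e' then φ.mu e else 0) = d

/-- The local degree `m_φ(v)` at a vertex. -/
noncomputable def mVal (φ : CMorphism G T) (v : G.V) : ℕ :=
  (Finset.univ.filter fun e' : T.E => CGraph.Incident T e' (φ.vMap v)).sup (locDeg φ v)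

end CMorphism

/-- The class of an edge for the equivalence relation `∼_φ`: two edges are
equivalent iff they map to the same edge of the target; a contracted edge is
alone in its class. -/
def classMap {G T : CGraph} (φ : CMorphism G T) (e : G.E) : T.E ⊕ G.E :=
  match φ.eMap e with
  | Sum.inl e' => Sum.inl e'
  | Sum.inr _ => Sum.inr e

/-- `S` is a union of equivalence classes of `∼_φ`. -/
def ClassClosed {G T : CGraph} (φ : CMorphism G T) (S : Set G.E) : Prop :=
  ∀ e₁ e₂, classMap φ e₁ = classMap φ e₂ → (e₁ ∈ S ↔ e₂ ∈ S)

/-- The number of equivalence classes of `∼_φ` on the edges of the source. -/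
noncomputable def numClasses {G T : CGraph} (φ : CMorphism G T) : ℕ :=
  (Finset.univ.image (classMap φ)).card

/-! ### Weighted contractions -/

/-- Two vertices are joined by edges of `S`. -/
def SReach (G : CGraph) (S : Set G.E) (a b : G.V) : Prop :=
  Relation.ReflTransGen
    (fun u v => ∃ e ∈ S, (G.src e = u ∧ G.tgt e = v) ∨ (G.src e = v ∧ G.tgt e = u))
    a b

/-- Data exhibiting `H` as the contraction of the edge set `S` in `G`. -/
structure ContractionData (G : CGraph) (S : Set G.E) (H : CGraph) where
  c : G.V → H.V
  fe : H.E ≃ {e : G.E // e ∉ S}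
  surj : Function.Surjective c
  ends : ∀ e : H.E,
    (H.src e = c (G.src (fe e).1) ∧ H.tgt e = c (G.tgt (fe e).1)) ∨
    (H.src e = c (G.tgt (fe e).1) ∧ H.tgt e = c (G.src (fe e).1))
  fibers : ∀ u v : G.V, c u = c v ↔ SReach G S u v

/-- The weights of the weighted contraction: the sum of the weights in a fiber
plus the first Betti number of the contracted piece. -/
noncomputable def contractedWeight {G : CGraph} {S : Set G.E} {H : CGraph}
    (cd : ContractionData G S H) (w : G.V → ℕ) : H.V → ℕ :=
  fun v' => (∑ u ∈ Finset.univ.filter (fun u => cd.c u = v'), w u) +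
    ((Finset.univ.filter fun e : G.E => e ∈ S ∧ cd.c (G.src e) = v').card + 1
      - (Finset.univ.filter fun u : G.V => cd.c u = v').card)

/-! ### Trigonal types -/

/-- A `3`-edge connected trigonal type: a `3`-edge connected stable weighted
graph `(G, w)` together with a non-degenerate harmonic morphism of degree `3`
from a graph `Gphi` with `(Gphi)^st = G^w` onto a tree, such that the preimage
of every vertex of the tree contains a vertex of `G`. -/
structure TrigonalType : Type 1 where
  G : CGraph
  w : G.V → ℕ
  stable : ∀ v, w v = 0 → 3 ≤ CGraph.valence G v
  conn : CGraph.Connected G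
  threeEC : CGraph.ThreeEdgeConnected G
  Gphi : CGraph
  connphi : CGraph.Connected Gphi
  T : CGraph
  treeT : CGraph.IsTree T
  phi : CMorphism Gphi T
  harm : CMorphism.Harmonic phi
  nondeg : CMorphism.Nondegenerate phi
  deg3 : CMorphism.HasDegree phi 3
  stab : StabReduces0 Gphi (withLoops G w)
  vG : G.V → Gphi.V
  vG_inj : Function.Injective vG
  cover : ∀ t : T.V, ∃ x : G.V, phi.vMap (vG x) = t

/-- `X` is a `3`-edge connected trigonal graph. -/
def IsTrigonalGraph (X : WGraph) : Prop :=
  ∃ 𝒯 : TrigonalType, WGIso ⟨𝒯.G, 𝒯.w⟩ X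

/-- `Y` is a trigonal contraction of `X`: there are a trigonal type on `X`,
a `φ`-contraction of it, and a trigonal type on `Y` such that the contracted
graph and the new covering graph have a common stable model. -/
def TrigContraction (X Y : WGraph) : Prop :=
  ∃ 𝒯 : TrigonalType, WGIso ⟨𝒯.G, 𝒯.w⟩ X ∧
    ∃ S : Set 𝒯.Gphi.E, ClassClosed 𝒯.phi S ∧
      ∃ (H : CGraph) (cd : ContractionData 𝒯.Gphi S H)
        (𝒯' : TrigonalType) (K : CGraph),
        WGIso ⟨𝒯'.G, 𝒯'.w⟩ Y ∧ CGraph.IsStable0 K ∧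
        StabReduces0 (withLoops H (contractedWeight cd fun _ => 0)) K ∧
        StabReduces0 𝒯'.Gphi K

/-- A trigonal contraction contracting a single equivalence class of `∼_φ`. -/
def SingleClassContraction (X Y : WGraph) : Prop :=
  ∃ 𝒯 : TrigonalType, WGIso ⟨𝒯.G, 𝒯.w⟩ X ∧
    ∃ e₀ : 𝒯.Gphi.E,
      ∃ (H : CGraph)
        (cd : ContractionData 𝒯.Gphi {e | classMap 𝒯.phi e = classMap 𝒯.phi e₀} H)
        (𝒯' : TrigonalType) (K : CGraph),
        WGIso ⟨𝒯'.G, 𝒯'.w⟩ Y ∧ CGraph.IsStable0 K ∧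
        StabReduces0 (withLoops H (contractedWeight cd fun _ => 0)) K ∧
        StabReduces0 𝒯'.Gphi K

/-- A maximal `3`-edge connected trigonal graph: it is not a proper trigonal
contraction of any other trigonal graph. -/
def MaximalTrigonal (X : WGraph) : Prop :=
  IsTrigonalGraph X ∧
    ∀ Y : WGraph, IsTrigonalGraph Y → TrigContraction Y X → WGIso Y X

/-! ### `3`-ladders -/

/-- A witness that `H` is a `3`-ladder over the tree `T`: three disjoint
copies of `T`, one added edge joining two copies over each valence-two vertex,
two non-parallel added edges over each valence-one vertex, and the path
condition. -/
structure LadderWitness (T H : CGraph) : Type 1 where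
  treeT : CGraph.IsTree T
  maxval : ∀ v : T.V, CGraph.valence T v ≤ 3
  A : Type
  [fA : Fintype A]
  [dA : DecidableEq A]
  vEquiv : H.V ≃ T.V × Fin 3
  eEquiv : H.E ≃ (T.E × Fin 3) ⊕ A
  ends_copy : ∀ (e : T.E) (i : Fin 3),
    Sym2.map (fun v => vEquiv v) (CGraph.endsOf H (eEquiv.symm (Sum.inl (e, i)))) =
      s((T.src e, i), (T.tgt e, i))
  aVert : A → T.V
  aPair : A → Fin 3 × Fin 3
  aPair_ne : ∀ a, (aPair a).1 ≠ (aPair a).2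
  ends_add : ∀ a : A,
    Sym2.map (fun v => vEquiv v) (CGraph.endsOf H (eEquiv.symm (Sum.inr a))) =
      s((aVert a, (aPair a).1), (aVert a, (aPair a).2))
  count1 : ∀ v : T.V, CGraph.valence T v = 1 →
    (Finset.univ.filter fun a : A => aVert a = v).card = 2
  nonparallel : ∀ a b : A, a ≠ b → aVert a = aVert b →
    s((aPair a).1, (aPair a).2) ≠ s((aPair b).1, (aPair b).2)
  count2 : ∀ v : T.V, CGraph.valence T v = 2 →
    (Finset.univ.filter fun a : A => aVert a = v).card = 1
  count3 : ∀ v : T.V, CGraph.valence T v = 3 →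
    (Finset.univ.filter fun a : A => aVert a = v).card = 0
  pathCond : (∀ v : T.V, CGraph.valence T v ≤ 2) →
    2 ≤ (Finset.univ.filter fun v : T.V => CGraph.valence T v = 2).card →
    ¬ ∃ p : Sym2 (Fin 3), ∀ a : A, CGraph.valence T (aVert a) = 2 →
        s((aPair a).1, (aPair a).2) = p

attribute [instance] LadderWitness.fA LadderWitness.dA

/-- `φ` is the canonical degree-`3` harmonic morphism `φ_T : G_T → T` of a
`3`-ladder: it sends each copy of `T` to `T` with index `1` and contracts the
added edges. -/
def IsLadderMorphism {T H : CGraph} (L : LadderWitness T H) (φ : CMorphism H T) : Prop :=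
  (∀ v : H.V, φ.vMap v = (L.vEquiv v).1) ∧
  (∀ (e : T.E) (i : Fin 3),
    φ.eMap (L.eEquiv.symm (Sum.inl (e, i))) = Sum.inl e ∧
    φ.mu (L.eEquiv.symm (Sum.inl (e, i))) = 1) ∧
  (∀ a : L.A, φ.eMap (L.eEquiv.symm (Sum.inr a)) = Sum.inr (L.aVert a))

/-- `H` is a `3`-ladder over `T`. -/
def IsThreeLadder (T H : CGraph) : Prop := Nonempty (LadderWitness T H)

/-! ### Chain stabilizations and induced edge classes -/

/-- Data exhibiting `G` as the stabilization of `H` obtained by suppressing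
the valence-two vertices: each edge of `G` corresponds to a chain of edges
of `H`. -/
structure ChainStab (H G : CGraph) where
  rho : H.E → G.E
  iota : G.V → H.V
  inj : Function.Injective iota
  vert_char : ∀ v : H.V, (∃ u, iota u = v) ↔ 3 ≤ CGraph.valence H v
  min2 : ∀ v : H.V, 2 ≤ CGraph.valence H v
  chain : ∀ eb : G.E, ∃ Lw : List (H.E × Bool),
    CGraph.IsWalk H Lw (iota (G.src eb)) (iota (G.tgt eb)) ∧ Lw ≠ [] ∧
    (Lw.map Prod.fst).Nodup ∧ ∀ h : H.E, rho h = eb ↔ h ∈ Lw.map Prod.fst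

/-- The number of classes of the equivalence relation induced on the edges of
the stabilization `G`: two edges of `G` are identified if their chains contain
`∼_φ`-equivalent edges of `H`. -/
noncomputable def inducedClassCount {H T G : CGraph} (φ : CMorphism H T)
    (cs : ChainStab H G) : ℕ :=
  Nat.card (Quot fun e₁ e₂ : G.E =>
    ∃ h₁ h₂ : H.E, cs.rho h₁ = e₁ ∧ cs.rho h₂ = e₂ ∧ classMap φ h₁ = classMap φ h₂)

/-! ### Cells, dimension and the local Riemann–Hurwitz condition -/

/-- A trigonal type together with a tracking of the edges of the covering
graph inside the edges of the underlying trigonal graph; its dimension is the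
number of classes `|E(G)/≤_φ|` of the cone `τ_{(G,w,φ)}`. -/
structure TrackedType : Type 1 where
  base : TrigonalType
  track : base.Gphi.E → Option base.G.E
  track_surj : ∀ eb : base.G.E, ∃ h, track h = some eb

/-- The dimension `|E(G)/≤_φ|` of the cone associated to a tracked trigonal
type. -/
noncomputable def TrackedType.dim (X : TrackedType) : ℕ :=
  Nat.card (Quot fun e₁ e₂ : X.base.G.E =>
    ∃ h₁ h₂ : X.base.Gphi.E, X.track h₁ = some e₁ ∧ X.track h₂ = some e₂ ∧
      classMap X.base.phi h₁ = classMap X.base.phi h₂)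

/-- Two maximal cells share a common codimension-one face, obtained by
contracting a single equivalence class of edges. -/
def AdjacentCells (X Y : WGraph) : Prop :=
  ∃ Z : WGraph, SingleClassContraction X Z ∧ SingleClassContraction Y Z

/-- The local Riemann–Hurwitz equation
`2 − 2 w(v) = m_φ(v) (2 − 2 w'(φ(v))) − Σ_{e ∈ E_v} (μ_φ(e) − 1)`. -/
def LocalRH {G T : CGraph} (φ : CMorphism G T) (wG : G.V → ℕ) (wT : T.V → ℕ) : Prop :=
  ∀ v : G.V, (2 : ℤ) - 2 * (wG v : ℤ) =
    (CMorphism.mVal φ v : ℤ) * (2 - 2 * (wT (φ.vMap v) : ℤ)) -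
      ∑ e : G.E, (CGraph.incid G e v : ℤ) * ((φ.mu e : ℤ) - 1)

open scoped Classical
namespace TG
open Relation CGraph

def bfsD {α : Type*} (R : α → α → Prop) (r : α) : ℕ → α → Prop
  | 0, v => v = r
  | n + 1, v => ∃ u, bfsD R r n u ∧ R u v

theorem bfs_exists {α : Type*} (R : α → α → Prop) (r : α) :
    ∃ rk : α → ℕ, ∀ v, ReflTransGen R r v → v ≠ r →
      ∃ u, ReflTransGen R r u ∧ R u v ∧ rk u < rk v := by
  let D := bfsD R r
  have hD : ∀ v, ReflTransGen R r v → ∃ n, D n v := by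
    intro v h
    induction h with
    | refl => exact ⟨0, rfl⟩
    | tail _ h2 ih => obtain ⟨n, hn⟩ := ih; exact ⟨n + 1, _, hn, h2⟩
  have hR : ∀ n v, D n v → ReflTransGen R r v := by
    intro n
    induction n with
    | zero => intro v h; have : v = r := h; subst this; exact .refl
    | succ n ih => rintro v ⟨u, hu, h⟩; exact (ih u hu).tail h
  refine ⟨fun v => if h : ∃ n, D n v then Nat.find h else 0, ?_⟩
  intro v hv hne
  have h := hD v hv
  have hs := Nat.find_spec h
  rcases hn : Nat.find h with _ | n
  · rw [hn] at hs; exact absurd hs hne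
  · rw [hn] at hs
    obtain ⟨u, hu, huv⟩ := hs
    refine ⟨u, hR _ _ hu, huv, ?_⟩
    have h' : ∃ n, D n u := ⟨n, hu⟩
    simp only [h, h', dif_pos]
    rw [hn]
    exact Nat.lt_succ_of_le (Nat.find_min' h' hu)

/-- Adjacency through edges of `S`. -/
def SAdj (G : CGraph) (S : Set G.E) (u v : G.V) : Prop :=
  ∃ e ∈ S, (G.src e = u ∧ G.tgt e = v) ∨ (G.src e = v ∧ G.tgt e = u)

theorem sreach_symm {G : CGraph} {S : Set G.E} {u v : G.V} (h : SReach G S u v) :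
    SReach G S v u := by
  induction h with
  | refl => exact .refl
  | tail _ h ih =>
    obtain ⟨e, he, h⟩ := h
    exact ReflTransGen.head ⟨e, he, h.symm⟩ ih

theorem sreach_mono {G : CGraph} {S S' : Set G.E} (hS : S ⊆ S') {u v : G.V}
    (h : SReach G S u v) : SReach G S' u v := by
  induction h with
  | refl => exact .refl
  | tail _ h ih =>
    obtain ⟨e, he, h⟩ := h
    exact ReflTransGen.tail ih ⟨e, hS he, h⟩

theorem sreach_trans {G : CGraph} {S : Set G.E} {u v w : G.V}
    (h : SReach G S u v) (h' : SReach G S v w) : SReach G S u w := ReflTransGen.trans h h'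

theorem sreach_refl {G : CGraph} {S : Set G.E} {u : G.V} : SReach G S u u := ReflTransGen.refl

theorem sreach_edge {G : CGraph} {S : Set G.E} {e : G.E} (he : e ∈ S) :
    SReach G S (G.src e) (G.tgt e) := ReflTransGen.single ⟨e, he, Or.inl ⟨rfl, rfl⟩⟩

theorem sreach_const {G : CGraph} {S : Set G.E} {β : Type*} (f : G.V → β)
    (hf : ∀ e ∈ S, f (G.src e) = f (G.tgt e)) {u v : G.V} (h : SReach G S u v) : f u = f v := by
  induction h with
  | refl => rfl
  | tail _ h ih =>
    obtain ⟨e, he, ⟨rfl, rfl⟩ | ⟨rfl, rfl⟩⟩ := h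
    · exact ih.trans (hf e he)
    · exact ih.trans (hf e he).symm

theorem sreach_map {G H : CGraph} {S : Set G.E} {S' : Set H.E} (f : G.V → H.V)
    (hf : ∀ e ∈ S, SReach H S' (f (G.src e)) (f (G.tgt e))) {u v : G.V} (h : SReach G S u v) :
    SReach H S' (f u) (f v) := by
  induction h with
  | refl => exact .refl
  | tail _ h ih =>
    obtain ⟨e, he, ⟨rfl, rfl⟩ | ⟨rfl, rfl⟩⟩ := h
    · exact sreach_trans ih (hf e he)
    · exact sreach_trans ih (sreach_symm (hf e he))

/-- BFS parents: injective assignment of edges. -/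
theorem bfs_edges (G : CGraph) (S : Set G.E) (r : G.V) :
    ∃ pe : {v : G.V // SReach G S r v ∧ v ≠ r} → G.E, Function.Injective pe ∧
      (∀ v, pe v ∈ S) ∧ (∀ v, SReach G S r (G.src (pe v)) ∧ SReach G S r (G.tgt (pe v))) ∧
      ∀ v, SReach G S r v → SReach G (Set.range pe) r v := by
  obtain ⟨rk, hrk⟩ := bfs_exists (SAdj G S) r
  have h1 : ∀ v : {v : G.V // SReach G S r v ∧ v ≠ r}, ∃ e ∈ S, ∃ u, SReach G S r u ∧ rk u < rk v ∧
      ((G.src e = u ∧ G.tgt e = v) ∨ (G.src e = v ∧ G.tgt e = u)) := by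
    rintro ⟨v, hv, hne⟩
    obtain ⟨u, hu, ⟨e, he, h⟩, hlt⟩ := hrk v hv hne
    exact ⟨e, he, u, hu, hlt, h⟩
  choose pe hS pu hu hlt hends using h1
  refine ⟨pe, ?_, hS, ?_, ?_⟩
  · intro v v' h
    have a := hends v
    have b := hends v'
    rw [← h] at b
    have l1 := hlt v
    have l2 := hlt v'
    apply Subtype.ext
    rcases a with ⟨a1, a2⟩ | ⟨a1, a2⟩ <;> rcases b with ⟨b1, b2⟩ | ⟨b1, b2⟩
    · exact a2.symm.trans b2
    · rw [← a1, b1] at l1; rw [← b2, a2] at l2; omega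
    · rw [← a2, b2] at l1; rw [← b1, a1] at l2; omega
    · exact a1.symm.trans b1
  · intro v
    rcases hends v with ⟨a1, a2⟩ | ⟨a1, a2⟩
    · rw [a1, a2]; exact ⟨hu v, v.2.1⟩
    · rw [a1, a2]; exact ⟨v.2.1, hu v⟩
  · intro v
    induction hn : rk v using Nat.strong_induction_on generalizing v with
    | _ n ih =>
      intro hv
      by_cases hne : v = r
      · subst hne; exact .refl
      · have := ih (rk (pu ⟨v, hv, hne⟩)) (by rw [← hn]; exact hlt ⟨v, hv, hne⟩) _ rfl (hu _)
        refine this.tail ⟨pe ⟨v, hv, hne⟩, ⟨_, rfl⟩, ?_⟩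
        exact hends ⟨v, hv, hne⟩

/-- Number of vertices of a connected piece. -/
theorem card_le_edges (G : CGraph) (S : Set G.E) (A : Finset G.V) (r : G.V) (hr : r ∈ A)
    (hA : ∀ v ∈ A, SReach G S r v) (hcl : ∀ e ∈ S, (G.src e ∈ A ↔ G.tgt e ∈ A)) :
    A.card ≤ (Finset.univ.filter fun e : G.E => e ∈ S ∧ G.src e ∈ A).card + 1 := by
  obtain ⟨pe, hinj, hS, hR, -⟩ := bfs_edges G S r
  have hmem : ∀ v, SReach G S r v → v ∈ A := by
    intro v h
    have := sreach_const (fun v => v ∈ A) (by intro e he; exact propext (hcl e he)) h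
    simp only [eq_iff_iff] at this
    exact this.1 hr
  have : (A.erase r).card ≤ (Finset.univ.filter fun e : G.E => e ∈ S ∧ G.src e ∈ A).card := by
    calc (A.erase r).card ≤ (Finset.univ.image
            (Subtype.val : {v : G.V // SReach G S r v ∧ v ≠ r} → G.V)).card := by
          apply Finset.card_le_card
          intro v hv
          rw [Finset.mem_erase] at hv
          exact Finset.mem_image.2 ⟨⟨v, hA v hv.2, hv.1⟩, Finset.mem_univ _, rfl⟩
      _ ≤ (Finset.univ : Finset {v : G.V // SReach G S r v ∧ v ≠ r}).card :=
          Finset.card_image_le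
      _ = (Finset.univ.image pe).card := (Finset.card_image_of_injective _ hinj).symm
      _ ≤ _ := by
          apply Finset.card_le_card
          intro e he
          obtain ⟨v, -, rfl⟩ := Finset.mem_image.1 he
          simp only [Finset.mem_filter, Finset.mem_univ, true_and]
          exact ⟨hS v, hmem _ (hR v).1⟩
  rw [Finset.card_erase_of_mem hr] at this
  omega
end TG

open scoped Classical
namespace TG
open Relation CGraph

/-- `K` is obtained from `G` by contracting a forest (the edges not in the range of `fe`). -/
structure Ctr (G K : CGraph) where
  c : G.V → K.V
  fe : K.E → G.E
  surj : Function.Surjective c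
  inj : Function.Injective fe
  ends : ∀ e, (K.src e = c (G.src (fe e)) ∧ K.tgt e = c (G.tgt (fe e))) ∨
    (K.src e = c (G.tgt (fe e)) ∧ K.tgt e = c (G.src (fe e)))
  fib : ∀ u v, c u = c v → SReach G (Set.range fe)ᶜ u v
  drop : ∀ e, e ∉ Set.range fe → c (G.src e) = c (G.tgt e)
  card : Fintype.card G.E + Fintype.card K.V = Fintype.card K.E + Fintype.card G.V

theorem valence_sum (G : CGraph) (A : Finset G.V) :
    ∑ v ∈ A, valence G v =
      ∑ e : G.E, ((if G.src e ∈ A then 1 else 0) + (if G.tgt e ∈ A then 1 else 0)) := by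
  unfold valence incid
  rw [Finset.sum_comm]
  refine Finset.sum_congr rfl fun e _ => ?_
  rw [Finset.sum_add_distrib]
  simp

theorem valence_total (G : CGraph) : ∑ v, valence G v = 2 * Fintype.card G.E := by
  rw [valence_sum]; simp [mul_comm]

namespace Ctr
variable {G H K : CGraph}

theorem card_drop (π : Ctr G K) (k : K.V) :
    (Finset.univ.filter fun e : G.E => e ∉ Set.range π.fe ∧ π.c (G.src e) = k).card + 1 =
      (Finset.univ.filter fun v : G.V => π.c v = k).card := by
  have hle : ∀ k : K.V, (Finset.univ.filter fun v : G.V => π.c v = k).card ≤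
      (Finset.univ.filter fun e : G.E => e ∉ Set.range π.fe ∧ π.c (G.src e) = k).card + 1 := by
    intro k
    obtain ⟨r, hr⟩ := π.surj k
    have := card_le_edges G (Set.range π.fe)ᶜ (Finset.univ.filter fun v : G.V => π.c v = k) r
      (by simpa using hr)
      (by intro v hv; exact π.fib _ _ (by rw [hr]; simpa using Eq.symm (by simpa using hv)))
      (by intro e he; simp [π.drop e he])
    simpa using this
  have hsum : ∑ k : K.V, ((Finset.univ.filter fun e : G.E =>
      e ∉ Set.range π.fe ∧ π.c (G.src e) = k).card + 1) =
      ∑ k : K.V, (Finset.univ.filter fun v : G.V => π.c v = k).card := by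
    rw [Finset.sum_add_distrib]
    have h1 : ∑ k : K.V, (Finset.univ.filter fun v : G.V => π.c v = k).card =
        Fintype.card G.V := by
      rw [← Finset.card_univ, Finset.card_eq_sum_card_fiberwise (f := π.c) (t := Finset.univ)]
      intro x _; simp
    have h2 : ∑ k : K.V, (Finset.univ.filter fun e : G.E =>
        e ∉ Set.range π.fe ∧ π.c (G.src e) = k).card =
        (Finset.univ.filter fun e : G.E => e ∉ Set.range π.fe).card := by
      rw [Finset.card_eq_sum_card_fiberwise (f := fun e => π.c (G.src e)) (t := Finset.univ)]
      · simp only [Finset.filter_filter]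
      · intro x _; simp
    have h3 : (Finset.univ.filter fun e : G.E => e ∉ Set.range π.fe).card + Fintype.card K.E =
        Fintype.card G.E := by
      have h4 : (Finset.univ.filter fun e : G.E => e ∈ Set.range π.fe).card = Fintype.card K.E := by
        rw [← Finset.card_univ, ← Finset.card_image_of_injective _ π.inj]
        congr 1; ext e; simp
      rw [← h4, add_comm, Finset.card_filter_add_card_filter_not]
      simp
    have := π.card
    simp only [Finset.sum_const, Finset.card_univ, smul_eq_mul, mul_one]
    omega
  have := (Finset.sum_eq_sum_iff_of_le (fun k _ => hle k)).1 hsum.symm k (Finset.mem_univ k)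
  omega

theorem valence_eq (π : Ctr G K) (k : K.V) :
    ∑ v ∈ Finset.univ.filter (fun v : G.V => π.c v = k), valence G v + 2 =
      valence K k + 2 * (Finset.univ.filter fun v : G.V => π.c v = k).card := by
  rw [valence_sum, ← π.card_drop k]
  have h1 : valence K k = ∑ e ∈ Finset.univ.filter (fun e : G.E => e ∈ Set.range π.fe),
      ((if π.c (G.src e) = k then 1 else 0) + (if π.c (G.tgt e) = k then 1 else 0)) := by
    have : Finset.univ.filter (fun e : G.E => e ∈ Set.range π.fe) = Finset.univ.image π.fe := by
      ext e; simp
    rw [this, Finset.sum_image (fun a _ b _ h => π.inj h)]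
    unfold valence incid
    refine Finset.sum_congr rfl fun e _ => ?_
    rcases π.ends e with ⟨h, h'⟩ | ⟨h, h'⟩
    · rw [h, h']
    · rw [h, h', add_comm]
  have h2 : 2 * (Finset.univ.filter fun e : G.E =>
      e ∉ Set.range π.fe ∧ π.c (G.src e) = k).card =
      ∑ e ∈ Finset.univ.filter (fun e : G.E => ¬ e ∈ Set.range π.fe),
      ((if π.c (G.src e) = k then 1 else 0) + (if π.c (G.tgt e) = k then 1 else 0)) := by
    rw [← Finset.filter_filter, Finset.card_filter, Finset.mul_sum]
    refine Finset.sum_congr rfl fun e he => ?_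
    rw [← π.drop e (by simpa using he)]
    split_ifs <;> rfl
  have h3 := Finset.sum_filter_add_sum_filter_not Finset.univ (fun e : G.E => e ∈ Set.range π.fe)
    (fun e => ((if π.c (G.src e) = k then 1 else 0) + (if π.c (G.tgt e) = k then 1 else 0)))
  simp only [Finset.mem_filter, Finset.mem_univ, true_and]
  rw [mul_add, h2, h1, ← h3]
  ring

def refl (G : CGraph) : Ctr G G where
  c := id
  fe := id
  surj := Function.surjective_id
  inj := Function.injective_id
  ends := fun e => Or.inl ⟨rfl, rfl⟩
  fib := by intro u v h; have : u = v := h; subst this; exact .refl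
  drop := by intro e he; exact absurd ⟨e, rfl⟩ he
  card := rfl

def ofIso (i : CIso G H) : Ctr G H where
  c := i.vEquiv
  fe := i.eEquiv.symm
  surj := i.vEquiv.surjective
  inj := i.eEquiv.symm.injective
  ends := by
    intro e
    have := i.ends (i.eEquiv.symm e)
    unfold sameEndsMapC at this
    simp only [Equiv.apply_symm_apply] at this
    rcases this with ⟨a, b⟩ | ⟨a, b⟩
    · exact Or.inl ⟨a.symm, b.symm⟩
    · exact Or.inr ⟨b.symm, a.symm⟩
  fib := by intro u v h; have : u = v := i.vEquiv.injective h; subst this; exact .refl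
  drop := by intro e he; exact absurd ⟨i.eEquiv e, by simp⟩ he
  card := by
    rw [Fintype.card_congr i.vEquiv, Fintype.card_congr i.eEquiv]

def trans (π : Ctr G H) (ρ : Ctr H K) : Ctr G K where
  c := ρ.c ∘ π.c
  fe := π.fe ∘ ρ.fe
  surj := ρ.surj.comp π.surj
  inj := π.inj.comp ρ.inj
  ends := by
    intro e
    simp only [Function.comp]
    rcases ρ.ends e with ⟨a, b⟩ | ⟨a, b⟩ <;> rcases π.ends (ρ.fe e) with ⟨c, d⟩ | ⟨c, d⟩ <;>
      rw [a, b, c, d] <;> simp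
  fib := by
    intro u v h
    have hsub : (Set.range π.fe)ᶜ ⊆ (Set.range (π.fe ∘ ρ.fe))ᶜ := by
      rw [Set.compl_subset_compl]; exact Set.range_comp_subset_range _ _
    have key : ∀ x y, SReach H (Set.range ρ.fe)ᶜ x y → ∀ u v, π.c u = x → π.c v = y →
        SReach G (Set.range (π.fe ∘ ρ.fe))ᶜ u v := by
      intro x y h
      induction h with
      | refl => intro u v hu hv; exact sreach_mono hsub (π.fib u v (hu.trans hv.symm))
      | tail _ h ih =>
        intro u v hu hv
        obtain ⟨e, he, h⟩ := h
        have he' : π.fe e ∈ (Set.range (π.fe ∘ ρ.fe))ᶜ := by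
          rintro ⟨e', he'⟩; exact he ⟨e', π.inj he'⟩
        have h1 := sreach_edge he'
        rcases π.ends e with ⟨a, b⟩ | ⟨a, b⟩ <;> rcases h with ⟨p, q⟩ | ⟨p, q⟩
        · exact sreach_trans (ih u _ hu (a.symm.trans p)) (sreach_trans h1
            (sreach_mono hsub (π.fib _ _ (by rw [hv, ← q, b]))))
        · exact sreach_trans (ih u _ hu (b.symm.trans q)) (sreach_trans (sreach_symm h1)
            (sreach_mono hsub (π.fib _ _ (by rw [hv, ← p, a]))))
        · exact sreach_trans (ih u _ hu (a.symm.trans p)) (sreach_trans (sreach_symm h1)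
            (sreach_mono hsub (π.fib _ _ (by rw [hv, ← q, b]))))
        · exact sreach_trans (ih u _ hu (b.symm.trans q)) (sreach_trans h1
            (sreach_mono hsub (π.fib _ _ (by rw [hv, ← p, a]))))
    exact key _ _ (ρ.fib _ _ h) u v rfl rfl
  drop := by
    intro e he
    simp only [Function.comp]
    by_cases h : e ∈ Set.range π.fe
    · obtain ⟨e', rfl⟩ := h
      have := ρ.drop e' (by rintro ⟨x, rfl⟩; exact he ⟨x, rfl⟩)
      rcases π.ends e' with ⟨a, b⟩ | ⟨a, b⟩
      · rw [← a, ← b, this]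
      · rw [← a, ← b, this]
    · rw [π.drop e h]
  card := by have := π.card; have := ρ.card; omega

/-- Factorization. -/
theorem factor (π : Ctr G H) (ρ : Ctr G K) (h : Set.range ρ.fe ⊆ Set.range π.fe) :
    Nonempty (Ctr H K) := by
  have hc : ∀ u v, π.c u = π.c v → ρ.c u = ρ.c v := fun u v huv =>
    sreach_const (S := (Set.range π.fe)ᶜ) ρ.c (fun e he => ρ.drop e (fun h1 => he (h h1))) (π.fib u v huv)
  choose s hs using π.surj
  have hsc : ∀ u, ρ.c (s (π.c u)) = ρ.c u := fun u => hc _ _ (hs _)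
  choose t ht using fun e => h ⟨e, rfl⟩
  have hr : ∀ x, π.fe x ∈ Set.range ρ.fe ↔ x ∈ Set.range t := by
    intro x; constructor
    · rintro ⟨e, he⟩; exact ⟨e, π.inj (by rw [ht, he])⟩
    · rintro ⟨e, rfl⟩; exact ⟨e, (ht e).symm⟩
  refine ⟨⟨fun x => ρ.c (s x), t, ?_, ?_, ?_, ?_, ?_, ?_⟩⟩
  · intro k; obtain ⟨u, rfl⟩ := ρ.surj k; exact ⟨π.c u, hsc u⟩
  · intro a b hab; apply ρ.inj; rw [← ht, ← ht, hab]
  · intro e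
    rcases ρ.ends e with ⟨a, b⟩ | ⟨a, b⟩ <;> rcases π.ends (t e) with ⟨c, d⟩ | ⟨c, d⟩ <;>
      rw [a, b, c, d, ht, hsc, hsc] <;> simp
  · intro x y hxy
    have h1 := ρ.fib _ _ hxy
    have h2 := sreach_map (S' := (Set.range t)ᶜ) π.c (by
      intro e he
      by_cases h' : e ∈ Set.range π.fe
      · obtain ⟨x, rfl⟩ := h'
        have hx : x ∈ (Set.range t)ᶜ := fun h' => he ((hr x).2 h')
        rcases π.ends x with ⟨a, b⟩ | ⟨a, b⟩
        · rw [← a, ← b]; exact sreach_edge hx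
        · rw [← a, ← b]; exact sreach_symm (sreach_edge hx)
      · rw [π.drop e h']; exact .refl) h1
    rwa [hs, hs] at h2
  · intro x hx
    have := ρ.drop (π.fe x) (fun h' => hx ((hr x).1 h'))
    rcases π.ends x with ⟨a, b⟩ | ⟨a, b⟩
    · rw [a, b, hsc, hsc, this]
    · rw [a, b, hsc, hsc, this]
  · have := π.card; have := ρ.card; omega

/-- If all edges at `v` are kept, the fiber of `v` is a singleton. -/
theorem fiber_single (π : Ctr G K) (v : G.V)
    (h : ∀ e, Incident G e v → e ∈ Set.range π.fe) : valence K (π.c v) = valence G v := by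
  have hs : ∀ u, π.c u = π.c v → u = v := by
    intro u hu
    have h1 := π.fib _ _ hu
    rcases ReflTransGen.cases_tail h1 with h2 | ⟨w, -, e, he, h2⟩
    · exact h2.symm
    · exact absurd (h e (by rcases h2 with h2 | h2; exacts [Or.inr h2.2, Or.inl h2.1])) he
  have h2 := π.valence_eq (π.c v)
  have h3 : (Finset.univ.filter fun u : G.V => π.c u = π.c v) = {v} := by
    ext u; simp only [Finset.mem_filter, Finset.mem_univ, true_and, Finset.mem_singleton]
    exact ⟨hs u, fun h => by rw [h]⟩
  rw [h3] at h2; simp at h2; omega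

theorem toIso (π : Ctr G K) (h : Fintype.card G.V = Fintype.card K.V) : Nonempty (CIso G K) := by
  have h1 : Function.Bijective π.c :=
    (Fintype.bijective_iff_surjective_and_card _).2 ⟨π.surj, h⟩
  have h2 : Function.Bijective π.fe :=
    (Fintype.bijective_iff_injective_and_card _).2 ⟨π.inj, by have := π.card; omega⟩
  refine ⟨⟨Equiv.ofBijective _ h1, (Equiv.ofBijective _ h2).symm, ?_⟩⟩
  intro e
  obtain ⟨e, rfl⟩ := (Equiv.ofBijective _ h2).surjective e
  rw [Equiv.symm_apply_apply]
  simp only [sameEndsMapC, Equiv.ofBijective_apply]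
  rcases π.ends e with ⟨a, b⟩ | ⟨a, b⟩
  · exact Or.inl ⟨a.symm, b.symm⟩
  · exact Or.inr ⟨b.symm, a.symm⟩

theorem card_le (π : Ctr G K) : Fintype.card K.V ≤ Fintype.card G.V :=
  Fintype.card_le_of_surjective _ π.surj

/-- A contraction from a stable graph to a cubic graph is an isomorphism. -/
theorem iso_of_cubic (π : Ctr G K) (hG : IsStable0 G) (hK : ∀ k, valence K k ≤ 3) :
    Nonempty (CIso G K) := by
  apply π.toIso
  have h1 : ∀ k, (Finset.univ.filter fun v : G.V => π.c v = k).card ≤ 1 := by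
    intro k
    have := π.valence_eq k
    have h2 := Finset.card_nsmul_le_sum (Finset.univ.filter fun v : G.V => π.c v = k)
      (fun v => valence G v) 3 (fun v _ => hG v)
    have := hK k
    simp only [smul_eq_mul] at h2
    omega
  apply le_antisymm _ π.card_le
  apply Fintype.card_le_of_injective π.c
  intro u v huv
  exact Finset.card_le_one.1 (h1 (π.c v)) u (by simpa using huv) v (by simp)

end Ctr
end TG

open scoped Classical
namespace TG
open Relation CGraph

variable {G H K : CGraph}

theorem ctr_drop_one (v₀ u₀ : G.V) (e₀ : G.E) (hne : u₀ ≠ v₀)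
    (he₀ : (G.src e₀ = v₀ ∧ G.tgt e₀ = u₀) ∨ (G.src e₀ = u₀ ∧ G.tgt e₀ = v₀))
    (fv : H.V ≃ {v : G.V // v ≠ v₀}) (fe : H.E → G.E) (inj : Function.Injective fe)
    (hr : Set.range fe = {e₀}ᶜ)
    (ends : ∀ e, ((fv (H.src e)).1 = (if G.src (fe e) = v₀ then u₀ else G.src (fe e)) ∧
        (fv (H.tgt e)).1 = (if G.tgt (fe e) = v₀ then u₀ else G.tgt (fe e))) ∨
      ((fv (H.src e)).1 = (if G.tgt (fe e) = v₀ then u₀ else G.tgt (fe e)) ∧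
        (fv (H.tgt e)).1 = (if G.src (fe e) = v₀ then u₀ else G.src (fe e)))) :
    ∃ π : Ctr G H, Set.range π.fe = {e₀}ᶜ ∧ ∀ x : H.V, π.c (fv x).1 = x := by
  let r : G.V → {v : G.V // v ≠ v₀} := fun u => if h : u = v₀ then ⟨u₀, hne⟩ else ⟨u, h⟩
  have r0 : r v₀ = ⟨u₀, hne⟩ := by simp [r]
  have r1 : ∀ u : {v : G.V // v ≠ v₀}, r u.1 = u := by intro u; simp [r, u.2]
  have rv : ∀ u, (r u).1 = if u = v₀ then u₀ else u := by
    intro u; by_cases h : u = v₀ <;> simp [r, h]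
  have hR : SReach G {e₀} v₀ u₀ := by
    rcases he₀ with ⟨a, b⟩ | ⟨a, b⟩
    · have := sreach_edge (G := G) (S := {e₀}) (Set.mem_singleton e₀); rwa [a, b] at this
    · have := sreach_edge (G := G) (S := {e₀}) (Set.mem_singleton e₀); rw [a, b] at this
      exact sreach_symm this
  have hR' : ∀ u, SReach G {e₀} u (r u).1 := by
    intro u; rw [rv]; split_ifs with h
    · rw [h]; exact hR
    · exact .refl
  refine ⟨⟨fun u => fv.symm (r u), fe, ?_, inj, ?_, ?_, ?_, ?_⟩, hr, ?_⟩
  · intro x; exact ⟨(fv x).1, by simp [r1]⟩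
  · intro e
    simp only [Equiv.eq_symm_apply, Subtype.ext_iff, rv]
    exact ends e
  · intro u v huv
    have huv : r u = r v := fv.symm.injective huv
    rw [hr, compl_compl]
    refine sreach_trans (hR' u) (sreach_trans ?_ (sreach_symm (hR' v)))
    rw [huv]; exact .refl
  · intro e he
    have : e = e₀ := by rw [hr] at he; simpa using he
    subst this
    simp only [EmbeddingLike.apply_eq_iff_eq, Subtype.ext_iff, rv]
    rcases he₀ with ⟨a, b⟩ | ⟨a, b⟩ <;> simp [a, b, hne]
  · have h1 : Fintype.card H.V + 1 = Fintype.card G.V := by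
      rw [Fintype.card_congr fv, Fintype.card_subtype_compl, Fintype.card_subtype_eq]
      have : 0 < Fintype.card G.V := Fintype.card_pos_iff.2 ⟨v₀⟩
      omega
    have h2 : Fintype.card H.E + 1 = Fintype.card G.E := by
      have : Fintype.card H.E = (Finset.univ.image fe).card := by
        rw [Finset.card_image_of_injective _ inj, Finset.card_univ]
      have h3 : Finset.univ.image fe = Finset.univ.erase e₀ := by
        ext e
        have : e ∈ Set.range fe ↔ e ∈ ({e₀}ᶜ : Set G.E) := by rw [hr]
        simpa using this
      rw [this, h3, Finset.card_erase_of_mem (Finset.mem_univ _), Finset.card_univ]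
      have : 0 < Fintype.card G.E := Fintype.card_pos_iff.2 ⟨e₀⟩
      omega
    omega
  · intro x; simp [r1]

theorem two_le_of_loop {e : G.E} {v : G.V} (h : G.src e = v) (h' : G.tgt e = v) :
    2 ≤ valence G v := by
  have : incid G e v ≤ valence G v :=
    Finset.single_le_sum (f := fun e => incid G e v) (fun _ _ => Nat.zero_le _) (Finset.mem_univ e)
  simpa [incid, h, h'] using this

theorem incid_pos {e : G.E} {v : G.V} : 1 ≤ incid G e v ↔ Incident G e v := by
  unfold incid Incident; split_ifs <;> simp_all

theorem incid_le (e : G.E) (v : G.V) : incid G e v ≤ 2 := by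
  unfold incid; split_ifs <;> simp

theorem incid_sum_le (A : Finset G.E) (v : G.V) : ∑ e ∈ A, incid G e v ≤ valence G v :=
  Finset.sum_le_sum_of_subset (Finset.subset_univ A)

theorem leaf_ctr {v₀ : G.V} {e₀ : G.E} (hv : valence G v₀ = 1) (hi : Incident G e₀ v₀)
    (fv : H.V ≃ {v : G.V // v ≠ v₀}) (fe : H.E ≃ {e : G.E // e ≠ e₀})
    (he : ∀ e : H.E, sameEndsMapC H G (fun v => (fv v).1) e (fe e).1) :
    ∃ π : Ctr G H, Set.range π.fe = {e₀}ᶜ := by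
  have h1 : ∃ u₀, u₀ ≠ v₀ ∧
      ((G.src e₀ = v₀ ∧ G.tgt e₀ = u₀) ∨ (G.src e₀ = u₀ ∧ G.tgt e₀ = v₀)) := by
    rcases hi with hi | hi
    · exact ⟨G.tgt e₀, fun h => by have := two_le_of_loop hi h; omega, Or.inl ⟨hi, rfl⟩⟩
    · exact ⟨G.src e₀, fun h => by have := two_le_of_loop h hi; omega, Or.inr ⟨rfl, hi⟩⟩
  obtain ⟨u₀, hne, hu⟩ := h1
  suffices h : ∃ π : Ctr G H, Set.range π.fe = {e₀}ᶜ ∧ ∀ x : H.V, π.c (fv x).1 = x from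
    ⟨h.choose, h.choose_spec.1⟩
  refine ctr_drop_one v₀ u₀ e₀ hne hu fv (fun e => (fe e).1) ?_ ?_ ?_
  · intro a b h; exact fe.injective (Subtype.ext h)
  · ext e; constructor
    · rintro ⟨a, rfl⟩; exact (fe a).2
    · intro h; exact ⟨fe.symm ⟨e, h⟩, by simp⟩
  · intro e
    have h2 := (fv (H.src e)).2
    have h3 := (fv (H.tgt e)).2
    rcases he e with ⟨a, b⟩ | ⟨a, b⟩
    · left; rw [← a, ← b, if_neg h2, if_neg h3]; exact ⟨rfl, rfl⟩
    · right; rw [← a, ← b, if_neg h2, if_neg h3]; exact ⟨rfl, rfl⟩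

theorem series_ctr {v₀ : G.V} {e₁ e₂ : G.E} {u₁ u₂ : G.V} (h12 : e₁ ≠ e₂) 
    (hu₁ : u₁ ≠ v₀) (hu₂ : u₂ ≠ v₀)
    (h1 : ({G.src e₁, G.tgt e₁} : Set G.V) = {v₀, u₁})
    (h2 : ({G.src e₂, G.tgt e₂} : Set G.V) = {v₀, u₂})
    (fv : H.V ≃ {v : G.V // v ≠ v₀}) (ebar : H.E)
    (fe : {e : H.E // e ≠ ebar} ≃ {e : G.E // e ≠ e₁ ∧ e ≠ e₂})
    (hb : ({(fv (H.src ebar)).1, (fv (H.tgt ebar)).1} : Set G.V) = {u₁, u₂})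
    (he : ∀ e : {e : H.E // e ≠ ebar}, sameEndsMapC H G (fun v => (fv v).1) e.1 (fe e).1) :
    ∃ π : Ctr G H, Set.range π.fe = {e₁}ᶜ := by
  rw [Set.pair_eq_pair_iff] at h1 h2 hb
  suffices h : ∃ π : Ctr G H, Set.range π.fe = {e₁}ᶜ ∧ ∀ x : H.V, π.c (fv x).1 = x from
    ⟨h.choose, h.choose_spec.1⟩
  refine ctr_drop_one v₀ u₁ e₁ hu₁ (by tauto) fv
    (fun e => if h : e = ebar then e₂ else (fe ⟨e, h⟩).1) ?_ ?_ ?_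
  · intro a b h
    by_cases ha : a = ebar <;> by_cases hb : b = ebar
    · rw [ha, hb]
    · simp only [ha, hb, dif_pos, dif_neg, not_false_eq_true] at h
      exact absurd h.symm (fe ⟨b, hb⟩).2.2
    · simp only [ha, hb, dif_pos, dif_neg, not_false_eq_true] at h
      exact absurd h (fe ⟨a, ha⟩).2.2
    · simp only [ha, hb, dif_neg, not_false_eq_true] at h
      have := fe.injective (Subtype.ext h)
      simpa using this
  · ext e; constructor
    · rintro ⟨a, rfl⟩
      by_cases ha : a = ebar
      · simp [ha, h12.symm]
      · simp only [ha, dif_neg, not_false_eq_true]; exact (fe ⟨a, ha⟩).2.1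
    · intro h
      by_cases h' : e = e₂
      · exact ⟨ebar, by simp [h']⟩
      · refine ⟨(fe.symm ⟨e, h, h'⟩).1, ?_⟩
        show (if h : _ then _ else _) = e
        rw [dif_neg (fe.symm ⟨e, h, h'⟩).2]; simp
  · intro e
    by_cases ha : e = ebar
    · subst ha
      simp only [dif_pos]
      rcases hb with ⟨a, b⟩ | ⟨a, b⟩ <;> rcases h2 with ⟨c, d⟩ | ⟨c, d⟩ <;>
        rw [a, b, c, d] <;> simp [hu₂]
    · simp only [ha, dif_neg, not_false_eq_true]
      have h2 := (fv (H.src e)).2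
      have h3 := (fv (H.tgt e)).2
      rcases he ⟨e, ha⟩ with ⟨a, b⟩ | ⟨a, b⟩
      · left; rw [← a, ← b, if_neg h2, if_neg h3]; exact ⟨rfl, rfl⟩
      · right; rw [← a, ← b, if_neg h2, if_neg h3]; exact ⟨rfl, rfl⟩

theorem series_ctr' {v₀ : G.V} {e₁ e₂ : G.E} {u₁ u₂ : G.V} (h12 : e₁ ≠ e₂) 
    (hu₁ : u₁ ≠ v₀) (hu₂ : u₂ ≠ v₀)
    (h1 : ({G.src e₁, G.tgt e₁} : Set G.V) = {v₀, u₁})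
    (h2 : ({G.src e₂, G.tgt e₂} : Set G.V) = {v₀, u₂})
    (fv : H.V ≃ {v : G.V // v ≠ v₀}) (ebar : H.E)
    (fe : {e : H.E // e ≠ ebar} ≃ {e : G.E // e ≠ e₁ ∧ e ≠ e₂})
    (hb : ({(fv (H.src ebar)).1, (fv (H.tgt ebar)).1} : Set G.V) = {u₁, u₂})
    (he : ∀ e : {e : H.E // e ≠ ebar}, sameEndsMapC H G (fun v => (fv v).1) e.1 (fe e).1) :
    ∃ π : Ctr G H, Set.range π.fe = {e₂}ᶜ := by
  refine series_ctr (u₁ := u₂) (u₂ := u₁) (e₁ := e₂) (e₂ := e₁) h12.symm hu₂ hu₁ h2 h1 fv ebar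
    (fe.trans (Equiv.subtypeEquivRight (fun e => and_comm))) ?_ ?_
  · rw [hb]; exact Set.pair_comm _ _
  · intro e; exact he e

theorem Ctr.ofStep (h : Step0 G H) : Nonempty (Ctr G H) := by
  rcases h with ⟨v₀, e₀, hv, hi, fv, fe, he⟩ |
    ⟨v₀, e₁, e₂, u₁, u₂, h12, hv, hu₁, hu₂, h1, h2, fv, ebar, fe, hb, he⟩ | ⟨⟨i⟩⟩
  · exact ⟨(leaf_ctr hv hi fv fe he).choose⟩
  · exact ⟨(series_ctr h12 hu₁ hu₂ h1 h2 fv ebar fe hb he).choose⟩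
  · exact ⟨Ctr.ofIso i⟩

theorem Ctr.ofStab (h : StabReduces0 G H) : Nonempty (Ctr G H) := by
  induction h with
  | refl => exact ⟨Ctr.refl G⟩
  | tail _ h ih => obtain ⟨π⟩ := ih; obtain ⟨ρ⟩ := Ctr.ofStep h; exact ⟨π.trans ρ⟩

def _root_.CIso.symm' (i : CIso G H) : CIso H G where
  vEquiv := i.vEquiv.symm
  eEquiv := i.eEquiv.symm
  ends := by
    intro e
    have := i.ends (i.eEquiv.symm e)
    simp only [sameEndsMapC, Equiv.apply_symm_apply] at this ⊢
    rcases this with ⟨a, b⟩ | ⟨a, b⟩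
    · left; rw [← a, ← b]; simp
    · right; rw [← a, ← b]; simp

def _root_.CIso.refl' (G : CGraph) : CIso G G := ⟨Equiv.refl _, Equiv.refl _, fun _ => Or.inl ⟨rfl, rfl⟩⟩

def _root_.CIso.trans' (i : CIso G H) (j : CIso H K) : CIso G K where
  vEquiv := i.vEquiv.trans j.vEquiv
  eEquiv := i.eEquiv.trans j.eEquiv
  ends := by
    intro e
    have h1 := i.ends e
    have h2 := j.ends (i.eEquiv e)
    simp only [sameEndsMapC, Equiv.trans_apply] at *
    rcases h1 with ⟨a, b⟩ | ⟨a, b⟩ <;> rcases h2 with ⟨c, d⟩ | ⟨c, d⟩ <;> rw [a, b, c, d] <;> simp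

theorem _root_.CIso.card (i : CIso G H) : Fintype.card G.V = Fintype.card H.V :=
  Fintype.card_congr i.vEquiv

theorem _root_.CIso.cardE (i : CIso G H) : Fintype.card G.E = Fintype.card H.E :=
  Fintype.card_congr i.eEquiv

theorem _root_.CIso.incid (i : CIso G H) (e : G.E) (v : G.V) :
    incid H (i.eEquiv e) (i.vEquiv v) = incid G e v := by
  unfold CGraph.incid
  rcases i.ends e with ⟨a, b⟩ | ⟨a, b⟩
  · simp only [← a, ← b, EmbeddingLike.apply_eq_iff_eq]
  · simp only [← a, ← b, EmbeddingLike.apply_eq_iff_eq]; rw [add_comm]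

theorem _root_.CIso.valence (i : CIso G H) (v : G.V) : valence H (i.vEquiv v) = valence G v := by
  unfold CGraph.valence
  rw [← i.eEquiv.sum_comp]
  exact Finset.sum_congr rfl fun e _ => i.incid e v

theorem _root_.CIso.stable (i : CIso G H) (h : IsStable0 G) : IsStable0 H := by
  intro v
  obtain ⟨v, rfl⟩ := i.vEquiv.surjective v
  rw [i.valence]; exact h v

theorem Ctr.step (h : Step0 G H) (ρ : Ctr G K) (hK : IsStable0 K) : Nonempty (Ctr H K) := by
  rcases h with ⟨v₀, e₀, hv, hi, fv, fe, he⟩ |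
    ⟨v₀, e₁, e₂, u₁, u₂, h12, hv, hu₁, hu₂, h1, h2, fv, ebar, fe, hb, he⟩ | ⟨⟨i⟩⟩
  · obtain ⟨π, hπ⟩ := leaf_ctr hv hi fv fe he
    refine π.factor ρ ?_
    rw [hπ]; rintro _ ⟨x, rfl⟩ hx
    simp only [Set.mem_singleton_iff] at hx
    have := ρ.fiber_single v₀ (by
      intro e he
      by_cases h : e = e₀
      · rw [h, ← hx]; exact ⟨x, rfl⟩
      · have := incid_sum_le {e, e₀} v₀
        rw [Finset.sum_pair h] at this
        have := incid_pos.2 he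
        have := incid_pos.2 hi
        omega)
    have := hK (ρ.c v₀)
    omega
  · by_cases hd : e₁ ∈ Set.range ρ.fe ∧ e₂ ∈ Set.range ρ.fe
    · exfalso
      have i1 : Incident G e₁ v₀ := by
        have := Set.pair_eq_pair_iff.1 h1; unfold Incident; tauto
      have i2 : Incident G e₂ v₀ := by
        have := Set.pair_eq_pair_iff.1 h2; unfold Incident; tauto
      have := ρ.fiber_single v₀ (by
        intro e he
        by_cases h : e = e₁
        · rw [h]; exact hd.1
        by_cases h' : e = e₂
        · rw [h']; exact hd.2
        have := incid_sum_le {e, e₁, e₂} v₀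
        rw [Finset.sum_insert (by simp [h, h']), Finset.sum_pair h12] at this
        have := incid_pos.2 he
        have := incid_pos.2 i1
        have := incid_pos.2 i2
        omega)
      have := hK (ρ.c v₀)
      omega
    · rw [not_and_or] at hd
      rcases hd with hd | hd
      · obtain ⟨π, hπ⟩ := series_ctr h12 hu₁ hu₂ h1 h2 fv ebar fe hb he
        refine π.factor ρ ?_
        rw [hπ]; rintro _ hx rfl; exact hd hx
      · obtain ⟨π, hπ⟩ := series_ctr' h12 hu₁ hu₂ h1 h2 fv ebar fe hb he
        refine π.factor ρ ?_
        rw [hπ]; rintro _ hx rfl; exact hd hx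
  · exact ⟨(Ctr.ofIso (CIso.symm' i)).trans ρ⟩

theorem Ctr.stab (h : StabReduces0 G H) (ρ : Ctr G K) (hK : IsStable0 K) : Nonempty (Ctr H K) := by
  induction h with
  | refl => exact ⟨ρ⟩
  | tail _ h ih => obtain ⟨π⟩ := ih; exact π.step h hK

theorem stab_unique {K' : CGraph} (h : StabReduces0 G K) (h' : StabReduces0 G K') (hK : IsStable0 K)
    (hK' : IsStable0 K') : Nonempty (CIso K K') := by
  obtain ⟨p⟩ := Ctr.ofStab h
  obtain ⟨p'⟩ := Ctr.ofStab h'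
  obtain ⟨q⟩ := p.stab h' hK
  obtain ⟨q'⟩ := p'.stab h hK'
  exact q'.toIso (le_antisymm q.card_le q'.card_le)

theorem stab_iso (i : CIso G H) (h : StabReduces0 H K) : StabReduces0 G K :=
  ReflTransGen.head (Or.inr (Or.inr ⟨i⟩)) h

theorem stab_iso' (h : StabReduces0 G H) (i : CIso H K) : StabReduces0 G K :=
  ReflTransGen.tail h (Or.inr (Or.inr ⟨i⟩))

/-- If `G` contracts to a stable `K` and `G` has a stable reduction, it is `K` (up to iso)
as soon as counts agree; general version: the stable model contracts to `K`. -/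
theorem Ctr.stab_card (h : StabReduces0 G H) (ρ : Ctr G K) (hK : IsStable0 K)
    (hc : Fintype.card H.V = Fintype.card K.V) : Nonempty (CIso H K) := by
  obtain ⟨q⟩ := ρ.stab h hK
  exact q.toIso hc
end TG

open scoped Classical
namespace TG
open Relation CGraph

variable {G H K : CGraph}

theorem card_not_mem {S : Set G.E} (f : H.E ≃ {e : G.E // e ∉ S}) :
    Fintype.card G.E = Fintype.card H.E + (Finset.univ.filter fun e : G.E => e ∈ S).card := by
  rw [Fintype.card_congr f, Fintype.card_subtype, add_comm,
    Finset.card_filter_add_card_filter_not]; simp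

theorem fiber_sumV (c : G.V → H.V) :
    ∑ k, (Finset.univ.filter fun u : G.V => c u = k).card = Fintype.card G.V := by
  rw [← Finset.card_univ, Finset.card_eq_sum_card_fiberwise (f := c) (t := Finset.univ)]
  intro x _; simp

theorem fiber_sumS (c : G.V → H.V) (S : Set G.E) :
    ∑ k, (Finset.univ.filter fun e : G.E => e ∈ S ∧ c (G.src e) = k).card =
      (Finset.univ.filter fun e : G.E => e ∈ S).card := by
  rw [Finset.card_eq_sum_card_fiberwise (f := fun e => c (G.src e)) (t := Finset.univ)]
  · simp only [Finset.filter_filter]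
  · intro x _; simp

theorem cd_drop {S : Set G.E} (cd : ContractionData G S H) {e : G.E} (he : e ∈ S) :
    cd.c (G.src e) = cd.c (G.tgt e) := (cd.fibers _ _).2 (sreach_edge he)

theorem cd_count {S : Set G.E} (cd : ContractionData G S H) (k : H.V) :
    (Finset.univ.filter fun u : G.V => cd.c u = k).card ≤
      (Finset.univ.filter fun e : G.E => e ∈ S ∧ cd.c (G.src e) = k).card + 1 := by
  obtain ⟨r, hr⟩ := cd.surj k
  have := card_le_edges G S (Finset.univ.filter fun v : G.V => cd.c v = k) r
      (by simpa using hr)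
      (by intro v hv; rw [← cd.fibers, hr]; exact Eq.symm (by simpa using hv))
      (by intro e he; simp [cd_drop cd he])
  simpa using this

theorem Ctr.ofCD {S : Set G.E} (cd : ContractionData G S H) :
    Nonempty (Ctr G (withLoops H (contractedWeight cd fun _ => 0))) := by
  choose r hr using cd.surj
  choose pe pinj pS pR pC using fun k => bfs_edges G S (r k)
  have hk : ∀ k v, SReach G S (r k) v ↔ cd.c v = k := by
    intro k v; rw [← cd.fibers, hr]; exact eq_comm
  have hpk : ∀ k v, cd.c (G.src (pe k v)) = k := fun k v => (hk _ _).1 (pR k v).1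
  -- tree edges
  let Tr : Set G.E := {e | ∃ k v, pe k v = e}
  have hTS : Tr ⊆ S := by rintro _ ⟨k, v, rfl⟩; exact pS k v
  have hT : ∀ k, (Finset.univ.filter fun e : G.E => e ∈ Tr ∧ cd.c (G.src e) = k).card + 1 =
      (Finset.univ.filter fun u : G.V => cd.c u = k).card := by
    intro k
    have h1 : (Finset.univ.filter fun e : G.E => e ∈ Tr ∧ cd.c (G.src e) = k) =
        Finset.univ.image (pe k) := by
      ext e
      simp only [Finset.mem_filter, Finset.mem_univ, true_and, Finset.mem_image]
      constructor
      · rintro ⟨⟨k', v, rfl⟩, h⟩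
        rw [hpk] at h; subst h; exact ⟨v, rfl⟩
      · rintro ⟨v, rfl⟩; exact ⟨⟨k, v, rfl⟩, hpk k v⟩
    have h2 : (Finset.univ.filter fun u : G.V => cd.c u = k).erase (r k) =
        Finset.univ.filter fun v => SReach G S (r k) v ∧ v ≠ r k := by
      ext v; simp [hk, and_comm]
    rw [h1, Finset.card_image_of_injective _ (pinj k), Finset.card_univ, Fintype.card_subtype, ← h2,
      Finset.card_erase_of_mem (by simp [hr])]
    have : 0 < (Finset.univ.filter fun u : G.V => cd.c u = k).card :=
      Finset.card_pos.2 ⟨r k, by simp [hr]⟩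
    omega
  have hcw : ∀ k, contractedWeight cd (fun _ => 0) k =
      (Finset.univ.filter fun e : G.E => e ∈ S ∧ cd.c (G.src e) = k).card + 1 -
      (Finset.univ.filter fun u : G.V => cd.c u = k).card := by
    intro k; unfold contractedWeight; simp
  have hN : ∀ k, Fintype.card {e : G.E // e ∈ S ∧ e ∉ Tr ∧ cd.c (G.src e) = k} =
      contractedWeight cd (fun _ => 0) k := by
    intro k
    rw [hcw, ← hT k, Fintype.card_subtype]
    have : (Finset.univ.filter fun e : G.E => e ∈ S ∧ cd.c (G.src e) = k).card =
        (Finset.univ.filter fun e : G.E => e ∈ Tr ∧ cd.c (G.src e) = k).card +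
        (Finset.univ.filter fun e : G.E => e ∈ S ∧ e ∉ Tr ∧ cd.c (G.src e) = k).card := by
      rw [← Finset.card_union_of_disjoint]
      · congr 1; ext e
        have := @hTS e
        simp only [Finset.mem_filter, Finset.mem_univ, true_and, Finset.mem_union]; tauto
      · rw [Finset.disjoint_left]; intro e
        simp only [Finset.mem_filter, Finset.mem_univ, true_and]; tauto
    omega
  let q := fun k => (Fintype.equivFinOfCardEq (hN k)).symm
  let fe : (withLoops H (contractedWeight cd fun _ => 0)).E → G.E :=
    Sum.elim (fun e => (cd.fe e).1) (fun x => (q x.1 x.2).1)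
  have hr' : Set.range fe = Trᶜ := by
    ext e; constructor
    · rintro ⟨a | ⟨k, i⟩, rfl⟩
      · exact fun h => (cd.fe a).2 (hTS h)
      · exact (q k i).2.2.1
    · intro h
      by_cases hS : e ∈ S
      · exact ⟨Sum.inr ⟨cd.c (G.src e), (q _).symm ⟨e, hS, h, rfl⟩⟩, by simp [fe]⟩
      · exact ⟨Sum.inl (cd.fe.symm ⟨e, hS⟩), by simp [fe]⟩
  refine ⟨⟨cd.c, fe, cd.surj, ?_, ?_, ?_, ?_, ?_⟩⟩
  · rintro (a | ⟨k, i⟩) (b | ⟨l, j⟩) h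
    · exact congrArg Sum.inl (cd.fe.injective (Subtype.ext h))
    · exact absurd (show (cd.fe a).1 ∈ S by
        have : (cd.fe a).1 = (q l j).1 := h
        rw [this]; exact (q l j).2.1) (cd.fe a).2
    · exact absurd (show (cd.fe b).1 ∈ S by
        have : (q k i).1 = (cd.fe b).1 := h
        rw [← this]; exact (q k i).2.1) (cd.fe b).2
    · have h : (q k i).1 = (q l j).1 := h
      have : k = l := by rw [← (q k i).2.2.2, ← (q l j).2.2.2, h]
      subst this
      have := (q k).injective (Subtype.ext h)
      rw [this]
  · rintro (a | ⟨k, i⟩)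
    · exact cd.ends a
    · have h1 := (q k i).2.2.2
      have h2 := cd_drop cd (q k i).2.1
      exact Or.inl ⟨h1.symm, by rw [h1] at h2; exact h2⟩
  · intro u v h
    rw [hr', compl_compl]
    have h1 : ∀ u, SReach G Tr (r (cd.c u)) u := by
      intro u
      refine sreach_mono ?_ (pC (cd.c u) u ((hk _ _).2 rfl))
      rintro _ ⟨v, rfl⟩; exact ⟨_, v, rfl⟩
    have := h1 v
    rw [← h] at this
    exact sreach_trans (sreach_symm (h1 u)) this
  · intro e he
    rw [hr', Set.mem_compl_iff, not_not] at he
    exact cd_drop cd (hTS he)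
  · have h1 := card_not_mem cd.fe
    have h2 := fiber_sumV cd.c
    have h3 := fiber_sumS cd.c S
    have h4 : ∑ k, ((Finset.univ.filter fun e : G.E => e ∈ S ∧ cd.c (G.src e) = k).card + 1) =
        ∑ k, (contractedWeight cd (fun _ => 0) k +
          (Finset.univ.filter fun u : G.V => cd.c u = k).card) := by
      refine Finset.sum_congr rfl fun k _ => ?_
      have := cd_count cd k
      rw [hcw]; omega
    rw [Finset.sum_add_distrib, Finset.sum_add_distrib, h2, h3] at h4
    have h5 : Fintype.card (withLoops H (contractedWeight cd fun _ => 0)).E =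
        Fintype.card H.E + ∑ k, contractedWeight cd (fun _ => 0) k := by
      show Fintype.card (H.E ⊕ Σ v : H.V, Fin _) = _
      rw [Fintype.card_sum, Fintype.card_sigma]; simp
    have h6 : Fintype.card (withLoops H (contractedWeight cd fun _ => 0)).V = Fintype.card H.V := rfl
    simp only [Finset.sum_const, Finset.card_univ, smul_eq_mul, mul_one] at h4
    omega

theorem cw_zero {S : Set G.E} (cd : ContractionData G S H)
    (h : (Finset.univ.filter fun e : G.E => e ∈ S).card + Fintype.card H.V = Fintype.card G.V) :
    contractedWeight cd (fun _ => 0) = fun _ => 0 := by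
  funext k
  have h2 := fiber_sumV cd.c
  have h3 := fiber_sumS cd.c S
  have hsum : ∑ k, (Finset.univ.filter fun u : G.V => cd.c u = k).card =
     ∑ k, ((Finset.univ.filter fun e : G.E => e ∈ S ∧ cd.c (G.src e) = k).card + 1) := by
    rw [Finset.sum_add_distrib, h2, h3]; simp; omega
  have := (Finset.sum_eq_sum_iff_of_le (fun k _ => cd_count cd k)).1 hsum k (Finset.mem_univ k)
  simp only [contractedWeight, Finset.sum_const_zero]
  omega

def withLoopsZero (H : CGraph) : CIso (withLoops H fun _ => 0) H where
  vEquiv := Equiv.refl _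
  eEquiv :=
    { toFun := fun e => match e with
        | Sum.inl e => e
        | Sum.inr q => q.2.elim0
      invFun := Sum.inl
      left_inv := by rintro (e | q); exacts [rfl, q.2.elim0]
      right_inv := fun e => rfl }
  ends := by rintro (e | q); exacts [Or.inl ⟨rfl, rfl⟩, q.2.elim0]

/-- Converse packaging: a `Ctr` is a contraction datum with zero weights. -/
noncomputable def Ctr.toCD (π : Ctr G H) : ContractionData G (Set.range π.fe)ᶜ H where
  c := π.c
  fe := (Equiv.ofInjective _ π.inj).trans (Equiv.subtypeEquivRight (by intro x; simp))
  surj := π.surj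
  ends := by intro e; exact π.ends e
  fibers := by
    intro u v
    refine ⟨π.fib u v, fun h => sreach_const (S := (Set.range π.fe)ᶜ) π.c
      (fun e he => π.drop e he) h⟩

theorem Ctr.toCD_zero (π : Ctr G H) : contractedWeight π.toCD (fun _ => 0) = fun _ => 0 := by
  apply cw_zero
  have := card_not_mem π.toCD.fe
  have := π.card
  omega

theorem valence_withLoops (w : G.V → ℕ) (v : G.V) :
    valence (withLoops G w) v = valence G v + 2 * w v := by
  unfold valence
  show ∑ e : G.E ⊕ (Σ v : G.V, Fin (w v)), _ = _
  rw [Fintype.sum_sum_type]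
  congr 1
  rw [Fintype.sum_sigma]
  have : ∀ x, ∑ y : Fin (w x), incid (withLoops G w) (Sum.inr ⟨x, y⟩) v =
      if x = v then 2 * w x else 0 := by
    intro x
    have : ∀ y, incid (withLoops G w) (Sum.inr ⟨x, y⟩) v = if x = v then 2 else 0 := by
      intro y; by_cases h : x = v <;> simp [incid, withLoops, h]
    simp only [this]; split_ifs <;> simp [mul_comm]
  simp [this]

theorem stable_withLoops {w : G.V → ℕ} (h : ∀ v, w v = 0 → 3 ≤ valence G v)
    (h' : ∀ v, 1 ≤ valence G v) : IsStable0 (withLoops G w) := by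
  refine fun (v : G.V) => ?_
  rw [valence_withLoops]
  have := h v; have := h' v
  by_cases h0 : w v = 0 <;> omega
end TG

open scoped Classical
namespace TG
open Relation CGraph

variable {G H K : CGraph}

theorem walk_iff {S : Finset G.E} {u v : G.V} :
    (∃ L, IsWalk G L u v ∧ ∀ x ∈ L, x.1 ∉ S) ↔ SReach G {e | e ∉ S} u v := by
  constructor
  · rintro ⟨L, hL, hS⟩
    induction L generalizing u with
    | nil => have : u = v := hL; subst this; exact .refl
    | cons x xs ih =>
      obtain ⟨h1, h2⟩ := hL
      refine ReflTransGen.head ⟨x.1, hS x (by simp), ?_⟩ (ih h2 (fun y hy => hS y (by simp [hy])))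
      unfold dSrc at h1; unfold dTgt
      cases hx : x.2 <;> simp_all
  · intro h
    induction h using ReflTransGen.head_induction_on with
    | refl => exact ⟨[], rfl, by simp⟩
    | head h _ ih =>
      obtain ⟨L, hL, hS⟩ := ih
      obtain ⟨e, he, ⟨h1, h2⟩ | ⟨h1, h2⟩⟩ := h
      · refine ⟨(e, true) :: L, ⟨by simp [dSrc, h1], by simpa [dTgt, h2] using hL⟩, ?_⟩
        intro x hx
        rcases List.mem_cons.1 hx with rfl | hx
        exacts [he, hS x hx]
      · refine ⟨(e, false) :: L, ⟨by simp [dSrc, h2], by simpa [dTgt, h1] using hL⟩, ?_⟩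
        intro x hx
        rcases List.mem_cons.1 hx with rfl | hx
        exacts [he, hS x hx]

theorem connected_iff : Connected G ↔ Nonempty G.V ∧ ∀ u v, SReach G Set.univ u v := by
  unfold Connected
  refine and_congr_right fun _ => forall_congr' fun u => forall_congr' fun v => ?_
  have := walk_iff (G := G) (S := ∅) (u := u) (v := v)
  simpa [Set.ofPred_true] using this

/-- Cut edges of a vertex set. -/
noncomputable def cut (G : CGraph) (U : G.V → Prop) : Finset G.E :=
  Finset.univ.filter fun e => ¬ (U (G.src e) ↔ U (G.tgt e))

theorem mem_cut {U : G.V → Prop} {e : G.E} : e ∈ cut G U ↔ ¬ (U (G.src e) ↔ U (G.tgt e)) := by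
  simp [cut]

theorem tec_iff : ThreeEdgeConnected G ↔
    ∀ U : G.V → Prop, (∃ u, U u) → (∃ v, ¬ U v) → 3 ≤ (cut G U).card := by
  constructor
  · rintro h U ⟨u, hu⟩ ⟨v, hv⟩
    by_contra hlt
    have := walk_iff.1 (h (cut G U) (by omega) u v)
    have := sreach_const (S := {e | e ∉ cut G U}) (fun x => U x)
      (by intro e he; simpa [cut] using he) this
    simp only [eq_iff_iff] at this
    exact hv (this.1 hu)
  · intro h S hS u v
    rw [walk_iff]
    by_contra hv
    have h3 := h (fun x => SReach G {e | e ∉ S} u x) ⟨u, .refl⟩ ⟨v, hv⟩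
    have : cut G (fun x => SReach G {e | e ∉ S} u x) ⊆ S := by
      intro e he
      by_contra heS
      simp only [cut, Finset.mem_filter, Finset.mem_univ, true_and] at he
      have := sreach_edge (S := {e | e ∉ S}) heS
      exact he ⟨fun h => sreach_trans h this, fun h => sreach_trans h (sreach_symm this)⟩
    have := Finset.card_le_card this
    omega

theorem tec_conn (h : ThreeEdgeConnected G) (hn : Nonempty G.V) : Connected G := by
  refine ⟨hn, fun u v => ?_⟩
  obtain ⟨L, hL, -⟩ := h ∅ (by simp) u v
  exact ⟨L, hL⟩

theorem tec_valence (h : ThreeEdgeConnected G) (hc : 2 ≤ Fintype.card G.V) (v : G.V) :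
    3 + 2 * (Finset.univ.filter fun e : G.E => G.src e = v ∧ G.tgt e = v).card ≤ valence G v := by
  have : Nontrivial G.V := Fintype.one_lt_card_iff_nontrivial.1 hc
  obtain ⟨u, hu⟩ := exists_ne v
  have h3 := tec_iff.1 h (fun x => x = v) ⟨v, rfl⟩ ⟨u, hu⟩
  have h4 : (cut G fun x => x = v).card +
      2 * (Finset.univ.filter fun e : G.E => G.src e = v ∧ G.tgt e = v).card ≤ valence G v := by
    unfold cut valence
    rw [Finset.card_filter, Finset.card_filter, Finset.mul_sum, ← Finset.sum_add_distrib]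
    refine Finset.sum_le_sum fun e _ => ?_
    unfold incid
    by_cases a : G.src e = v <;> by_cases b : G.tgt e = v <;> simp [a, b]
  omega

theorem cut_iso (i : CIso G H) (U : H.V → Prop) :
    (cut G fun v => U (i.vEquiv v)).card = (cut H U).card := by
  rw [← Finset.card_map i.eEquiv.toEmbedding]
  congr 1; ext e
  obtain ⟨e, rfl⟩ := i.eEquiv.surjective e
  simp only [cut, Finset.mem_map_equiv, Equiv.symm_apply_apply, Finset.mem_filter,
    Finset.mem_univ, true_and]
  rcases i.ends e with ⟨a, b⟩ | ⟨a, b⟩ <;> simp only [← a, ← b]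
  tauto

theorem tec_iso (i : CIso G H) (h : ThreeEdgeConnected G) : ThreeEdgeConnected H := by
  rw [tec_iff] at *
  rintro U ⟨u, hu⟩ ⟨v, hv⟩
  rw [← cut_iso i]
  exact h _ ⟨i.vEquiv.symm u, by simpa⟩ ⟨i.vEquiv.symm v, by simpa⟩

theorem cut_withLoops (w : G.V → ℕ) (U : G.V → Prop) :
    (cut (withLoops G w) U).card = (cut G U).card := by
  rw [← Finset.card_map (s := cut G U) (⟨Sum.inl, Sum.inl_injective⟩ :
    G.E ↪ (G.E ⊕ Σ v : G.V, Fin (w v)))]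
  congr 1; ext e
  refine Iff.trans mem_cut (Iff.trans ?_ Finset.mem_map.symm)
  rcases e with e | q
  · constructor
    · intro h; exact ⟨e, (mem_cut (G := G)).2 h, rfl⟩
    · rintro ⟨e', he, h⟩
      have : e' = e := Sum.inl_injective h
      subst this; exact (mem_cut (G := G)).1 he
  · constructor
    · intro h; exact absurd Iff.rfl h
    · rintro ⟨e', he, h⟩; exact absurd h Sum.inl_ne_inr

theorem tec_withLoops (w : G.V → ℕ) : ThreeEdgeConnected (withLoops G w) ↔ ThreeEdgeConnected G := by
  rw [tec_iff, tec_iff]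
  refine forall_congr' fun (U : G.V → Prop) => ?_
  rw [cut_withLoops]; rfl

theorem tt_card (T : TrigonalType) : 2 ≤ Fintype.card T.G.V := by
  obtain ⟨v⟩ := T.connphi.1
  obtain ⟨e, -⟩ := T.nondeg v
  have h1 : 0 < Fintype.card T.T.E := Fintype.card_pos_iff.2 ⟨e⟩
  have h2 := T.treeT.2
  have h3 : Fintype.card T.T.V ≤ Fintype.card T.G.V :=
    Fintype.card_le_of_surjective _ T.cover
  omega

theorem tt_valence (T : TrigonalType) (v : T.G.V) :
    3 + 2 * (Finset.univ.filter fun e : T.G.E => T.G.src e = v ∧ T.G.tgt e = v).card ≤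
      valence T.G v := tec_valence T.threeEC (tt_card T) v

theorem tt_stable (T : TrigonalType) : IsStable0 (withLoops T.G T.w) :=
  stable_withLoops (fun v _ => by have := tt_valence T v; omega)
    (fun v => by have := tt_valence T v; omega)

theorem wg_refl (X : WGraph) : WGIso X X := ⟨CIso.refl' _, fun _ => rfl⟩

theorem wg_symm {X Y : WGraph} (h : WGIso X Y) : WGIso Y X := by
  obtain ⟨i, hi⟩ := h
  exact ⟨i.symm', fun v => by rw [← hi]; simp [CIso.symm']⟩

theorem wg_trans {X Y Z : WGraph} (h : WGIso X Y) (h' : WGIso Y Z) : WGIso X Z := by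
  obtain ⟨i, hi⟩ := h
  obtain ⟨j, hj⟩ := h'
  exact ⟨i.trans' j, fun v => by simp [CIso.trans', hi, hj]⟩

theorem trig_right {X Y Z : WGraph} (h : TrigContraction X Y) (i : WGIso Y Z) :
    TrigContraction X Z := by
  obtain ⟨T, h1, S, h2, H, cd, T', K, h3, h4⟩ := h
  exact ⟨T, h1, S, h2, H, cd, T', K, wg_trans h3 i, h4⟩

theorem max_iso {X Y : WGraph} (h : MaximalTrigonal X) (i : WGIso X Y) : MaximalTrigonal Y := by
  obtain ⟨⟨T, hT⟩, h2⟩ := h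
  refine ⟨⟨T, wg_trans hT i⟩, fun Z hZ hc => ?_⟩
  exact wg_trans (h2 Z hZ (trig_right hc (wg_symm i))) i

theorem single_left {X Y Z : WGraph} (h : SingleClassContraction X Y) (i : WGIso X Z) :
    SingleClassContraction Z Y := by
  obtain ⟨T, h1, h2⟩ := h
  exact ⟨T, wg_trans h1 i, h2⟩

/-- cubic types are maximal -/
theorem max_of_cubic (T : TrigonalType) (hw : ∀ v, T.w v = 0) (hc : ∀ v, valence T.G v ≤ 3) :
    MaximalTrigonal ⟨T.G, T.w⟩ := by
  refine ⟨⟨T, wg_refl _⟩, ?_⟩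
  rintro Y - ⟨T1, hY, S, -, H, cd, T', K, hX, hK, hs1, hs2⟩
  refine wg_trans (wg_symm hY) ?_
  have hw' : ∀ v, T'.w v = 0 := by
    obtain ⟨i, hi⟩ := hX; intro v; exact (hi v).symm.trans (hw _)
  obtain ⟨i, -⟩ := hX
  obtain ⟨i2⟩ := stab_unique hs2 T'.stab hK (tt_stable T')
  have e1 : T'.w = fun _ => 0 := funext hw'
  rw [e1] at i2
  have iKX := (i2.trans' (withLoopsZero _)).trans' i
  obtain ⟨p⟩ := Ctr.ofCD cd
  obtain ⟨p2⟩ := Ctr.ofStab hs1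
  obtain ⟨p3⟩ := ((p.trans p2).trans (Ctr.ofIso iKX)).stab T1.stab
    (iKX.stable hK)
  obtain ⟨j⟩ := p3.iso_of_cubic (tt_stable T1) hc
  have hw1 : ∀ v, T1.w v = 0 := by
    intro v
    by_contra h0
    let e : (withLoops T1.G T1.w).E := Sum.inr ⟨v, ⟨0, Nat.pos_of_ne_zero h0⟩⟩
    have h1 := tt_valence T (j.vEquiv v)
    have h2 := hc (j.vEquiv v)
    have h3 : j.eEquiv e ∈ (Finset.univ.filter fun e : T.G.E =>
        T.G.src e = j.vEquiv v ∧ T.G.tgt e = j.vEquiv v) := by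
      simp only [Finset.mem_filter, Finset.mem_univ, true_and]
      rcases j.ends e with ⟨a, b⟩ | ⟨a, b⟩
      · exact ⟨a.symm, b.symm⟩
      · exact ⟨b.symm, a.symm⟩
    have := Finset.card_pos.2 ⟨_, h3⟩
    omega
  have e2 : T1.w = fun _ => 0 := funext hw1
  rw [e2] at j
  refine ⟨(withLoopsZero _).symm'.trans' j, fun v => ?_⟩
  exact (hw _).trans (hw1 _).symm

/-- The identity contraction. -/
theorem trig_id (T T' : TrigonalType) (K : CGraph) (hK : IsStable0 K)
    (h : StabReduces0 T.Gphi K) (h' : StabReduces0 T'.Gphi K) :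
    TrigContraction ⟨T.G, T.w⟩ ⟨T'.G, T'.w⟩ := by
  refine ⟨T, wg_refl _, (Set.range (Ctr.refl T.Gphi).fe)ᶜ, ?_, _, (Ctr.refl T.Gphi).toCD, T', K,
    wg_refl _, hK, ?_, h'⟩
  · intro a b _; simp [Ctr.refl]
  · rw [Ctr.toCD_zero]; exact stab_iso (withLoopsZero _) h

/-- Changing the underlying weighted graph. -/
def retype (T : TrigonalType) (X : WGraph) (i : CIso (withLoops T.G T.w) (withLoops X.G X.w)) :
    TrigonalType :=
  have h3 : ThreeEdgeConnected X.G :=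
    (tec_withLoops _).1 (tec_iso i ((tec_withLoops _).2 T.threeEC))
  { G := X.G
    w := X.w
    stable := fun v _ => by
      have := tec_valence h3 (by
        have := tt_card T
        have h : Fintype.card T.G.V = Fintype.card X.G.V := i.card
        omega) v
      omega
    conn := tec_conn h3 (by obtain ⟨v⟩ := T.conn.1; exact ⟨i.vEquiv v⟩)
    threeEC := h3
    Gphi := T.Gphi
    connphi := T.connphi
    T := T.T
    treeT := T.treeT
    phi := T.phi
    harm := T.harm
    nondeg := T.nondeg
    deg3 := T.deg3
    stab := stab_iso' T.stab i
    vG := fun x => T.vG (i.vEquiv.symm x)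
    vG_inj := T.vG_inj.comp i.vEquiv.symm.injective
    cover := fun t => by
      obtain ⟨x, hx⟩ := T.cover t
      exact ⟨i.vEquiv x, by rw [← hx]; exact congrArg _ (congrArg _ (i.vEquiv.symm_apply_apply x))⟩ }

theorem max_retype (T : TrigonalType) (h : MaximalTrigonal ⟨T.G, T.w⟩) (X : WGraph)
    (i : CIso (withLoops T.G T.w) (withLoops X.G X.w)) : WGIso X ⟨T.G, T.w⟩ :=
  h.2 X ⟨retype T X i, wg_refl _⟩ (trig_id (retype T X i) T _ (tt_stable T) T.stab T.stab)

/-- Delete loops. -/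
def unloop (G : CGraph) : CGraph where
  V := G.V
  E := {e : G.E // G.src e ≠ G.tgt e}
  fV := inferInstance
  fE := inferInstance
  dV := inferInstance
  dE := inferInstance
  src := fun e => G.src e.1
  tgt := fun e => G.tgt e.1

noncomputable def loopCount (G : CGraph) (v : G.V) : ℕ :=
  Fintype.card {e : G.E // G.src e = v ∧ G.tgt e = v}

theorem unloop_iso (G : CGraph) : Nonempty (CIso G (withLoops (unloop G) (loopCount G))) := by
  let q := fun v => Fintype.equivFin {e : G.E // G.src e = v ∧ G.tgt e = v}
  let f : G.E → (withLoops (unloop G) (loopCount G)).E := fun e =>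
    if h : G.src e = G.tgt e then Sum.inr ⟨G.src e, q _ ⟨e, rfl, h.symm⟩⟩ else Sum.inl ⟨e, h⟩
  let g : (withLoops (unloop G) (loopCount G)).E → G.E :=
    Sum.elim (fun e => e.1) (fun x => ((q x.1).symm x.2).1)
  have f1 : ∀ e, ∀ h : G.src e = G.tgt e,
      f e = Sum.inr ⟨G.src e, q _ ⟨e, rfl, h.symm⟩⟩ := fun e h => dif_pos h
  have f2 : ∀ e, ∀ h : ¬ G.src e = G.tgt e, f e = Sum.inl ⟨e, h⟩ := fun e h => dif_neg h
  have hgf : ∀ e, g (f e) = e := by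
    intro e
    by_cases h : G.src e = G.tgt e
    · rw [f1 e h]; simp [g]
    · rw [f2 e h]; rfl
  have hg : Function.Injective g := by
    rintro (a | ⟨v, i⟩) (b | ⟨u, j⟩) h
    · exact congrArg Sum.inl (Subtype.ext h)
    · have h : a.1 = ((q u).symm j).1 := h
      have := ((q u).symm j).2
      rw [← h] at this
      exact absurd (this.1.trans this.2.symm) a.2
    · have h : ((q v).symm i).1 = b.1 := h
      have := ((q v).symm i).2
      rw [h] at this
      exact absurd (this.1.trans this.2.symm) b.2
    · have h : ((q v).symm i).1 = ((q u).symm j).1 := h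
      have : v = u := by rw [← ((q v).symm i).2.1, ← ((q u).symm j).2.1, h]
      subst this
      have := (q v).symm.injective (Subtype.ext h)
      rw [this]
  refine ⟨⟨Equiv.refl _, ⟨f, g, hgf, fun x => hg (hgf _)⟩, ?_⟩⟩
  intro e
  left
  show G.src e = (withLoops (unloop G) (loopCount G)).src (f e) ∧
    G.tgt e = (withLoops (unloop G) (loopCount G)).tgt (f e)
  by_cases h : G.src e = G.tgt e
  · rw [f1 e h]
    exact ⟨rfl, h.symm⟩
  · rw [f2 e h]
    exact ⟨rfl, rfl⟩

theorem max_simple (T : TrigonalType) (h : MaximalTrigonal ⟨T.G, T.w⟩) :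
    (∀ v, T.w v = 0) ∧ ∀ e, T.G.src e ≠ T.G.tgt e := by
  have hw : ∀ v, T.w v = 0 := by
    obtain ⟨i, hi⟩ := max_retype T h ⟨withLoops T.G T.w, fun _ => 0⟩ (withLoopsZero _).symm'
    intro v
    obtain ⟨u, rfl⟩ := i.vEquiv.surjective v
    exact hi u
  refine ⟨hw, ?_⟩
  obtain ⟨j⟩ := unloop_iso T.G
  have e1 : T.w = fun _ => 0 := funext hw
  have j' : CIso (withLoops T.G T.w) T.G := by rw [e1]; exact withLoopsZero _
  obtain ⟨i, -⟩ := max_retype T h ⟨unloop T.G, loopCount T.G⟩ (j'.trans' j)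
  have hc : Fintype.card {e : T.G.E // T.G.src e ≠ T.G.tgt e} = Fintype.card T.G.E := i.cardE
  intro e he
  have := Fintype.card_subtype_lt (p := fun e => T.G.src e ≠ T.G.tgt e) (x := e) (by simpa using he)
  omega
end TG

open scoped Classical
namespace TG
open Relation CGraph

variable {G H K : CGraph}

theorem Ctr.connected (π : Ctr G K) (h : Connected G) : Connected K := by
  rw [connected_iff] at *
  obtain ⟨⟨v⟩, h⟩ := h
  refine ⟨⟨π.c v⟩, fun x y => ?_⟩
  obtain ⟨u, rfl⟩ := π.surj x
  obtain ⟨v, rfl⟩ := π.surj y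
  refine sreach_map π.c (fun e _ => ?_) (h u v)
  by_cases he : e ∈ Set.range π.fe
  · obtain ⟨e, rfl⟩ := he
    rcases π.ends e with ⟨a, b⟩ | ⟨a, b⟩ <;> rw [← a, ← b]
    · exact sreach_edge trivial
    · exact sreach_symm (sreach_edge trivial)
  · rw [π.drop e he]; exact .refl

theorem incid_eq_two {e : G.E} {v : G.V} (h : incid G e v = 2) : G.src e = v ∧ G.tgt e = v := by
  unfold incid at h; split_ifs at h <;> simp_all

theorem incid_zero {e : G.E} {v : G.V} (h : incid G e v = 0) : G.src e ≠ v ∧ G.tgt e ≠ v := by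
  unfold incid at h; split_ifs at h <;> simp_all

theorem incid_one {e : G.E} {v : G.V} (h : incid G e v = 1) :
    ∃ u, u ≠ v ∧ ((G.src e = v ∧ G.tgt e = u) ∨ (G.src e = u ∧ G.tgt e = v)) := by
  unfold incid at h; split_ifs at h with h1 h2 h3
  · omega
  · exact ⟨_, h2, Or.inl ⟨h1, rfl⟩⟩
  · exact ⟨_, h1, Or.inr ⟨rfl, h3⟩⟩
  · omega

theorem val_two (v : G.V) (h : valence G v = 2) :
    (∃ e, G.src e = v ∧ G.tgt e = v ∧ ∀ e', e' ≠ e → incid G e' v = 0) ∨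
    ∃ e₁ e₂, e₁ ≠ e₂ ∧ incid G e₁ v = 1 ∧ incid G e₂ v = 1 ∧
      ∀ e, e ≠ e₁ → e ≠ e₂ → incid G e v = 0 := by
  have h1 : ∃ e, incid G e v ≠ 0 := by
    by_contra hn; push Not at hn
    have : valence G v = 0 := Finset.sum_eq_zero fun e _ => hn e
    omega
  obtain ⟨e, he⟩ := h1
  have hs : incid G e v + ∑ e' ∈ Finset.univ.erase e, incid G e' v = 2 := by
    rw [Finset.add_sum_erase _ (fun e => incid G e v) (Finset.mem_univ e)]; exact h
  have hle := incid_le e v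
  by_cases h2 : incid G e v = 2
  · left
    refine ⟨e, (incid_eq_two h2).1, (incid_eq_two h2).2, fun e' he' => ?_⟩
    have h0 : ∑ e' ∈ Finset.univ.erase e, incid G e' v = 0 := by omega
    exact Finset.sum_eq_zero_iff.1 h0 e' (by simp [he'])
  · right
    have h1 : incid G e v = 1 := by omega
    have h3 : ∃ e' ∈ Finset.univ.erase e, incid G e' v ≠ 0 := by
      by_contra hn; push Not at hn
      rw [Finset.sum_eq_zero hn] at hs; omega
    obtain ⟨e', he', h4⟩ := h3
    have hs' : incid G e' v + ∑ x ∈ (Finset.univ.erase e).erase e', incid G x v = 1 := by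
      rw [Finset.add_sum_erase _ (fun e => incid G e v) he']; omega
    refine ⟨e, e', (Finset.ne_of_mem_erase he').symm, h1, by omega, fun x hx hx' => ?_⟩
    have h0 : ∑ x ∈ (Finset.univ.erase e).erase e', incid G x v = 0 := by omega
    exact Finset.sum_eq_zero_iff.1 h0 x (by simp [hx, hx'])

/-- Contract one edge `e₁` at `v₀`. -/
abbrev suppress (G : CGraph) (v₀ : G.V) (e₁ : G.E) (r : G.V → {v : G.V // v ≠ v₀}) : CGraph where
  V := {v : G.V // v ≠ v₀}
  E := {e : G.E // e ≠ e₁}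
  fV := inferInstance
  fE := inferInstance
  dV := inferInstance
  dE := inferInstance
  src := fun e => r (G.src e.1)
  tgt := fun e => r (G.tgt e.1)

theorem suppress_step (hG : Connected G) (v₀ : G.V) (h2 : valence G v₀ = 2)
    (h3 : ∃ v, 3 ≤ valence G v) :
    ∃ (H : CGraph) (q : H.V → G.V), SeriesStep0 G H ∧ Connected H ∧ Function.Injective q ∧
      Set.range q = {v₀}ᶜ ∧ ∀ x, valence H x = valence G (q x) := by
  rcases val_two v₀ h2 with ⟨e, he1, he2, he⟩ | ⟨e₁, e₂, h12, hi1, hi2, hi⟩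
  · exfalso
    obtain ⟨v, hv⟩ := h3
    have := (connected_iff.1 hG).2 v₀ v
    have := sreach_const (S := Set.univ) (fun x => x = v₀) (by
      intro e' _
      by_cases h : e' = e
      · rw [h, he1, he2]
      · have := incid_zero (he e' h)
        simp [this.1, this.2]) this
    simp only [eq_iff_iff, true_iff] at this
    rw [this] at hv; omega
  · obtain ⟨u₁, hu₁, hE1⟩ := incid_one hi1
    obtain ⟨u₂, hu₂, hE2⟩ := incid_one hi2
    let r : G.V → {v : G.V // v ≠ v₀} := fun u => if h : u = v₀ then ⟨u₁, hu₁⟩ else ⟨u, h⟩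
    have r1 : ∀ u, u ≠ v₀ → (r u).1 = u := by intro u hu; simp [r, hu]
    have r0 : (r v₀).1 = u₁ := by simp [r]
    have rv : ∀ u, (r u).1 = if u = v₀ then u₁ else u := by
      intro u; by_cases h : u = v₀ <;> simp [r, h]
    obtain ⟨π, hπ, hc⟩ := ctr_drop_one (H := suppress G v₀ e₁ r) v₀ u₁ e₁ hu₁ hE1 (Equiv.refl _)
      (fun e => e.1) Subtype.val_injective (by ext e; simp)
      (by intro e; left; exact ⟨rv _, rv _⟩)
    refine ⟨suppress G v₀ e₁ r, fun v => v.1, ?_, π.connected hG, Subtype.val_injective,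
      by ext; simp, ?_⟩
    · refine ⟨v₀, e₁, e₂, u₁, u₂, h12, h2, hu₁, hu₂, ?_, ?_, Equiv.refl _, ⟨e₂, h12.symm⟩,
        ⟨fun e => ⟨e.1.1, e.1.2, fun h => e.2 (Subtype.ext h)⟩,
          fun e => ⟨⟨e.1, e.2.1⟩, fun h => e.2.2 (congrArg Subtype.val h)⟩,
          fun e => rfl, fun e => rfl⟩, ?_, ?_⟩
      · rw [Set.pair_eq_pair_iff]; tauto
      · rw [Set.pair_eq_pair_iff]; tauto
      · rw [Set.pair_eq_pair_iff]
        simp only [Equiv.refl_apply]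
        rcases hE2 with ⟨a, b⟩ | ⟨a, b⟩
        · rw [a, b, r0, r1 _ hu₂]; simp
        · rw [a, b, r0, r1 _ hu₂]; simp
      · intro e
        have h0 := incid_zero (hi e.1.1 e.1.2 (fun h => e.2 (Subtype.ext h)))
        left; exact ⟨r1 _ h0.1, r1 _ h0.2⟩
    · intro x
      show valence _ x = valence G x.1
      have hv := π.valence_eq x
      have hx : π.c x.1 = x := hc x
      by_cases h0 : π.c v₀ = x
      · have : (Finset.univ.filter fun v : G.V => π.c v = x) = {x.1, v₀} := by
          ext v
          simp only [Finset.mem_filter, Finset.mem_univ, true_and, Finset.mem_insert,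
            Finset.mem_singleton]
          constructor
          · intro h
            by_cases hv : v = v₀
            · exact Or.inr hv
            · left
              have := hc ⟨v, hv⟩
              have h4 : π.c v = ⟨v, hv⟩ := this
              rw [← h, h4]
          · rintro (rfl | rfl)
            exacts [hx, h0]
        rw [this, Finset.sum_pair x.2, Finset.card_pair x.2] at hv
        omega
      · have : (Finset.univ.filter fun v : G.V => π.c v = x) = {x.1} := by
          ext v
          simp only [Finset.mem_filter, Finset.mem_univ, true_and,
            Finset.mem_singleton]
          constructor
          · intro h
            by_cases hv : v = v₀
            · rw [hv] at h; exact absurd h h0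
            · have := hc ⟨v, hv⟩
              have h4 : π.c v = ⟨v, hv⟩ := this
              rw [← h, h4]
          · rintro rfl
            exact hx
        rw [this, Finset.sum_singleton, Finset.card_singleton] at hv
        omega

theorem exists_stab (n : ℕ) : ∀ G : CGraph, Fintype.card G.V = n → Connected G →
    (∀ v, 2 ≤ valence G v) → (∃ v, 3 ≤ valence G v) →
    ∃ (K : CGraph) (q : K.V → G.V), StabReduces0 G K ∧ IsStable0 K ∧ Function.Injective q ∧
      Set.range q = {v | 3 ≤ valence G v} ∧ ∀ x, valence K x = valence G (q x) := by
  induction n with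
  | zero =>
    intro G hn hc
    have := hc.1
    exact absurd hn (Fintype.card_ne_zero)
  | succ n ih =>
    intro G hn hG h2 h3
    by_cases hs : ∀ v, 3 ≤ valence G v
    · exact ⟨G, id, .refl, hs, Function.injective_id, by ext; simp [hs], fun _ => rfl⟩
    · push Not at hs
      obtain ⟨v₀, hv₀⟩ := hs
      have hv2 : valence G v₀ = 2 := by have := h2 v₀; omega
      obtain ⟨H, q, hstep, hc, hi, hr, hval⟩ := suppress_step hG v₀ hv2 h3
      have hcard : Fintype.card H.V = n := by
        have : (Finset.univ.image q) = Finset.univ.erase v₀ := by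
          ext v
          have : v ∈ Set.range q ↔ v ∈ ({v₀}ᶜ : Set G.V) := by rw [hr]
          simpa using this
        rw [← Finset.card_univ, ← Finset.card_image_of_injective _ hi, this,
          Finset.card_erase_of_mem (Finset.mem_univ _), Finset.card_univ]
        omega
      obtain ⟨K, p, hK, hKs, hpi, hpr, hpv⟩ := ih H hcard hc (fun x => by rw [hval]; exact h2 _) (by
        obtain ⟨v, hv⟩ := h3
        have : v ∈ Set.range q := by rw [hr]; rintro rfl; omega
        obtain ⟨x, rfl⟩ := this
        exact ⟨x, by rw [hval]; exact hv⟩)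
      refine ⟨K, q ∘ p, ReflTransGen.head (Or.inr (Or.inl hstep)) hK, hKs, hi.comp hpi, ?_, ?_⟩
      · ext v
        simp only [Set.mem_range, Function.comp, Set.mem_ofPred_eq]
        constructor
        · rintro ⟨x, rfl⟩; rw [← hval, ← hpv]; exact hKs x
        · intro hv
          have : v ∈ Set.range q := by rw [hr]; rintro rfl; omega
          obtain ⟨y, rfl⟩ := this
          have : y ∈ Set.range p := by rw [hpr]; show 3 ≤ _; rw [hval]; exact hv
          obtain ⟨x, rfl⟩ := this
          exact ⟨x, rfl⟩
      · intro x; rw [hpv, hval]; rfl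

/-- Transfer of 3-edge-connectivity. -/
theorem Ctr.tec (π : Ctr G K) (hK : IsStable0 K)
    (h : ∀ U : G.V → Prop, (cut G U).card ≤ 2 →
      (∀ v, U v → valence G v ≤ 2) ∨ (∀ v, ¬ U v → valence G v ≤ 2)) : ThreeEdgeConnected K := by
  rw [tec_iff]
  rintro U ⟨u, hu⟩ ⟨v, hv⟩
  by_contra hlt
  have hcut : (cut G fun x => U (π.c x)).card ≤ (cut K U).card := by
    rw [← Finset.card_image_of_injective _ π.inj]
    apply Finset.card_le_card
    intro e he
    rw [mem_cut] at he
    by_cases h : e ∈ Set.range π.fe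
    · obtain ⟨e, rfl⟩ := h
      refine Finset.mem_image.2 ⟨e, ?_, rfl⟩
      rw [mem_cut]
      rcases π.ends e with ⟨a, b⟩ | ⟨a, b⟩ <;> rw [a, b] <;> tauto
    · exact absurd (by rw [π.drop e h]) he
  have key : ∀ k, (∀ v, π.c v = k → valence G v ≤ 2) → False := by
    intro k hk
    have h1 := π.valence_eq k
    have h2 := hK k
    have h3 := Finset.sum_le_card_nsmul (Finset.univ.filter fun v : G.V => π.c v = k)
      (fun v => valence G v) 2 (by intro v hv; exact hk v (by simpa using hv))
    simp only [smul_eq_mul] at h3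
    omega
  rcases h (fun x => U (π.c x)) (by omega) with h | h
  · exact key u (fun v hv => h v (by rw [hv]; exact hu))
  · exact key v (fun x hx => h x (by rw [hx]; exact hv))
end TG

open scoped Classical
namespace TG
open Relation CGraph
variable {G H K : CGraph}

/-- Ladder data: a rooted tree with nodes `Option N` and rungs `C`. -/
structure LD : Type 1 where
  N : Type
  C : Type
  fN : Fintype N
  fC : Fintype C
  par : N → Option N
  rk : N → ℕ
  rk_lt : ∀ n m, par n = some m → rk m < rk n
  pos : C → Option N
  typ : C → Fin 3

attribute [instance] LD.fN LD.fC

/-- The tree of a ladder datum. -/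
noncomputable abbrev Tr (D : LD) : CGraph where
  V := Option D.N
  E := D.N
  fV := inferInstance
  fE := inferInstance
  dV := inferInstance
  dE := inferInstance
  src := fun n => some n
  tgt := D.par

/-- The ladder graph. -/
noncomputable abbrev Lad (D : LD) : CGraph where
  V := Option D.N × Fin 3
  E := (D.N × Fin 3) ⊕ D.C
  fV := inferInstance
  fE := inferInstance
  dV := inferInstance
  dE := inferInstance
  src := Sum.elim (fun x => (some x.1, x.2)) (fun c => (D.pos c, D.typ c + 1))
  tgt := Sum.elim (fun x => (D.par x.1, x.2)) (fun c => (D.pos c, D.typ c + 2))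

noncomputable abbrev tv (D : LD) (t : Option D.N) : ℕ := valence (Tr D) t

variable {D : LD}

theorem par_ne (n : D.N) : D.par n ≠ some n := fun h => lt_irrefl _ (D.rk_lt n n h)

theorem tv_none : tv D none = (Finset.univ.filter fun n => D.par n = none).card := by
  simp only [tv, valence, incid]
  rw [Finset.card_filter]
  simp only [reduceCtorEq, if_false, zero_add]

theorem tv_some (n : D.N) :
    tv D (some n) = 1 + (Finset.univ.filter fun m => D.par m = some n).card := by
  simp only [tv, valence, incid]
  rw [Finset.card_filter, Finset.sum_add_distrib]
  simp

theorem fin3_ind (p i : Fin 3) :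
    ((if p + 1 = i then 1 else 0) + (if p + 2 = i then 1 else 0) : ℕ) = if p = i then 0 else 1 := by
  revert p i; decide

theorem incid_rung (c : D.C) (t : Option D.N) (i : Fin 3) :
    incid (Lad D) (Sum.inr c) (t, i) = if D.pos c = t ∧ D.typ c ≠ i then 1 else 0 := by
  have := fin3_ind (D.typ c) i
  simp only [incid, Sum.elim_inr, Prod.mk.injEq]
  by_cases h : D.pos c = t
  · simp only [h, true_and]
    rw [this]
    by_cases h' : D.typ c = i <;> simp [h']
  · simp [h]

theorem incid_strand (n : D.N) (t : Option D.N) (i j : Fin 3) :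
    incid (Lad D) (Sum.inl (n, j)) (t, i) = if j = i then incid (Tr D) n t else 0 := by
  simp only [incid, Sum.elim_inl, Prod.mk.injEq]
  by_cases h : j = i <;> simp [h]

theorem val_lad (t : Option D.N) (i : Fin 3) : valence (Lad D) (t, i) =
    tv D t + (Finset.univ.filter fun c => D.pos c = t ∧ D.typ c ≠ i).card := by
  rw [valence, Fintype.sum_sum_type, Fintype.sum_prod_type]
  simp only [incid_rung, incid_strand]
  rw [Finset.card_filter]
  congr 1
  simp [tv, valence]

/-- The tree inequality. -/
theorem tree_ineq (A : Option D.N → Prop) (hA : ∃ t, A t) :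
    ∑ t ∈ Finset.univ.filter A, tv D t + 2 ≤
      2 * (Finset.univ.filter A).card + (cut (Tr D) A).card := by
  have h1 := valence_sum (Tr D) (Finset.univ.filter A)
  let I := Finset.univ.filter fun n : D.N => A (some n) ∧ A (D.par n)
  have h2 : ∑ e : D.N, ((if some e ∈ Finset.univ.filter A then 1 else 0) +
      (if D.par e ∈ Finset.univ.filter A then 1 else 0)) = 2 * I.card + (cut (Tr D) A).card := by
    simp only [I, cut, Finset.card_filter, Finset.mul_sum]
    rw [← Finset.sum_add_distrib]
    refine Finset.sum_congr rfl fun e _ => ?_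
    simp only [Finset.mem_filter, Finset.mem_univ, true_and]
    by_cases a : A (some e) <;> by_cases b : A (D.par e) <;> simp [a, b]
  have h3 : I.card + 1 ≤ (Finset.univ.filter A).card := by
    let rk' : Option D.N → ℕ := fun t => t.elim 0 (fun n => D.rk n + 1)
    obtain ⟨t, ht, hmin⟩ := Finset.exists_min_image (Finset.univ.filter A) rk'
      (by obtain ⟨t, ht⟩ := hA; exact ⟨t, by simpa⟩)
    have hnot : t ∉ I.image some := by
      intro h
      obtain ⟨n, hn, rfl⟩ := Finset.mem_image.1 h
      have hn := (Finset.mem_filter.1 hn).2.2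
      have := hmin (D.par n) (by simpa)
      cases hp : D.par n with
      | none => rw [hp] at this; simp [rk'] at this
      | some m => 
        rw [hp] at this
        have h4 := D.rk_lt n m hp
        simp [rk'] at this
        omega
    rw [← Finset.card_image_of_injective I (Option.some_injective _), ← Finset.card_insert_of_notMem hnot]
    apply Finset.card_le_card
    intro x hx
    rcases Finset.mem_insert.1 hx with rfl | hx
    · exact ht
    · obtain ⟨n, hn, rfl⟩ := Finset.mem_image.1 hx
      simpa using (Finset.mem_filter.1 hn).2.1
  change ∑ t ∈ Finset.univ.filter A, tv D t = _ at h1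
  rw [h1]
  change (∑ e : D.N, ((if some e ∈ Finset.univ.filter A then 1 else 0) +
      (if D.par e ∈ Finset.univ.filter A then 1 else 0))) + 2 ≤ _
  rw [h2]; omega

structure Good (D : LD) : Prop where
  ne : Nonempty D.N
  one : ∀ t, tv D t = 1 → ∃ c c', D.pos c = t ∧ D.pos c' = t ∧ D.typ c ≠ D.typ c'
  two : ∀ t, tv D t = 2 → ∃ c, D.pos c = t

theorem child_none (h : Nonempty D.N) : ∃ n, D.par n = none := by
  obtain ⟨n, -, hmin⟩ := Finset.exists_min_image (Finset.univ : Finset D.N) D.rk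
    ⟨h.some, by simp⟩
  refine ⟨n, ?_⟩
  cases hp : D.par n with
  | none => rfl
  | some m => have := hmin m (by simp); have := D.rk_lt n m hp; omega

theorem tv_pos (h : Nonempty D.N) (t : Option D.N) : 1 ≤ tv D t := by
  cases t with
  | some n => rw [tv_some]; omega
  | none =>
    rw [tv_none]
    obtain ⟨n, hn⟩ := child_none h
    exact Finset.card_pos.2 ⟨n, by simpa⟩

theorem rung_card {t : Option D.N} {i : Fin 3} {c : D.C} (h : D.pos c = t) (h' : D.typ c ≠ i) :
    1 ≤ (Finset.univ.filter fun c => D.pos c = t ∧ D.typ c ≠ i).card :=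
  Finset.card_pos.2 ⟨c, by simp [h, h']⟩

namespace Good

theorem val_two (h : Good D) (v) : 2 ≤ valence (Lad D) v := by
  obtain ⟨t, i⟩ := v
  rw [val_lad]
  have h1 := tv_pos h.ne t
  by_cases h2 : tv D t = 1
  · obtain ⟨c, c', hc, hc', hne⟩ := h.one t h2
    by_cases hi : D.typ c = i
    · have := rung_card (i := i) hc' (by rw [← hi]; exact hne.symm); omega
    · have := rung_card (i := i) hc hi; omega
  · omega

theorem val_three (h : Good D) (t) : ∃ i, 3 ≤ valence (Lad D) (t, i) := by
  have h1 := tv_pos h.ne t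
  by_cases h2 : tv D t = 1
  · obtain ⟨c, c', hc, hc', hne⟩ := h.one t h2
    obtain ⟨i, hi, hi'⟩ : ∃ i, D.typ c ≠ i ∧ D.typ c' ≠ i := by
      generalize D.typ c = p; generalize D.typ c' = q; revert p q; decide
    refine ⟨i, ?_⟩
    rw [val_lad]
    have : 2 ≤ (Finset.univ.filter fun c => D.pos c = t ∧ D.typ c ≠ i).card := by
      have : c ≠ c' := by rintro rfl; exact hne rfl
      rw [← Finset.card_pair this]
      apply Finset.card_le_card
      intro x hx
      rcases Finset.mem_insert.1 hx with rfl | hx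
      · simp [hc, hi]
      · rw [Finset.mem_singleton.1 hx]; simp [hc', hi']
    omega
  · by_cases h3 : tv D t = 2
    · obtain ⟨c, hc⟩ := h.two t h3
      refine ⟨D.typ c + 1, ?_⟩
      rw [val_lad]
      have := rung_card (i := D.typ c + 1) hc (by simp)
      omega
    · exact ⟨0, by rw [val_lad]; omega⟩

theorem leaf_in (h : Good D) (A : Option D.N → Prop) (hA : ∃ t, A t) (hc : (cut (Tr D) A).card ≤ 1) :
    ∃ t, A t ∧ tv D t = 1 := by
  by_contra hcon
  push Not at hcon
  have h1 := tree_ineq A hA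
  have h2 := Finset.card_nsmul_le_sum (Finset.univ.filter A) (fun t => tv D t) 2 (by
    intro t ht
    have := tv_pos h.ne t
    have := hcon t (by simpa using ht)
    omega)
  simp only [smul_eq_mul] at h2
  omega

theorem cut_true : (cut (Tr D) fun _ => True).card = 0 := by simp [cut]

theorem two_leaves (h : Good D) : ∃ t t', t ≠ t' ∧ tv D t = 1 ∧ tv D t' = 1 := by
  obtain ⟨t, -, ht⟩ := h.leaf_in (fun _ => True) ⟨none, trivial⟩ (by rw [cut_true]; omega)
  by_contra hcon
  push Not at hcon
  have h1 := tree_ineq (D := D) (fun _ => True) ⟨none, trivial⟩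
  rw [cut_true] at h1
  have h2 := Finset.card_nsmul_le_sum (Finset.univ.erase t) (fun t => tv D t) 2 (by
    intro s hs
    have := tv_pos h.ne s
    have := hcon t s (Finset.ne_of_mem_erase hs).symm ht
    omega)
  have h3 := Finset.add_sum_erase Finset.univ (fun t => tv D t) (Finset.mem_univ t)
  have h4 := Finset.card_erase_add_one (Finset.mem_univ t)
  simp only [smul_eq_mul, Finset.filter_true] at h1 h2 h3 h4
  omega

/-- cap connectivity. -/
theorem cap (h : Good D) {t} (ht : tv D t = 1) (P : Fin 3 → Prop) (i j : Fin 3) (hi : P i)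
    (hj : ¬ P j) : ∃ c, D.pos c = t ∧ ¬ (P (D.typ c + 1) ↔ P (D.typ c + 2)) := by
  obtain ⟨c, c', hc, hc', hne⟩ := h.one t ht
  by_contra hcon
  push Not at hcon
  have h1 := hcon c hc
  have h2 := hcon c' hc'
  have key : ∀ (P : Fin 3 → Bool) (p q i j : Fin 3), p ≠ q → (P (p + 1) = P (p + 2)) →
    (P (q + 1) = P (q + 2)) → P i = P j := by decide
  have := key (fun x => decide (P x)) _ _ i j hne (by simpa using h1) (by simpa using h2)
  simp [hi, hj] at this

theorem connected (h : Good D) : Connected (Lad D) := by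
  rw [connected_iff]
  refine ⟨⟨(none, 0)⟩, ?_⟩
  have h0 : ∀ k : ℕ, ∀ n : D.N, D.rk n = k → ∀ i,
      SReach (Lad D) Set.univ (some n, i) (none, i) := by
    intro k
    induction k using Nat.strong_induction_on with
    | _ k ih =>
      intro n hn i
      have e : SReach (Lad D) Set.univ (some n, i) (D.par n, i) :=
        sreach_edge (G := Lad D) (e := Sum.inl (n, i)) (Set.mem_univ _)
      cases hp : D.par n with
      | none => rw [hp] at e; exact e
      | some m => rw [hp] at e; exact sreach_trans e (ih _ (hn ▸ D.rk_lt n m hp) m rfl i)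
  have h1 : ∀ t i, SReach (Lad D) Set.univ (t, i) (none, i) := by
    intro t i
    cases t with
    | none => exact sreach_refl
    | some n => exact h0 _ n rfl i
  have h2 : ∀ i j, SReach (Lad D) Set.univ (none, i) (none, j) := by
    intro i j
    by_contra hcon
    obtain ⟨t, -, -, ht, -⟩ := h.two_leaves
    obtain ⟨c, hc, hc'⟩ := h.cap ht (fun j => SReach (Lad D) Set.univ (none, i) (none, j)) i j
      sreach_refl hcon
    have e : SReach (Lad D) Set.univ (D.pos c, D.typ c + 1) (D.pos c, D.typ c + 2) :=
        sreach_edge (G := Lad D) (e := Sum.inr c) (Set.mem_univ _)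
    have e := sreach_trans (sreach_trans (sreach_symm (h1 _ _)) e) (h1 _ _)
    exact hc' ⟨fun x => sreach_trans x e, fun x => sreach_trans x (sreach_symm e)⟩
  rintro ⟨t, i⟩ ⟨s, j⟩
  exact sreach_trans (h1 _ _) (sreach_trans (h2 _ _) (sreach_symm (h1 _ _)))

end Good
end TG

open scoped Classical
namespace TG
open Relation CGraph
variable {G H K : CGraph} {D : LD}

theorem cut_lad (U : Option D.N × Fin 3 → Prop) : (cut (Lad D) U).card =
    ∑ i, (cut (Tr D) fun t => U (t, i)).card +
    (Finset.univ.filter fun c => ¬ (U (D.pos c, D.typ c + 1) ↔ U (D.pos c, D.typ c + 2))).card := by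
  simp only [cut, Finset.card_filter]
  rw [Fintype.sum_sum_type, Fintype.sum_prod_type, Finset.sum_comm]
  rfl

theorem cut_zero {A : Option D.N → Prop} (h : (cut (Tr D) A).card = 0) (t) : A t ↔ A none := by
  have h0 : ∀ n, A (some n) ↔ A (D.par n) := by
    intro n
    by_contra hn
    have : n ∈ cut (Tr D) A := mem_cut.2 hn
    rw [Finset.card_eq_zero.1 h] at this
    simp at this
  have h1 : ∀ k : ℕ, ∀ n : D.N, D.rk n = k → (A (some n) ↔ A none) := by
    intro k
    induction k using Nat.strong_induction_on with
    | _ k ih =>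
      intro n hn
      rw [h0]
      cases hp : D.par n with
      | none => rfl
      | some m => exact ih _ (hn ▸ D.rk_lt n m hp) m rfl
  cases t with
  | none => rfl
  | some n => exact h1 _ n rfl

theorem fin3_two : ∀ p i : Fin 3, ¬ p = i →
    (p + 1 = i ∧ p + 2 ≠ i) ∨ (p + 1 ≠ i ∧ p + 2 = i) := by decide

theorem fin3_three : ∀ i : Fin 3, ∃ j k : Fin 3, i ≠ j ∧ i ≠ k ∧ j ≠ k ∧
      ∀ l, l = i ∨ l = j ∨ l = k := by decide

namespace Good

theorem caseA (h : Good D) (U : Option D.N × Fin 3 → Prop) (j : Fin 3)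
    (hj : ∀ t i, i ≠ j → ¬ U (t, i)) (hc : (cut (Lad D) U).card ≤ 2) :
    ∀ v, U v → valence (Lad D) v ≤ 2 := by
  rintro ⟨t, i⟩ hv
  obtain rfl : i = j := by by_contra hi; exact hj t i hi hv
  by_contra hlt
  rw [cut_lad] at hc
  let A : Option D.N → Prop := fun t => U (t, i)
  have h1 := tree_ineq A ⟨t, hv⟩
  have h2 : (cut (Tr D) A).card ≤ ∑ i, (cut (Tr D) fun t => U (t, i)).card :=
    Finset.single_le_sum (f := fun i => (cut (Tr D) fun t => U (t, i)).card)
      (fun _ _ => Nat.zero_le _) (Finset.mem_univ i)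
  have h3 : ∑ t ∈ Finset.univ.filter A,
      (Finset.univ.filter fun c => D.pos c = t ∧ D.typ c ≠ i).card ≤
      (Finset.univ.filter fun c =>
        ¬ (U (D.pos c, D.typ c + 1) ↔ U (D.pos c, D.typ c + 2))).card := by
    simp only [Finset.card_filter]
    rw [Finset.sum_comm]
    refine Finset.sum_le_sum fun c _ => ?_
    by_cases hi : D.typ c = i
    · simp [hi]
    by_cases hA : A (D.pos c)
    · have : ¬ (U (D.pos c, D.typ c + 1) ↔ U (D.pos c, D.typ c + 2)) := by
        have : (D.typ c + 1 = i ∧ D.typ c + 2 ≠ i) ∨ (D.typ c + 1 ≠ i ∧ D.typ c + 2 = i) := by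
          exact fin3_two _ _ hi
        rcases this with ⟨a, b⟩ | ⟨a, b⟩
        · rw [a]; have := hj (D.pos c) _ b; tauto
        · rw [b]; have := hj (D.pos c) _ a; tauto
      simp [this, hi]
      split_ifs; omega
    · rw [Finset.sum_eq_zero]
      · exact Nat.zero_le _
      · intro x hx
        have : D.pos c ≠ x := by rintro rfl; exact hA (by simpa using hx)
        simp [this]
  have h4 : ∑ s ∈ Finset.univ.filter A, 2 < ∑ s ∈ Finset.univ.filter A, valence (Lad D) (s, i) :=
    Finset.sum_lt_sum (fun s _ => h.val_two _) ⟨t, by simpa using hv, by omega⟩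
  simp only [val_lad, Finset.sum_add_distrib, Finset.sum_const, smul_eq_mul] at h4
  omega

theorem caseB (h : Good D) (U : Option D.N × Fin 3 → Prop) (i : Fin 3)
    (hi : ∀ t, ¬ U (t, i)) (hc : (cut (Lad D) U).card ≤ 2) :
    (∀ v, U v → valence (Lad D) v ≤ 2) ∨ (∀ v, ¬ U v → valence (Lad D) v ≤ 2) := by
  obtain ⟨j, k, hij, hik, hjk, hall⟩ : ∃ j k : Fin 3, i ≠ j ∧ i ≠ k ∧ j ≠ k ∧
      ∀ l, l = i ∨ l = j ∨ l = k := fin3_three i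
  by_cases hj : ∃ t, U (t, j)
  swap
  · push Not at hj
    left
    refine h.caseA U k (fun t l hl => ?_) hc
    rcases hall l with rfl | rfl | rfl
    exacts [hi t, hj t, absurd rfl hl]
  by_cases hk : ∃ t, U (t, k)
  swap
  · push Not at hk
    left
    refine h.caseA U j (fun t l hl => ?_) hc
    rcases hall l with rfl | rfl | rfl
    exacts [hi t, absurd rfl hl, hk t]
  have hsum : ∑ l, (cut (Tr D) fun t => U (t, l)).card ≥ (cut (Tr D) fun t => U (t, j)).card +
      (cut (Tr D) fun t => U (t, k)).card := by
    rw [← Finset.sum_pair (f := fun l => (cut (Tr D) fun t => U (t, l)).card) hjk]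
    exact Finset.sum_le_sum_of_subset (Finset.subset_univ _)
  have hpos : ∀ l, (∃ t, U (t, l)) → (¬ ∀ t, U (t, l)) →
      1 ≤ (cut (Tr D) fun t => U (t, l)).card := by
    rintro l ⟨t, ht⟩ hn
    by_contra h0
    have := cut_zero (A := fun t => U (t, l)) (Nat.lt_one_iff.1 (not_le.1 h0))
    exact hn fun s => (this s).2 ((this t).1 ht)
  have hleaf : ∀ t, tv D t = 1 → ∀ l, U (t, l) → ∃ c, D.pos c = t ∧
      c ∈ (Finset.univ.filter fun c =>
        ¬ (U (D.pos c, D.typ c + 1) ↔ U (D.pos c, D.typ c + 2))) := by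
    intro t ht l hl
    obtain ⟨c, hc, hc'⟩ := h.cap ht (fun l => U (t, l)) l i hl (hi t)
    exact ⟨c, hc, by rw [← hc] at hc'; simpa using hc'⟩
  have hfull : ∀ l, (∀ t, U (t, l)) → 2 ≤ (Finset.univ.filter fun c =>
        ¬ (U (D.pos c, D.typ c + 1) ↔ U (D.pos c, D.typ c + 2))).card := by
    intro l hl
    obtain ⟨t, t', hne, ht, ht'⟩ := h.two_leaves
    obtain ⟨c, hc, hm⟩ := hleaf t ht l (hl t)
    obtain ⟨c', hc', hm'⟩ := hleaf t' ht' l (hl t')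
    have : c ≠ c' := by rintro rfl; exact hne (hc.symm.trans hc')
    refine (Finset.card_pair this).symm.trans_le (Finset.card_le_card ?_)
    intro x hx
    rcases Finset.mem_insert.1 hx with rfl | hx
    · exact hm
    · rw [Finset.mem_singleton.1 hx]; exact hm'
  by_cases aj : ∀ t, U (t, j) <;> by_cases ak : ∀ t, U (t, k)
  · right
    refine h.caseA (fun v => ¬ U v) i (fun t l hl => ?_) ?_
    · rcases hall l with rfl | rfl | rfl
      exacts [absurd rfl hl, not_not.2 (aj t), not_not.2 (ak t)]
    · have : cut (Lad D) (fun v => ¬ U v) = cut (Lad D) U := by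
        ext e; rw [mem_cut, mem_cut]; tauto
      rw [this]; exact hc
  · rw [cut_lad] at hc
    have := hfull j aj
    have := hpos k hk ak
    omega
  · rw [cut_lad] at hc
    have := hfull k ak
    have := hpos j hj aj
    omega
  · rw [cut_lad] at hc
    have h1 := hpos j hj aj
    have h2 := hpos k hk ak
    have h5 : (cut (Tr D) fun t => U (t, j)).card ≤ 1 := by omega
    obtain ⟨t, ht, ht'⟩ := h.leaf_in (fun t => U (t, j)) hj h5
    obtain ⟨c, -, hm⟩ := hleaf t ht' j ht
    have := Finset.card_pos.2 ⟨c, hm⟩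
    omega

theorem cut_claim (h : Good D) (U : Option D.N × Fin 3 → Prop) (hc : (cut (Lad D) U).card ≤ 2) :
    (∀ v, U v → valence (Lad D) v ≤ 2) ∨ (∀ v, ¬ U v → valence (Lad D) v ≤ 2) := by
  obtain ⟨i, hi⟩ : ∃ i, (cut (Tr D) fun t => U (t, i)).card = 0 := by
    by_contra hcon
    push Not at hcon
    have : (Finset.univ : Finset (Fin 3)).card • 1 ≤ ∑ i, (cut (Tr D) fun t => U (t, i)).card :=
      Finset.card_nsmul_le_sum Finset.univ (fun i => (cut (Tr D) fun t => U (t, i)).card) 1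
        (fun i _ => Nat.pos_of_ne_zero (hcon i))
    rw [cut_lad] at hc
    rw [Finset.card_univ, Fintype.card_fin, smul_eq_mul] at this
    omega
  have h0 := cut_zero hi
  by_cases hn : U (none, i)
  · have : cut (Lad D) (fun v => ¬ U v) = cut (Lad D) U := by
      ext e; rw [mem_cut, mem_cut]; tauto
    have := h.caseB (fun v => ¬ U v) i (fun t => not_not.2 ((h0 t).2 hn)) (by rw [this]; exact hc)
    simp only [not_not] at this
    exact this.symm
  · exact h.caseB U i (fun t ht => hn ((h0 t).1 ht)) hc

end Good

/-- The canonical morphism. -/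
noncomputable def ladMor (D : LD) : CMorphism (Lad D) (Tr D) where
  vMap := fun v => v.1
  eMap := Sum.elim (fun x => Sum.inl x.1) (fun c => Sum.inr (D.pos c))
  mu := Sum.elim (fun _ => 1) (fun _ => 0)
  mu_zero := by rintro (e | e) <;> simp
  contract_ok := by
    rintro (e | e) v' h <;> simp at h
    subst h; exact ⟨rfl, rfl⟩
  edge_ok := by
    rintro (e | e) v' h <;> simp at h
    subst h; exact Or.inl ⟨rfl, rfl⟩

theorem ladMor_loc (t : Option D.N) (i : Fin 3) (n : D.N) :
    (ladMor D).locDeg (t, i) n = incid (Tr D) n t := by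
  rw [CMorphism.locDeg, Fintype.sum_sum_type, Fintype.sum_prod_type]
  simp only [ladMor, incid_strand, Sum.elim_inl, Sum.elim_inr, Sum.inl.injEq, reduceCtorEq, if_false]
  simp

theorem tr_incid {t : Option D.N} {n : D.N} (h : Incident (Tr D) n t) : incid (Tr D) n t = 1 := by
  have := par_ne n
  rcases h with h | h <;> change _ = t at h <;> subst h <;> simp [incid, par_ne]
  exact fun h => this h.symm

theorem tr_tree (D : LD) : IsTree (Tr D) := by
  refine ⟨?_, by simp⟩
  rw [connected_iff]
  refine ⟨⟨none⟩, fun u v => ?_⟩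
  have h0 : ∀ t, SReach (Tr D) Set.univ t none := by
    have h1 : ∀ k : ℕ, ∀ n : D.N, D.rk n = k → SReach (Tr D) Set.univ (some n) none := by
      intro k
      induction k using Nat.strong_induction_on with
      | _ k ih =>
        intro n hn
        have e : SReach (Tr D) Set.univ (some n) (D.par n) :=
          sreach_edge (G := Tr D) (e := n) (Set.mem_univ _)
        cases hp : D.par n with
        | none => rw [hp] at e; exact e
        | some m => rw [hp] at e; exact sreach_trans e (ih _ (hn ▸ D.rk_lt n m hp) m rfl)
    intro t
    cases t with
    | none => exact sreach_refl
    | some n => exact h1 _ n rfl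
  exact sreach_trans (h0 u) (sreach_symm (h0 v))

theorem Good.ex (h : Good D) : ∃ (K : CGraph) (q : K.V → (Lad D).V), StabReduces0 (Lad D) K ∧
      IsStable0 K ∧ Function.Injective q ∧
      Set.range q = {v | 3 ≤ valence (Lad D) v} ∧ ∀ x, valence K x = valence (Lad D) (q x) :=
  exists_stab _ (Lad D) rfl h.connected h.val_two
    (by obtain ⟨i, hi⟩ := h.val_three none; exact ⟨_, hi⟩)

/-- The stabilization of a good ladder. -/
noncomputable def St (h : Good D) : CGraph := h.ex.choose

noncomputable def Stq (h : Good D) : (St h).V → Option D.N × Fin 3 := h.ex.choose_spec.choose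

theorem St_red (h : Good D) : StabReduces0 (Lad D) (St h) := h.ex.choose_spec.choose_spec.1
theorem St_stable (h : Good D) : IsStable0 (St h) := h.ex.choose_spec.choose_spec.2.1
theorem Stq_inj (h : Good D) : Function.Injective (Stq h) := h.ex.choose_spec.choose_spec.2.2.1
theorem Stq_range (h : Good D) : Set.range (Stq h) = {v | 3 ≤ valence (Lad D) v} :=
  h.ex.choose_spec.choose_spec.2.2.2.1
theorem Stq_val (h : Good D) (x) : valence (St h) x = valence (Lad D) (Stq h x) :=
  h.ex.choose_spec.choose_spec.2.2.2.2 x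

theorem Stq_cover (h : Good D) (t) : ∃ x, (Stq h x).1 = t := by
  obtain ⟨i, hi⟩ := h.val_three t
  have : (t, i) ∈ Set.range (Stq h) := by rw [Stq_range]; exact hi
  obtain ⟨x, hx⟩ := this
  exact ⟨x, by rw [hx]⟩

theorem St_tec (h : Good D) : ThreeEdgeConnected (St h) := by
  obtain ⟨π⟩ := Ctr.ofStab (St_red h)
  exact π.tec (St_stable h) h.cut_claim

/-- The trigonal type of a good ladder. -/
noncomputable def TT (h : Good D) : TrigonalType where
  G := St h
  w := fun _ => 0
  stable := fun v _ => St_stable h v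
  conn := tec_conn (St_tec h) ⟨(Stq_cover h none).choose⟩
  threeEC := St_tec h
  Gphi := Lad D
  connphi := h.connected
  T := Tr D
  treeT := tr_tree D
  phi := ladMor D
  harm := by
    rintro ⟨t, i⟩ n m h1 h2
    rw [ladMor_loc, ladMor_loc]; exact (tr_incid h1).trans (tr_incid h2).symm
  nondeg := by
    rintro ⟨t, i⟩
    have : ∃ n : D.N, Incident (Tr D) n t := by
      cases t with
      | none => obtain ⟨n, hn⟩ := child_none h.ne; exact ⟨n, Or.inr hn⟩
      | some n => exact ⟨n, Or.inl rfl⟩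
    obtain ⟨n, hn⟩ := this
    exact ⟨n, hn, by rw [ladMor_loc, tr_incid hn]⟩
  deg3 := by
    intro n
    rw [Fintype.sum_sum_type, Fintype.sum_prod_type]
    simp [ladMor]
  stab := stab_iso' (St_red h) (withLoopsZero _).symm'
  vG := Stq h
  vG_inj := Stq_inj h
  cover := Stq_cover h

/-- The cell of a good ladder. -/
noncomputable def Cell (h : Good D) : WGraph := ⟨St h, fun _ => 0⟩

theorem cell_trig (h : Good D) : IsTrigonalGraph (Cell h) := ⟨TT h, wg_refl _⟩

theorem cell_max (h : Good D) (h3 : ∀ v, valence (Lad D) v ≤ 3) : MaximalTrigonal (Cell h) :=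
  max_of_cubic (TT h) (fun _ => rfl) (fun v => (Stq_val h v).trans_le (h3 _))

theorem St_card (h : Good D) : Fintype.card (St h).E + 3 = Fintype.card (St h).V + Fintype.card D.C := by
  obtain ⟨π⟩ := Ctr.ofStab (St_red h)
  have := π.card
  simp at this
  omega
end TG

open scoped Classical
namespace TG
open Relation CGraph
variable {G H K : CGraph} {D D' D'' : LD}

/-- Morphisms of ladder data contracting tree edges. -/
structure Mor (D D' : LD) where
  ν : D'.N → D.N
  κ : Option D.N → Option D'.N
  γ : D'.C → D.C
  κ_none : κ none = none
  κ_ν : ∀ m, κ (some (ν m)) = some m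
  drop : ∀ a, (∀ m, ν m ≠ a) → κ (some a) = κ (D.par a)
  par : ∀ m, D'.par m = κ (D.par (ν m))
  γ_bij : Function.Bijective γ
  pos : ∀ c, D'.pos c = κ (D.pos (γ c))
  typ : ∀ c, D'.typ c = D.typ (γ c)

namespace Mor

def refl (D : LD) : Mor D D where
  ν := id
  κ := id
  γ := id
  κ_none := rfl
  κ_ν _ := rfl
  drop a h := absurd rfl (h a)
  par _ := rfl
  γ_bij := Function.bijective_id
  pos _ := rfl
  typ _ := rfl

def trans (M : Mor D D') (M' : Mor D' D'') : Mor D D'' where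
  ν := M.ν ∘ M'.ν
  κ := M'.κ ∘ M.κ
  γ := M.γ ∘ M'.γ
  κ_none := by simp [M.κ_none, M'.κ_none]
  κ_ν m := by simp [M.κ_ν, M'.κ_ν]
  drop a h := by
    by_cases ha : ∃ m, M.ν m = a
    · obtain ⟨m, rfl⟩ := ha
      simp only [Function.comp, M.κ_ν]
      rw [M'.drop m (fun k hk => h k (by simp [hk])), M.par]
    · push Not at ha
      simp only [Function.comp]
      rw [M.drop a ha]
  par m := by simp [M.par, M'.par]
  γ_bij := M.γ_bij.comp M'.γ_bij
  pos c := by simp [M.pos, M'.pos]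
  typ c := by simp [M.typ, M'.typ]

theorem ν_inj (M : Mor D D') : Function.Injective M.ν := by
  intro a b h
  have := M.κ_ν a
  rw [h, M.κ_ν] at this
  exact (Option.some_injective _ this).symm

def rep (M : Mor D D') : Option D'.N → Option D.N := fun t => t.map M.ν

theorem κ_rep (M : Mor D D') (t) : M.κ (M.rep t) = t := by
  cases t with
  | none => exact M.κ_none
  | some m => exact M.κ_ν m

theorem reach (M : Mor D D') (i : Fin 3) (S : Set (Lad D).E)
    (hS : ∀ a, (∀ m, M.ν m ≠ a) → Sum.inl (a, i) ∈ S) (t) :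
    SReach (Lad D) S (t, i) (M.rep (M.κ t), i) := by
  have h1 : ∀ k : ℕ, ∀ n : D.N, D.rk n = k → SReach (Lad D) S (some n, i) (M.rep (M.κ (some n)), i) := by
    intro k
    induction k using Nat.strong_induction_on with
    | _ k ih =>
      intro n hn
      by_cases hm : ∃ m, M.ν m = n
      · obtain ⟨m, rfl⟩ := hm
        rw [M.κ_ν]; exact sreach_refl
      · push Not at hm
        have e : SReach (Lad D) S (some n, i) (D.par n, i) :=
          sreach_edge (G := Lad D) (e := Sum.inl (n, i)) (hS n hm)
        rw [M.drop n hm]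
        refine sreach_trans e ?_
        cases hp : D.par n with
        | none => rw [M.κ_none]; exact sreach_refl
        | some m => exact ih _ (hn ▸ D.rk_lt n m hp) m rfl
  cases t with
  | none => rw [M.κ_none]; exact sreach_refl
  | some n => exact h1 _ n rfl

def lfe (M : Mor D D') : (Lad D').E → (Lad D).E :=
  Sum.map (fun x => (M.ν x.1, x.2)) M.γ

theorem lfe_range (M : Mor D D') (e) : e ∈ (Set.range M.lfe)ᶜ ↔
    ∃ a i, e = Sum.inl (a, i) ∧ ∀ m, M.ν m ≠ a := by
  rcases e with ⟨a, i⟩ | c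
  · constructor
    · intro h
      refine ⟨a, i, rfl, ?_⟩
      rintro m rfl
      exact h ⟨Sum.inl (m, i), rfl⟩
    · rintro ⟨a', i', h, hm⟩
      obtain ⟨rfl, rfl⟩ := Prod.mk.inj (Sum.inl.inj h)
      rintro ⟨e | e, he⟩
      · simp [lfe] at he; exact hm _ he.1
      · simp [lfe] at he
  · constructor
    · intro h
      obtain ⟨c, rfl⟩ := M.γ_bij.2 c
      exact absurd ⟨Sum.inr c, rfl⟩ h
    · rintro ⟨a', i', h, hm⟩; cases h

noncomputable def ctr (M : Mor D D') : Ctr (Lad D) (Lad D') where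
  c := fun v => (M.κ v.1, v.2)
  fe := M.lfe
  surj := fun v => ⟨(M.rep v.1, v.2), by simp [M.κ_rep]⟩
  inj := by
    rintro (⟨a, i⟩ | c) (⟨b, j⟩ | d) h <;> simp [lfe] at h ⊢
    · exact ⟨M.ν_inj h.1, h.2⟩
    · exact M.γ_bij.1 h
  ends := by
    rintro (⟨a, i⟩ | c)
    · left; simp [lfe, M.κ_ν, M.par]
    · left; simp [lfe, M.pos, M.typ]
  fib := by
    rintro ⟨t, i⟩ ⟨s, j⟩ h
    obtain ⟨h1, rfl⟩ := Prod.mk.inj h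
    have hS : ∀ a, (∀ m, M.ν m ≠ a) → Sum.inl (a, i) ∈ (Set.range M.lfe)ᶜ :=
      fun a ha => (M.lfe_range _).2 ⟨a, i, rfl, ha⟩
    refine sreach_trans (M.reach i _ hS t) ?_
    simp only [] at h1
    rw [h1]
    exact sreach_symm (M.reach i _ hS s)
  drop := by
    intro e he
    obtain ⟨a, i, rfl, h⟩ := (M.lfe_range e).1 he
    simp [M.drop a h]
  card := by
    have := Fintype.card_congr (Equiv.ofBijective _ M.γ_bij)
    simp
    omega

theorem trig (M : Mor D D') (h : Good D) (h' : Good D') : TrigContraction (Cell h) (Cell h') := by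
  refine ⟨TT h, wg_refl _, (Set.range M.ctr.fe)ᶜ, ?_, Lad D', M.ctr.toCD, TT h', St h', wg_refl _,
    St_stable h', ?_, St_red h'⟩
  · intro e₁ e₂ he
    have key : ∀ e₁ e₂ : (Lad D).E, classMap (ladMor D) e₁ = classMap (ladMor D) e₂ →
        e₁ ∈ (Set.range M.lfe)ᶜ → e₂ ∈ (Set.range M.lfe)ᶜ := by
      intro e₁ e₂ he h1
      obtain ⟨a, i, rfl, ha⟩ := (M.lfe_range _).1 h1
      rcases e₂ with ⟨b, j⟩ | c
      · simp [classMap, ladMor] at he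
        subst he
        exact (M.lfe_range _).2 ⟨a, j, rfl, ha⟩
      · simp [classMap, ladMor] at he
    exact ⟨key e₁ e₂ he, key e₂ e₁ he.symm⟩
  · refine (M.ctr.toCD_zero) ▸ ?_
    exact stab_iso (withLoopsZero _) (St_red h')

theorem single (M : Mor D D') (h : Good D) (h' : Good D')
    (hc : Fintype.card D.N = Fintype.card D'.N + 1) :
    SingleClassContraction (Cell h) (Cell h') := by
  have h1 : (Finset.univ.image M.ν)ᶜ.card = 1 := by
    rw [Finset.card_compl, Finset.card_image_of_injective _ M.ν_inj, Finset.card_univ]; omega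
  obtain ⟨a, ha⟩ := Finset.card_eq_one.1 h1
  have ha : ∀ b, (∀ m, M.ν m ≠ b) ↔ b = a := by
    intro b
    have : b ∈ (Finset.univ.image M.ν)ᶜ ↔ b ∈ ({a} : Finset _) := by rw [ha]
    simpa using this
  have hS : (Set.range M.ctr.fe)ᶜ =
      {e | classMap (ladMor D) e = classMap (ladMor D) (Sum.inl (a, 0))} := by
    ext e
    refine (M.lfe_range e).trans ?_
    rcases e with ⟨b, j⟩ | c
    · simp [classMap, ladMor, ha]
    · simp [classMap, ladMor]
  refine ⟨TT h, wg_refl _, (Sum.inl (a, 0) : (Lad D).E), ?_⟩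
  have key : ∀ S : Set (Lad D).E, S = (Set.range M.ctr.fe)ᶜ → ∃ (H : CGraph)
      (cd : ContractionData (Lad D) S H) (𝒯' : TrigonalType) (K : CGraph),
        WGIso ⟨𝒯'.G, 𝒯'.w⟩ (Cell h') ∧ CGraph.IsStable0 K ∧
        StabReduces0 (withLoops H (contractedWeight cd fun _ => 0)) K ∧
        StabReduces0 𝒯'.Gphi K := by
    rintro _ rfl
    refine ⟨Lad D', M.ctr.toCD, TT h', St h', wg_refl _, St_stable h', ?_, St_red h'⟩
    refine (M.ctr.toCD_zero) ▸ ?_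
    exact stab_iso (withLoopsZero _) (St_red h')
  exact key _ hS.symm

theorem iso (M : Mor D D') (hc : Fintype.card D.N = Fintype.card D'.N) :
    Nonempty (CIso (Lad D) (Lad D')) :=
  M.ctr.toIso (by simp [hc])

theorem cut_fib (M : Mor D D') (t : Option D'.N) :
    (cut (Tr D) fun s => M.κ s = t).card = tv D' t := by
  have : tv D' t = ∑ m : D'.N, if Incident (Tr D') m t then 1 else 0 := by
    refine Finset.sum_congr rfl fun m _ => ?_
    by_cases h : Incident (Tr D') m t
    · rw [if_pos h]; exact tr_incid h
    · rw [if_neg h]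
      have := (incid_pos (e := m) (v := t) (G := Tr D')).not.2 h
      omega
  rw [this, ← Finset.card_filter]
  rw [← Finset.card_image_of_injective (Finset.univ.filter fun m => Incident (Tr D') m t) M.ν_inj]
  congr 1
  ext a
  rw [mem_cut, Finset.mem_image]
  constructor
  · intro h
    by_cases ha : ∃ m, M.ν m = a
    · obtain ⟨m, rfl⟩ := ha
      refine ⟨m, ?_, rfl⟩
      simp only [Finset.mem_filter, Finset.mem_univ, true_and]
      simp only [M.κ_ν, ← M.par] at h
      unfold Incident
      simp only []
      tauto
    · push Not at ha
      simp [M.drop a ha] at h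
  · rintro ⟨m, hm, rfl⟩
    simp only [Finset.mem_filter, Finset.mem_univ, true_and] at hm
    simp only [M.κ_ν, ← M.par]
    have hp := par_ne m
    rcases hm with hm | hm <;> change _ = t at hm <;> subst hm <;> simp
    · exact hp
    · exact fun h => hp h.symm

/-- Goodness is inherited. -/
theorem good (M : Mor D D') (h : Good D) (hn : Nonempty D'.N) : Good D' := by
  have hpush : ∀ s (c : D.C), D.pos c = s → ∃ c', D'.pos c' = M.κ s ∧ D'.typ c' = D.typ c := by
    intro s c hc
    obtain ⟨c', rfl⟩ := M.γ_bij.2 c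
    exact ⟨c', by rw [M.pos, hc], M.typ c'⟩
  have hone : ∀ s, tv D s = 1 → ∃ c c', D'.pos c = M.κ s ∧ D'.pos c' = M.κ s ∧
      D'.typ c ≠ D'.typ c' := by
    intro s hs
    obtain ⟨c, c', hc, hc', hne⟩ := h.one s hs
    obtain ⟨d, h1, h2⟩ := hpush s c hc
    obtain ⟨d', h1', h2'⟩ := hpush s c' hc'
    exact ⟨d, d', h1, h1', by rw [h2, h2']; exact hne⟩
  refine ⟨hn, fun t ht => ?_, fun t ht => ?_⟩
  · obtain ⟨s, hs, hs1⟩ := h.leaf_in (fun s => M.κ s = t) ⟨_, M.κ_rep t⟩ ((M.cut_fib t).trans ht).le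
    subst hs
    exact hone s hs1
  · obtain ⟨s, hs, hs2⟩ : ∃ s, M.κ s = t ∧ tv D s ≤ 2 := by
      obtain ⟨A, hA⟩ : ∃ A : Option D.N → Prop, A = fun s => M.κ s = t := ⟨_, rfl⟩
      have hr : A (M.rep t) := by rw [hA]; exact M.κ_rep t
      have h1 := tree_ineq A ⟨_, hr⟩
      have h5 : (cut (Tr D) A).card = 2 := by rw [hA]; exact (M.cut_fib t).trans ht
      by_contra hcon
      push Not at hcon
      have h2 := Finset.card_nsmul_le_sum (Finset.univ.filter A)
        (fun t => tv D t) 3 (by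
          intro s hs
          refine hcon s ?_
          have := (Finset.mem_filter.1 hs).2
          rwa [hA] at this)
      have h3 : 0 < (Finset.univ.filter A).card :=
        Finset.card_pos.2 ⟨M.rep t, by simpa using hr⟩
      simp only [smul_eq_mul] at h2
      omega
    subst hs
    have := tv_pos h.ne s
    by_cases hs1 : tv D s = 1
    · obtain ⟨c, -, hc, -⟩ := hone s hs1
      exact ⟨c, hc⟩
    · obtain ⟨c, hc⟩ := h.two s (by omega)
      obtain ⟨c', hc', -⟩ := hpush s c hc
      exact ⟨c', hc'⟩

end Mor

theorem cell_iso (i : CIso (Lad D) (Lad D')) (h : Good D) (h' : Good D') :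
    WGIso (Cell h) (Cell h') := by
  obtain ⟨j⟩ := stab_unique (St_red h) (stab_iso i (St_red h')) (St_stable h) (St_stable h')
  exact ⟨j, fun _ => rfl⟩

theorem cell_up {X : WGraph} (hX : MaximalTrigonal X) (M : Mor D D') (h : Good D) (h' : Good D')
    (i : WGIso (Cell h') X) : WGIso (Cell h) X :=
  hX.2 _ (cell_trig h) (trig_right (M.trig h h') i)

/-- the step relation -/
def Rel (A B : WGraph) : Prop := MaximalTrigonal A ∧ MaximalTrigonal B ∧
        (AdjacentCells A B ∨ WGIso A B)

theorem rel_symm {A B : WGraph} (h : Rel A B) : Rel B A := by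
  obtain ⟨h1, h2, ⟨Z, h3, h4⟩ | h3⟩ := h
  · exact ⟨h2, h1, Or.inl ⟨Z, h4, h3⟩⟩
  · exact ⟨h2, h1, Or.inr (wg_symm h3)⟩

end TG

open scoped Classical
namespace TG
open Relation CGraph
variable {G H K : CGraph} {D D' D'' d d' e e' : LD}

abbrev nilLD : LD where
  N := Empty
  C := Empty
  fN := inferInstance
  fC := inferInstance
  par := fun n => n.elim
  rk := fun n => n.elim
  rk_lt := fun n => n.elim
  pos := fun n => n.elim
  typ := fun n => n.elim

abbrev rungLD (p : Fin 3) (D : LD) : LD where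
  N := D.N
  C := Option D.C
  fN := inferInstance
  fC := inferInstance
  par := D.par
  rk := D.rk
  rk_lt := D.rk_lt
  pos := fun c => c.elim none D.pos
  typ := fun c => c.elim p D.typ

abbrev childLD (d e : LD) : LD where
  N := Option d.N ⊕ e.N
  C := d.C ⊕ e.C
  fN := inferInstance
  fC := inferInstance
  par := Sum.elim (fun x => x.elim none fun a => some (Sum.inl (d.par a)))
    (fun b => (e.par b).map Sum.inr)
  rk := Sum.elim (fun x => x.elim 0 fun a => d.rk a + 1) e.rk
  rk_lt := by
    rintro ((_ | a) | a) m h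
    · simp at h
    · simp only [Sum.elim_inl, Option.elim_some, Option.some.injEq] at h
      subst h
      cases hp : d.par a with
      | none => simp
      | some b => have := d.rk_lt a b hp; simpa using this
    · simp only [Sum.elim_inr, Option.map_eq_some_iff] at h
      obtain ⟨b, hb, rfl⟩ := h
      exact e.rk_lt a b hb
  pos := Sum.elim (fun c => some (Sum.inl (d.pos c))) (fun c => (e.pos c).map Sum.inr)
  typ := Sum.elim d.typ e.typ

theorem option_map_bij {α β : Type} {f : α → β} (h : Function.Bijective f) :
    Function.Bijective (Option.map f) := by
  refine ⟨Option.map_injective h.1, ?_⟩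
  rintro (_ | b)
  · exact ⟨none, rfl⟩
  · obtain ⟨a, rfl⟩ := h.2 b
    exact ⟨some a, rfl⟩

def Mor.rung (p : Fin 3) (M : Mor D D') : Mor (rungLD p D) (rungLD p D') where
  ν := M.ν
  κ := M.κ
  γ := Option.map M.γ
  κ_none := M.κ_none
  κ_ν := M.κ_ν
  drop := M.drop
  par := M.par
  γ_bij := option_map_bij M.γ_bij
  pos := by rintro (_ | c) <;> simp [M.κ_none, M.pos]
  typ := by rintro (_ | c) <;> simp [M.typ]

def Mor.child (M : Mor d d') (M' : Mor e e') : Mor (childLD d e) (childLD d' e') where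
  ν := Sum.map (Option.map M.ν) M'.ν
  κ := fun t => t.elim none (Sum.elim (fun x => some (Sum.inl (M.κ x)))
    (fun b => (M'.κ (some b)).map Sum.inr))
  γ := Sum.map M.γ M'.γ
  κ_none := rfl
  κ_ν := by rintro ((_ | m) | m) <;> simp [M.κ_none, M.κ_ν, M'.κ_ν]
  drop := by
    rintro ((_ | a) | a) h
    · exact absurd rfl (h (Sum.inl none))
    · have := M.drop a (fun m hm => h (Sum.inl (some m)) (by simp [hm]))
      simp [this]
    · have := M'.drop a (fun m hm => h (Sum.inr m) (by simp [hm]))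
      simp only [Option.elim_some, Sum.elim_inr, this]
      cases e.par a <;> simp [M'.κ_none]
  par := by
    rintro ((_ | a) | a)
    · simp
    · simp [M.par]
    · simp only [Sum.elim_inr, M'.par, Sum.map_inr]
      cases e.par (M'.ν a) <;> simp [M'.κ_none]
  γ_bij := Sum.map_bijective.2 ⟨M.γ_bij, M'.γ_bij⟩
  pos := by
    rintro (c | c)
    · simp [M.pos]
    · simp only [Sum.elim_inr, M'.pos, Sum.map_inr]
      cases e.pos (M'.γ c) <;> simp [M'.κ_none]
  typ := by rintro (c | c) <;> simp [M.typ, M'.typ]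

/-- contraction of the edge to the only item of the root -/
def Mor.flat (D : LD) : Mor (childLD D nilLD) D where
  ν := fun m => Sum.inl (some m)
  κ := fun t => t.elim none (Sum.elim id (fun b => b.elim))
  γ := Sum.inl
  κ_none := rfl
  κ_ν _ := rfl
  drop := by
    rintro ((_ | a) | a) h
    · rfl
    · exact absurd rfl (h a)
    · exact a.elim
  par _ := rfl
  γ_bij := ⟨Sum.inl_injective, by rintro (c | c); exacts [⟨c, rfl⟩, c.elim]⟩
  pos _ := rfl
  typ _ := rfl

def Mor.rr (p q : Fin 3) (D : LD) : Mor (rungLD p (rungLD q D)) (rungLD q (rungLD p D)) where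
  ν := id
  κ := id
  γ := fun c => match c with
    | none => some none
    | some none => none
    | some (some c) => some (some c)
  κ_none := rfl
  κ_ν _ := rfl
  drop a h := absurd rfl (h a)
  par _ := rfl
  γ_bij := by
    constructor
    · rintro (_ | _ | a) (_ | _ | b) h <;> simp at h ⊢
      exact h
    · rintro (_ | _ | a)
      exacts [⟨some none, rfl⟩, ⟨none, rfl⟩, ⟨some (some a), rfl⟩]
  pos := by rintro (_ | _ | a) <;> rfl
  typ := by rintro (_ | _ | a) <;> rfl

def Mor.rc (p : Fin 3) (d e : LD) : Mor (rungLD p (childLD d e)) (childLD d (rungLD p e)) where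
  ν := id
  κ := id
  γ := fun c => match c with
    | Sum.inl c => some (Sum.inl c)
    | Sum.inr none => none
    | Sum.inr (some c) => some (Sum.inr c)
  κ_none := rfl
  κ_ν _ := rfl
  drop a h := absurd rfl (h a)
  par _ := rfl
  γ_bij := by
    constructor
    · rintro (a | _ | a) (b | _ | b) h <;> simp at h ⊢ <;> exact h
    · rintro (_ | a | a)
      exacts [⟨Sum.inr none, rfl⟩, ⟨Sum.inl a, rfl⟩, ⟨Sum.inr (some a), rfl⟩]
  pos := by rintro (a | _ | a) <;> rfl
  typ := by rintro (a | _ | a) <;> rfl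

def Mor.cr (p : Fin 3) (d e : LD) : Mor (childLD d (rungLD p e)) (rungLD p (childLD d e)) where
  ν := id
  κ := id
  γ := fun c => match c with
    | none => Sum.inr none
    | some (Sum.inl c) => Sum.inl c
    | some (Sum.inr c) => Sum.inr (some c)
  κ_none := rfl
  κ_ν _ := rfl
  drop a h := absurd rfl (h a)
  par _ := rfl
  γ_bij := by
    constructor
    · rintro (_ | a | a) (_ | b | b) h <;> simp at h ⊢ <;> exact h
    · rintro (a | _ | a)
      exacts [⟨some (Sum.inl a), rfl⟩, ⟨none, rfl⟩, ⟨some (Sum.inr a), rfl⟩]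
  pos := by rintro (_ | a | a) <;> rfl
  typ := by rintro (_ | a | a) <;> rfl

def swp {α β γ : Type} : α ⊕ (β ⊕ γ) → β ⊕ (α ⊕ γ)
  | Sum.inl a => Sum.inr (Sum.inl a)
  | Sum.inr (Sum.inl b) => Sum.inl b
  | Sum.inr (Sum.inr c) => Sum.inr (Sum.inr c)

theorem swp_swp {α β γ : Type} (x : α ⊕ (β ⊕ γ)) : swp (swp x) = x := by
  rcases x with a | b | c <;> rfl

def Mor.cc (a b c : LD) : Mor (childLD a (childLD b c)) (childLD b (childLD a c)) where
  ν := swp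
  κ := Option.map swp
  γ := swp
  κ_none := rfl
  κ_ν m := by simp [swp_swp]
  drop a h := absurd (swp_swp a) (h _)
  par := by
    rintro ((_ | x) | (_ | x) | x) <;> simp [swp]
    cases c.par x <;> rfl
  γ_bij := ⟨fun x y h => by rw [← swp_swp x, h, swp_swp], fun x => ⟨_, swp_swp x⟩⟩
  pos := by
    rintro (x | x | x) <;> simp [swp]
    cases c.pos x <;> rfl
  typ := by rintro (x | x | x) <;> rfl

/-- Rerooting. -/
theorem reroot (d e : LD) : Nonempty (CIso (Lad (childLD d e)) (Lad (childLD e d))) := by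
  let f : ∀ d e : LD, Option (Option d.N ⊕ e.N) → Option (Option e.N ⊕ d.N) := fun d e t =>
    match t with
    | none => some (Sum.inl none)
    | some (Sum.inl none) => none
    | some (Sum.inl (some a)) => some (Sum.inr a)
    | some (Sum.inr b) => some (Sum.inl (some b))
  have hf : ∀ d e t, f e d (f d e t) = t := by rintro d e (_ | (_ | a) | b) <;> rfl
  let g : ∀ d e : LD, Option d.N ⊕ e.N → Option e.N ⊕ d.N := fun d e t =>
    match t with
    | Sum.inl none => Sum.inl none
    | Sum.inl (some a) => Sum.inr a
    | Sum.inr b => Sum.inl (some b)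
  have hg : ∀ d e t, g e d (g d e t) = t := by rintro d e ((_ | a) | b) <;> rfl
  have h1 : ∀ d e : LD, ∀ t : Option d.N, f d e (some (Sum.inl t)) = t.map Sum.inr := by
    rintro d e (_ | a) <;> rfl
  have h2 : ∀ d e : LD, ∀ t : Option e.N, f d e (t.map Sum.inr) = some (Sum.inl t) := by
    rintro d e (_ | a) <;> rfl
  refine ⟨⟨⟨fun v => (f d e v.1, v.2), fun v => (f e d v.1, v.2), ?_, ?_⟩,
    ⟨Sum.map (fun x => (g d e x.1, x.2)) Sum.swap, Sum.map (fun x => (g e d x.1, x.2)) Sum.swap,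
      ?_, ?_⟩, ?_⟩⟩
  · rintro ⟨v, i⟩; simp [hf]
  · rintro ⟨v, i⟩; simp [hf]
  · rintro (⟨v, i⟩ | c) <;> simp [hg]
  · rintro (⟨v, i⟩ | c) <;> simp [hg]
  · rintro (⟨(_ | a) | b, i⟩ | c | c)
    · right; exact ⟨rfl, rfl⟩
    · left; simp only [Sum.elim_inl, Option.elim_some, Equiv.coe_fn_mk, h1]; exact ⟨rfl, rfl⟩
    · left; simp only [Sum.elim_inl, Sum.elim_inr, Equiv.coe_fn_mk, h2]; exact ⟨rfl, rfl⟩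
    · left; simp only [Sum.elim_inl, Sum.elim_inr, Equiv.coe_fn_mk, h1]; exact ⟨rfl, rfl⟩
    · left; simp only [Sum.elim_inr, Equiv.coe_fn_mk, h2]; exact ⟨rfl, rfl⟩

/-! ### local conditions -/

noncomputable def ch (D : LD) (t : Option D.N) : ℕ := (Finset.univ.filter fun m => D.par m = t).card
noncomputable def rgc (D : LD) (t : Option D.N) (i : Fin 3) : ℕ :=
  (Finset.univ.filter fun c => D.pos c = t ∧ D.typ c ≠ i).card

theorem ch_nil (t) : ch nilLD t = 0 := by simp [ch]
theorem ch_rung (p t) : ch (rungLD p D) t = ch D t := rfl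
theorem ch_child_none : ch (childLD d e) none = 1 + ch e none := by
  simp only [ch, Finset.card_filter]
  rw [Fintype.sum_sum_type, Fintype.sum_option]
  simp
theorem ch_child_inl (x) : ch (childLD d e) (some (Sum.inl x)) = ch d x := by
  simp only [ch, Finset.card_filter]
  rw [Fintype.sum_sum_type, Fintype.sum_option]
  simp
theorem ch_child_inr (x) : ch (childLD d e) (some (Sum.inr x)) = ch e (some x) := by
  simp only [ch, Finset.card_filter]
  rw [Fintype.sum_sum_type, Fintype.sum_option]
  simp

theorem rgc_nil (t i) : rgc nilLD t i = 0 := by simp [rgc]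
theorem rgc_rung_none (p i) : rgc (rungLD p D) none i = (if p = i then 0 else 1) + rgc D none i := by
  simp only [rgc, Finset.card_filter]
  rw [Fintype.sum_option]
  congr 1
  simp
theorem rgc_rung_some (p i x) : rgc (rungLD p D) (some x) i = rgc D (some x) i := by
  simp only [rgc, Finset.card_filter]
  rw [Fintype.sum_option]
  rw [if_neg (by simp), zero_add]
  rfl
theorem rgc_child_none (i) : rgc (childLD d e) none i = rgc e none i := by
  simp only [rgc, Finset.card_filter]
  rw [Fintype.sum_sum_type]
  simp
theorem rgc_child_inl (x i) : rgc (childLD d e) (some (Sum.inl x)) i = rgc d x i := by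
  simp only [rgc, Finset.card_filter]
  rw [Fintype.sum_sum_type]
  simp
theorem rgc_child_inr (x i) : rgc (childLD d e) (some (Sum.inr x)) i = rgc e (some x) i := by
  simp only [rgc, Finset.card_filter]
  rw [Fintype.sum_sum_type]
  simp

/-- local condition at a node with one further edge -/
def Q (D : LD) (t : Option D.N) : Prop :=
  (ch D t = 0 → ∃ c c', D.pos c = t ∧ D.pos c' = t ∧ D.typ c ≠ D.typ c') ∧
  (ch D t = 1 → ∃ c, D.pos c = t)

theorem Q_rung_some (p x) : Q (rungLD p D) (some x) ↔ Q D (some x) := by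
  unfold Q
  simp only [ch_rung, Option.exists]
  simp
theorem Q_child_inl (x) : Q (childLD d e) (some (Sum.inl x)) ↔ Q d x := by
  unfold Q
  rw [ch_child_inl]
  simp only [Sum.exists]
  simp
theorem Q_child_inr (x) : Q (childLD d e) (some (Sum.inr x)) ↔ Q e (some x) := by
  unfold Q
  rw [ch_child_inr]
  simp only [Sum.exists]
  simp

theorem good_child : Good (childLD d e) ↔ (∀ t, Q d t) ∧ ∀ t, Q e t := by
  have hs : ∀ D : LD, ∀ n, tv D (some n) = 1 + ch D (some n) := fun D n => tv_some n
  have hn : tv (childLD d e) none = 1 + ch e none := tv_none.trans ch_child_none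
  have key : ∀ D : LD, ∀ n, ((tv D (some n) = 1 → ∃ c c', D.pos c = some n ∧ D.pos c' = some n ∧
      D.typ c ≠ D.typ c') ∧ (tv D (some n) = 2 → ∃ c, D.pos c = some n)) ↔ Q D (some n) := by
    intro D n
    rw [hs, Q]
    have h1 : 1 + ch D (some n) = 1 ↔ ch D (some n) = 0 := by omega
    have h2 : 1 + ch D (some n) = 2 ↔ ch D (some n) = 1 := by omega
    rw [h1, h2]
  have key0 : ((tv (childLD d e) none = 1 → ∃ c c', (childLD d e).pos c = none ∧
      (childLD d e).pos c' = none ∧ (childLD d e).typ c ≠ (childLD d e).typ c') ∧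
      (tv (childLD d e) none = 2 → ∃ c, (childLD d e).pos c = none)) ↔ Q e none := by
    rw [hn, Q]
    have h1 : 1 + ch e none = 1 ↔ ch e none = 0 := by omega
    have h2 : 1 + ch e none = 2 ↔ ch e none = 1 := by omega
    rw [h1, h2]
    simp only [Sum.exists]
    simp
  constructor
  · intro h
    refine ⟨fun t => (Q_child_inl (d := d) (e := e) t).1 ((key _ _).1 ⟨h.one _, h.two _⟩), ?_⟩
    rintro (_ | x)
    · exact key0.1 ⟨h.one _, h.two _⟩
    · exact (Q_child_inr (d := d) (e := e) x).1 ((key _ _).1 ⟨h.one _, h.two _⟩)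
  · rintro ⟨h1, h2⟩
    have : ∀ t, (tv (childLD d e) t = 1 → ∃ c c', (childLD d e).pos c = t ∧
      (childLD d e).pos c' = t ∧ (childLD d e).typ c ≠ (childLD d e).typ c') ∧
      (tv (childLD d e) t = 2 → ∃ c, (childLD d e).pos c = t) := by
      rintro (_ | x | x)
      · exact key0.2 (h2 none)
      · exact (key _ _).2 ((Q_child_inl x).2 (h1 x))
      · exact (key _ _).2 ((Q_child_inr x).2 (h2 _))
    exact ⟨⟨Sum.inl none⟩, fun t => (this t).1, fun t => (this t).2⟩

theorem cubic_child (h1 : ∀ t i, ch d t + rgc d t i ≤ 2) (h2 : ∀ t i, ch e t + rgc e t i ≤ 2) :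
    ∀ v, valence (Lad (childLD d e)) v ≤ 3 := by
  rintro ⟨_ | x | x, i⟩
  · rw [val_lad]
    have h3 : tv (childLD d e) none = 1 + ch e none := tv_none.trans ch_child_none
    have h4 := rgc_child_none (d := d) (e := e) i
    have := h2 none i
    unfold rgc at h4 this
    omega
  · rw [val_lad]
    have h3 : tv (childLD d e) (some (Sum.inl x)) = 1 + ch d x := 
      (tv_some _).trans (congrArg (1 + ·) (ch_child_inl x))
    have h4 := rgc_child_inl (d := d) (e := e) x i
    have := h1 x i
    unfold rgc at h4 this
    omega
  · rw [val_lad]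
    have h3 : tv (childLD d e) (some (Sum.inr x)) = 1 + ch e (some x) := 
      (tv_some _).trans (congrArg (1 + ·) (ch_child_inr x))
    have h4 := rgc_child_inr (d := d) (e := e) x i
    have := h2 (some x) i
    unfold rgc at h4 this
    omega

end TG

open scoped Classical
namespace TG
open Relation CGraph
variable {G H K : CGraph} {D D' D'' d d' e e' : LD}

inductive F where
  | nil : F
  | rung : Fin 3 → F → F
  | child : F → F → F

abbrev DF : F → LD
  | F.nil => nilLD
  | F.rung p f => rungLD p (DF f)
  | F.child c r => childLD (DF c) (DF r)

inductive Cub where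
  | leaf (p q : Fin 3) (h : p ≠ q) : Cub
  | rung : Fin 3 → Cub → Cub
  | br : Cub → Cub → Cub

abbrev DC : Cub → LD
  | Cub.leaf p q _ => rungLD p (rungLD q nilLD)
  | Cub.rung p t => rungLD p (childLD (DC t) nilLD)
  | Cub.br s t => childLD (DC s) (childLD (DC t) nilLD)

theorem Q_rung_none (p) : Q (rungLD p D) none ↔
    (ch D none = 0 → ∃ c, D.pos c = none ∧ D.typ c ≠ p) := by
  unfold Q
  rw [ch_rung]
  constructor
  · rintro ⟨h, -⟩ h0
    obtain ⟨c, c', hc, hc', hne⟩ := h h0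
    have : ∀ x : Option D.C, (rungLD p D).pos x = none → (rungLD p D).typ x ≠ p →
        ∃ c, D.pos c = none ∧ D.typ c ≠ p := by
      rintro (_ | x) h1 h2
      · exact absurd rfl h2
      · exact ⟨x, h1, h2⟩
    by_cases hp : (rungLD p D).typ c = p
    · exact this c' hc' (fun h => hne (hp.trans h.symm))
    · exact this c hc hp
  · intro h
    refine ⟨fun h0 => ?_, fun _ => ⟨none, rfl⟩⟩
    obtain ⟨c, hc, hne⟩ := h h0
    exact ⟨some c, none, hc, rfl, hne⟩

theorem Q_child_none : Q (childLD d e) none ↔ (ch e none = 0 → ∃ c, e.pos c = none) := by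
  unfold Q
  rw [ch_child_none]
  have h1 : 1 + ch e none = 1 ↔ ch e none = 0 := by omega
  have h0 : ¬ (1 + ch e none = 0) := by omega
  rw [h1]
  simp only [h0, false_imp_iff, true_and, Sum.exists]
  simp

theorem Q_nil : ¬ Q nilLD none := by
  intro h
  obtain ⟨c, -⟩ := h.1 (ch_nil _)
  exact c.elim

theorem Q_rung_iff (p) : (∀ t, Q (rungLD p D) t) ↔ Q (rungLD p D) none ∧ ∀ x, Q D (some x) :=
  ⟨fun h => ⟨h _, fun x => (Q_rung_some p x).1 (h _)⟩, fun h t => by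
    cases t with
    | none => exact h.1
    | some x => exact (Q_rung_some p x).2 (h.2 x)⟩

theorem Q_child_iff : (∀ x, Q (childLD d e) (some x)) ↔ (∀ t, Q d t) ∧ ∀ x, Q e (some x) :=
  ⟨fun h => ⟨fun t => (Q_child_inl t).1 (h _), fun x => (Q_child_inr (d := d) x).1 (h _)⟩,
    fun h t => by
    rcases t with t | t
    · exact (Q_child_inl t).2 (h.1 t)
    · exact (Q_child_inr (d := d) t).2 (h.2 t)⟩

theorem Q_child_iff' : (∀ x, Q (childLD d e) x) ↔
    Q (childLD d e) none ∧ (∀ t, Q d t) ∧ ∀ x, Q e (some x) := by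
  rw [← Q_child_iff]
  exact ⟨fun h => ⟨h _, fun _ => h _⟩, fun h t => by cases t with
    | none => exact h.1
    | some x => exact h.2 x⟩

theorem Q_all : (∀ t, Q D t) ↔ Q D none ∧ ∀ x, Q D (some x) :=
  ⟨fun h => ⟨h _, fun x => h _⟩, fun h t => by
    cases t with
    | none => exact h.1
    | some x => exact h.2 x⟩

def Ex (D : LD) : Prop := ∃ s, Nonempty (Mor (DC s) D)

theorem Ex.mor (h : Ex D) (M : Mor D D') : Ex D' := by
  obtain ⟨s, ⟨M'⟩⟩ := h; exact ⟨s, ⟨M'.trans M⟩⟩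

theorem Ex.rung (p) (h : Ex D) : Ex (rungLD p D) := by
  obtain ⟨s, ⟨M⟩⟩ := h
  exact ⟨Cub.rung p s, ⟨Mor.rung p ((Mor.child M (Mor.refl _)).trans (Mor.flat D))⟩⟩

theorem Ex.child (h : Ex d) (h' : Ex D) : Ex (childLD d D) := by
  obtain ⟨s, ⟨M⟩⟩ := h
  obtain ⟨t, ⟨M'⟩⟩ := h'
  exact ⟨Cub.br s t, ⟨Mor.child M ((Mor.child M' (Mor.refl _)).trans (Mor.flat D))⟩⟩

theorem DF_nil {f : F} (h : ch (DF f) none = 0) (h' : ∀ c, (DF f).pos c ≠ none) : f = F.nil := by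
  cases f with
  | nil => rfl
  | rung p f => exact absurd rfl (h' none)
  | child c f => 
    rw [DF, ch_child_none] at h; omega

theorem not_Q_rung {p} (h : ¬ Q (rungLD p D) none) : ch D none = 0 ∧
    ∀ c, D.pos c = none → D.typ c = p := by
  rw [Q_rung_none] at h
  push Not at h
  exact h

theorem not_Q_child {f : F} (h : ¬ Q (childLD d (DF f)) none) : f = F.nil := by
  rw [Q_child_none] at h
  push Not at h
  exact DF_nil h.1 h.2

theorem expand : ∀ n : ℕ, ∀ f : F, sizeOf f ≤ n → (∀ t, Q (DF f) t) → Ex (DF f) := by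
  intro n
  induction n with
  | zero => intro f hf; cases f <;> simp at hf
  | succ n ih =>
    intro f hf hQ
    cases f with
    | nil => exact absurd (hQ none) Q_nil
    | rung r f =>
      simp only [F.rung.sizeOf_spec] at hf
      have hQ1 := (Q_rung_iff r).1 hQ
      by_cases h0 : Q (DF f) none
      · exact (ih f (by omega) (Q_all.2 ⟨h0, hQ1.2⟩)).rung r
      cases f with
      | nil =>
        obtain ⟨c, -⟩ := (Q_rung_none r).1 hQ1.1 (ch_nil _)
        exact c.elim
      | rung q f =>
        simp only [F.rung.sizeOf_spec] at hf
        have hQ2 : ∀ x, Q (DF f) (some x) := fun x => (Q_rung_some q x).1 (hQ1.2 x)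
        by_cases h1 : Q (DF (F.rung r f)) none
        · have := (ih (F.rung r f) (by simp only [F.rung.sizeOf_spec]; omega)
            ((Q_rung_iff r).2 ⟨h1, hQ2⟩)).rung q
          exact this.mor (Mor.rr _ _ _)
        · have h2 := not_Q_rung h0
          have h3 := not_Q_rung h1
          obtain ⟨c, hc, hcr⟩ := (Q_rung_none r).1 hQ1.1 h2.1
          have hqr : q ≠ r := by
            rcases c with _ | c
            · exact hcr
            · exact absurd (h3.2 c hc) hcr
          have : f = F.nil := DF_nil h2.1 fun c hc => hqr ((h2.2 c hc).symm.trans (h3.2 c hc))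
          subst this
          exact ⟨Cub.leaf r q hqr.symm, ⟨Mor.refl _⟩⟩
      | child c f =>
        simp only [F.child.sizeOf_spec] at hf
        have := not_Q_child h0
        subst this
        have hc := (Q_child_iff.1 hQ1.2).1
        obtain ⟨s, ⟨M⟩⟩ := ih c (by omega) hc
        exact ⟨Cub.rung r s, ⟨Mor.rung r (Mor.child M (Mor.refl _))⟩⟩
    | child c f =>
      simp only [F.child.sizeOf_spec] at hf
      obtain ⟨hQ0, hQc, hQf⟩ := Q_child_iff'.1 hQ
      have hc := ih c (by omega) hQc
      by_cases h0 : Q (DF f) none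
      · exact hc.child (ih f (by omega) (Q_all.2 ⟨h0, hQf⟩))
      cases f with
      | nil =>
        obtain ⟨c, -⟩ := Q_child_none.1 hQ0 (ch_nil _)
        exact c.elim
      | child d f =>
        simp only [F.child.sizeOf_spec] at hf
        have := not_Q_child h0
        subst this
        have hd := (Q_child_iff.1 hQf).1
        obtain ⟨s, ⟨M⟩⟩ := hc
        obtain ⟨t, ⟨M'⟩⟩ := ih d (by omega) hd
        exact ⟨Cub.br s t, ⟨Mor.child M (Mor.child M' (Mor.refl _))⟩⟩
      | rung q f =>
        simp only [F.rung.sizeOf_spec] at hf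
        have h2 := not_Q_rung h0
        by_cases hn : f = F.nil
        · subst hn
          obtain ⟨s, ⟨M⟩⟩ := hc
          exact ⟨Cub.rung q s, ⟨(Mor.rc q _ _).trans (Mor.child M (Mor.refl _))⟩⟩
        · have h3 : ∃ c, (DF f).pos c = none := by
            by_contra h
            push Not at h
            exact hn (DF_nil h2.1 h)
          have := (ih (F.child c f) (by simp only [F.child.sizeOf_spec]; omega)
            (Q_child_iff'.2 ⟨Q_child_none.2 fun _ => h3, hQc,
              fun x => (Q_rung_some q x).1 (hQf x)⟩)).rung q
          exact this.mor (Mor.rc q _ _)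

theorem DC_Q (s : Cub) : ∀ t, Q (DC s) t := by
  induction s with
  | leaf p q h =>
    refine (Q_rung_iff p).2 ⟨(Q_rung_none p).2 fun _ => ⟨none, rfl, h.symm⟩, fun x => x.elim⟩
  | rung p t ih =>
    refine (Q_rung_iff p).2 ⟨(Q_rung_none p).2 fun h => ?_, Q_child_iff.2 ⟨ih, fun x => x.elim⟩⟩
    rw [ch_child_none] at h; omega
  | br s t ih ih' =>
    refine Q_child_iff'.2 ⟨Q_child_none.2 fun h => ?_, ih, Q_child_iff.2 ⟨ih', fun x => x.elim⟩⟩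
    rw [ch_child_none] at h; omega

theorem DC_cub (s : Cub) : ∀ t i, ch (DC s) t + rgc (DC s) t i ≤ 2 := by
  induction s with
  | leaf p q h =>
    rintro (_ | x) i
    · have h1 : ch (DC (Cub.leaf p q h)) none = 0 := by
        rw [DC, ch_rung, ch_rung, ch_nil]
      have h2 : rgc (DC (Cub.leaf p q h)) none i ≤ 2 := by
        rw [DC, rgc_rung_none, rgc_rung_none, rgc_nil]
        split_ifs <;> omega
      omega
    · exact x.elim
  | rung p t ih =>
    rintro (_ | (x | x)) i
    · have h1 : ch (DC (Cub.rung p t)) none = 1 := by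
        rw [DC, ch_rung, ch_child_none, ch_nil]
      have h2 : rgc (DC (Cub.rung p t)) none i ≤ 1 := by
        rw [DC, rgc_rung_none, rgc_child_none, rgc_nil]
        split_ifs <;> omega
      omega
    · have h1 : ch (DC (Cub.rung p t)) (some (Sum.inl x)) = ch (DC t) x := (ch_child_inl (e := nilLD) x)
      have h2 : rgc (DC (Cub.rung p t)) (some (Sum.inl x)) i = rgc (DC t) x i := (rgc_rung_some _ _ _).trans (rgc_child_inl x i)
      have := ih x i
      omega
    · exact x.elim
  | br s t ih ih' =>
    rintro (_ | (x | (x | x))) i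
    · have h1 : ch (DC (Cub.br s t)) none = 2 := by
        rw [DC, ch_child_none, ch_child_none, ch_nil]
      have h2 : rgc (DC (Cub.br s t)) none i = 0 := by
        rw [DC, rgc_child_none, rgc_child_none, rgc_nil]
      omega
    · have h1 : ch (DC (Cub.br s t)) (some (Sum.inl x)) = ch (DC s) x := ch_child_inl x
      have h2 : rgc (DC (Cub.br s t)) (some (Sum.inl x)) i = rgc (DC s) x i := rgc_child_inl x i
      have := ih x i
      omega
    · have h1 : ch (DC (Cub.br s t)) (some (Sum.inr (Sum.inl x))) = ch (DC t) x := (ch_child_inr _).trans (ch_child_inl x)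
      have h2 : rgc (DC (Cub.br s t)) (some (Sum.inr (Sum.inl x))) i = rgc (DC t) x i := (rgc_child_inr _ _).trans (rgc_child_inl x i)
      have := ih' x i
      omega
    · exact x.elim

theorem DC_card (s : Cub) : Fintype.card (DC s).C = Fintype.card (DC s).N + 2 := by
  induction s with
  | leaf p q h => rfl
  | rung p t ih => simp only [DC, Fintype.card_option, Fintype.card_sum] at ih ⊢; simp; omega
  | br s t ih ih' => simp only [DC, Fintype.card_option, Fintype.card_sum] at ih ih' ⊢; simp; omega

abbrev E2 (s t : Cub) : LD := childLD (DC s) (DC t)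

theorem E2_good (s t : Cub) : Good (E2 s t) := good_child.2 ⟨DC_Q s, DC_Q t⟩
theorem E2_cub (s t : Cub) : ∀ v, valence (Lad (E2 s t)) v ≤ 3 :=
  cubic_child (DC_cub s) (DC_cub t)
noncomputable abbrev EC (s t : Cub) : WGraph := Cell (E2_good s t)
theorem EC_max (s t : Cub) : MaximalTrigonal (EC s t) := cell_max _ (E2_cub s t)

end TG

open scoped Classical
namespace TG
open Relation CGraph
variable {G H K : CGraph} {D D' D'' d d' e e' : LD}

theorem peel_rung (D : LD) (c0 : D.C) (h0 : D.pos c0 = none) :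
    ∃ D1 : LD, Nonempty (Mor D (rungLD (D.typ c0) D1)) ∧ Fintype.card D.N = Fintype.card D1.N := by
  let D1 : LD :=
    { N := D.N, C := {c // c ≠ c0}, fN := inferInstance, fC := inferInstance, par := D.par,
      rk := D.rk, rk_lt := D.rk_lt, pos := fun c => D.pos c.1, typ := fun c => D.typ c.1 }
  refine ⟨D1, ⟨⟨id, id, fun c => c.elim c0 (fun c => c.1), rfl, fun _ => rfl,
    fun a h => absurd rfl (h a), fun _ => rfl, ⟨?_, ?_⟩, ?_, ?_⟩⟩, rfl⟩
  · rintro (_ | ⟨a, ha⟩) (_ | ⟨b, hb⟩) h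
    · rfl
    · exact absurd h.symm hb
    · exact absurd h ha
    · have : a = b := h
      subst this; rfl
  · intro c
    by_cases h : c = c0
    · exact ⟨none, h.symm⟩
    · exact ⟨some ⟨c, h⟩, rfl⟩
  · rintro (_ | c)
    · exact h0.symm
    · rfl
  · rintro (_ | c) <;> rfl

theorem peel_child (D : LD) (n0 : D.N) (h0 : D.par n0 = none) :
    ∃ d e : LD, ∃ M : Mor D (childLD d e), Function.Bijective M.ν := by
  let B : D.N → Prop := fun m => ReflTransGen (fun a b => D.par a = some b) m n0
  have hB0 : B n0 := ReflTransGen.refl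
  have hBn : ∀ m, B m → m ≠ n0 → ∃ b, D.par m = some b ∧ B b := by
    intro m hm hne
    rcases ReflTransGen.cases_head hm with h | ⟨b, h1, h2⟩
    · exact absurd h hne
    · exact ⟨b, h1, h2⟩
  have hBs : ∀ m b, D.par m = some b → B b → B m := fun m b h1 h2 => ReflTransGen.head h1 h2
  let dp : Option D.N → Option {m // B m ∧ m ≠ n0} := fun t =>
    t.bind fun b => if h : B b ∧ b ≠ n0 then some ⟨b, h⟩ else none
  let ep : Option D.N → Option {m // ¬ B m} := fun t =>
    t.bind fun b => if h : ¬ B b then some ⟨b, h⟩ else none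
  have hdp : ∀ t m, dp t = some m → t = some m.1 := by
    rintro (_ | b) m h
    · simp [dp] at h
    · by_cases hb : B b ∧ b ≠ n0
      · simp only [dp, Option.bind_some, dif_pos hb, Option.some.injEq] at h
        rw [← h]
      · simp [dp, Option.bind_some, dif_neg hb] at h
  have hep : ∀ t m, ep t = some m → t = some m.1 := by
    rintro (_ | b) m h
    · simp [ep] at h
    · by_cases hb : ¬ B b
      · simp only [ep, Option.bind_some, dif_pos hb, Option.some.injEq] at h
        rw [← h]
      · simp only [ep, Option.bind_some] at h
        rw [dif_neg hb] at h
        cases h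
  have dp0 : dp (some n0) = none := by simp [dp]
  have dps : ∀ m : {m // B m ∧ m ≠ n0}, dp (some m.1) = some m := by
    rintro ⟨m, hm⟩
    simp only [dp, Option.bind_some, dif_pos hm]
  have eps : ∀ m : {m // ¬ B m}, ep (some m.1) = some m := by
    rintro ⟨m, hm⟩
    simp only [ep, Option.bind_some, dif_pos hm]
  let BB : Option D.N → Prop := fun t => ∃ b, t = some b ∧ B b
  let d : LD :=
    { N := {m // B m ∧ m ≠ n0}, C := {c // BB (D.pos c)}, fN := inferInstance, fC := inferInstance,
      par := fun m => dp (D.par m.1), rk := fun m => D.rk m.1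
      rk_lt := fun n m h => D.rk_lt n.1 m.1 (hdp _ _ h)
      pos := fun c => dp (D.pos c.1), typ := fun c => D.typ c.1 }
  let e : LD :=
    { N := {m // ¬ B m}, C := {c // ¬ BB (D.pos c)}, fN := inferInstance, fC := inferInstance,
      par := fun m => ep (D.par m.1), rk := fun m => D.rk m.1
      rk_lt := fun n m h => D.rk_lt n.1 m.1 (hep _ _ h)
      pos := fun c => ep (D.pos c.1), typ := fun c => D.typ c.1 }
  let κ : Option D.N → Option (childLD d e).N := fun t =>
    if BB t then some (Sum.inl (dp t)) else (ep t).map Sum.inr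
  have kp : ∀ t, BB t → κ t = some (Sum.inl (dp t)) := fun t h => if_pos h
  have kn : ∀ t, ¬ BB t → κ t = (ep t).map Sum.inr := fun t h => if_neg h
  have BB0 : ¬ BB none := by rintro ⟨b, h, -⟩; cases h
  have BBs : ∀ b, BB (some b) ↔ B b := fun b => ⟨by rintro ⟨c, h, h'⟩; cases h; exact h',
    fun h => ⟨b, rfl, h⟩⟩
  let ν : (childLD d e).N → D.N := Sum.elim (fun x => x.elim n0 (fun m => m.1)) (fun m => m.1)
  have hν : Function.Bijective ν := by
    constructor
    · rintro ((_ | ⟨a, ha⟩) | ⟨a, ha⟩) ((_ | ⟨b, hb⟩) | ⟨b, hb⟩) h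
      · rfl
      · exact absurd h.symm hb.2
      · have h : n0 = b := h
        exact absurd (h ▸ hB0) hb
      · exact absurd h ha.2
      · have h : a = b := h
        subst h; rfl
      · have h : a = b := h
        exact absurd (h ▸ ha.1) hb
      · have h : a = n0 := h
        exact absurd (h ▸ hB0) ha
      · have h : a = b := h
        exact absurd (h ▸ hb.1) ha
      · have h : a = b := h
        subst h; rfl
    · intro m
      by_cases hm : B m
      · by_cases h : m = n0
        · exact ⟨Sum.inl none, h.symm⟩
        · exact ⟨Sum.inl (some ⟨m, hm, h⟩), rfl⟩
      · exact ⟨Sum.inr ⟨m, hm⟩, rfl⟩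
  refine ⟨d, e, ⟨ν, κ, Sum.elim (fun c => c.1) (fun c => c.1), ?_, ?_, ?_, ?_, ⟨?_, ?_⟩, ?_, ?_⟩, hν⟩
  · rw [kn _ BB0]; rfl
  · rintro ((_ | m) | m)
    · show κ (some n0) = _
      rw [kp _ ((BBs _).2 hB0), dp0]
    · show κ (some m.1) = _
      rw [kp _ ((BBs _).2 m.2.1), dps]
    · show κ (some m.1) = _
      rw [kn _ (fun h => m.2 ((BBs _).1 h)), eps]; rfl
  · intro a h
    obtain ⟨m, hm⟩ := hν.2 a
    exact absurd hm (h m)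
  · rintro ((_ | m) | m)
    · show _ = κ (D.par n0)
      rw [h0, kn _ BB0]; rfl
    · show _ = κ (D.par m.1)
      obtain ⟨b, hb, hb'⟩ := hBn m.1 m.2.1 m.2.2
      rw [kp _ (by rw [hb]; exact (BBs _).2 hb')]
      rfl
    · show _ = κ (D.par m.1)
      rw [kn _ (by rintro ⟨b, hb, hb'⟩; exact m.2 (hBs _ _ hb hb'))]
      rfl
  · rintro (⟨a, ha⟩ | ⟨a, ha⟩) (⟨b, hb⟩ | ⟨b, hb⟩) h <;> have h : a = b := h <;> subst h
    · rfl
    · exact absurd ha hb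
    · exact absurd hb ha
    · rfl
  · intro c
    by_cases h : BB (D.pos c)
    · exact ⟨Sum.inl ⟨c, h⟩, rfl⟩
    · exact ⟨Sum.inr ⟨c, h⟩, rfl⟩
  · rintro (c | c)
    · show _ = κ (D.pos c.1)
      rw [kp _ c.2]; rfl
    · show _ = κ (D.pos c.1)
      rw [kn _ c.2]; rfl
  · rintro (c | c) <;> rfl

theorem root_child (D : LD) (h : Nonempty D.N) : ∃ n, D.par n = none := by
  obtain ⟨n, -, hn⟩ := Finset.exists_min_image Finset.univ D.rk ⟨h.some, Finset.mem_univ _⟩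
  refine ⟨n, ?_⟩
  cases hp : D.par n with
  | none => rfl
  | some m =>
    have h1 := D.rk_lt n m hp
    have h2 := hn m (Finset.mem_univ _)
    omega

theorem toF : ∀ n : ℕ, ∀ D : LD, Fintype.card D.N + Fintype.card D.C ≤ n →
    ∃ f : F, Nonempty (Mor D (DF f)) ∧ Fintype.card D.N = Fintype.card (DF f).N := by
  intro n
  induction n with
  | zero =>
    intro D hD
    have hN : IsEmpty D.N := Fintype.card_eq_zero_iff.1 (by omega)
    have hC : IsEmpty D.C := Fintype.card_eq_zero_iff.1 (by omega)
    refine ⟨F.nil, ⟨⟨fun m => m.elim, fun _ => none, fun m => m.elim, rfl, fun m => m.elim,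
      fun m => isEmptyElim m, fun m => m.elim, ⟨fun m => m.elim, fun m => isEmptyElim m⟩,
      fun m => m.elim, fun m => m.elim⟩⟩, ?_⟩
    show _ = Fintype.card Empty
    simp
  | succ n ih =>
    intro D hD
    by_cases h : Nonempty D.N
    · obtain ⟨n0, h0⟩ := root_child D h
      obtain ⟨d, e, M, hM⟩ := peel_child D n0 h0
      have h1 := Fintype.card_of_bijective hM
      have h2 := Fintype.card_of_bijective M.γ_bij
      simp only [Fintype.card_sum, Fintype.card_option] at h1 h2
      obtain ⟨f, ⟨Mf⟩, hf⟩ := ih d (by omega)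
      obtain ⟨f', ⟨Mf'⟩, hf'⟩ := ih e (by omega)
      refine ⟨F.child f f', ⟨M.trans (Mor.child Mf Mf')⟩, ?_⟩
      simp only [DF, Fintype.card_sum, Fintype.card_option]
      omega
    · have hN : IsEmpty D.N := not_nonempty_iff.1 h
      by_cases hC : Nonempty D.C
      · obtain ⟨c0⟩ := hC
        have hc : D.pos c0 = none := by
          cases hp : D.pos c0 with
          | none => rfl
          | some m => exact isEmptyElim m
        obtain ⟨D1, ⟨M⟩, h1⟩ := peel_rung D c0 hc
        have h2 := Fintype.card_of_bijective M.γ_bij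
        simp only [Fintype.card_option] at h2
        obtain ⟨f, ⟨Mf⟩, hf⟩ := ih D1 (by omega)
        exact ⟨F.rung (D.typ c0) f, ⟨M.trans (Mor.rung _ Mf)⟩, h1.trans hf⟩
      · have : IsEmpty D.C := not_nonempty_iff.1 hC
        refine ih D ?_
        simp

theorem max_form {X : WGraph} (hX : MaximalTrigonal X) (h : Good D) (i : WGIso (Cell h) X) :
    ∃ s t, WGIso (EC s t) X := by
  obtain ⟨n0, h0⟩ := root_child D h.ne
  obtain ⟨d, e, M, hM⟩ := peel_child D n0 h0
  obtain ⟨f, ⟨Mf⟩, hf⟩ := toF _ d le_rfl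
  obtain ⟨f', ⟨Mf'⟩, hf'⟩ := toF _ e le_rfl
  let M1 : Mor D (childLD (DF f) (DF f')) := M.trans (Mor.child Mf Mf')
  have hg : Good (childLD (DF f) (DF f')) := M1.good h ⟨Sum.inl none⟩
  have hc : Fintype.card D.N = Fintype.card (childLD (DF f) (DF f')).N := by
    rw [← Fintype.card_of_bijective hM]
    simp only [Fintype.card_sum, Fintype.card_option]
    omega
  obtain ⟨j⟩ := M1.iso hc
  have hQ := good_child.1 hg
  obtain ⟨s, ⟨Ms⟩⟩ := expand _ f le_rfl hQ.1
  obtain ⟨t, ⟨Mt⟩⟩ := expand _ f' le_rfl hQ.2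
  exact ⟨s, t, cell_up hX (Mor.child Ms Mt) _ hg (wg_trans (wg_symm (cell_iso j h hg)) i)⟩

end TG

open scoped Classical
namespace TG
open Relation CGraph
variable {G H K : CGraph} {D D' D'' d d' e e' : LD}

theorem fin3_conn : ∀ p q : Fin 3, p ≠ q → ∀ i j : Fin 3, i = j ∨
    ((i = p+1 ∧ j = p+2) ∨ (i = p+2 ∧ j = p+1)) ∨ ((i = q+1 ∧ j = q+2) ∨ (i = q+2 ∧ j = q+1)) ∨
    (∃ k, ((i = p+1 ∧ k = p+2) ∨ (i = p+2 ∧ k = p+1)) ∧ ((k = q+1 ∧ j = q+2) ∨ (k = q+2 ∧ j = q+1))) ∨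
    (∃ k, ((i = q+1 ∧ k = q+2) ∨ (i = q+2 ∧ k = q+1)) ∧
      ((k = p+1 ∧ j = p+2) ∨ (k = p+2 ∧ j = p+1))) := by decide

noncomputable abbrev mgc (D : LD) (l : D.N) (v : Option D.N × Fin 3) :
    {t : Option D.N // t ≠ some l} × Fin 3 ⊕ Unit :=
  if h : v.1 = some l then Sum.inr () else Sum.inl (⟨v.1, h⟩, v.2)

/-- the ladder with the fibre over `l` merged to a point -/
noncomputable abbrev Mg (D : LD) (l : D.N) : CGraph where
  V := {t : Option D.N // t ≠ some l} × Fin 3 ⊕ Unit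
  E := (D.N × Fin 3) ⊕ {c : D.C // D.pos c ≠ some l}
  fV := inferInstance
  fE := inferInstance
  dV := inferInstance
  dE := inferInstance
  src := Sum.elim (fun x => mgc D l (some x.1, x.2)) (fun c => mgc D l (D.pos c.1, D.typ c.1 + 1))
  tgt := Sum.elim (fun x => mgc D l (D.par x.1, x.2)) (fun c => mgc D l (D.pos c.1, D.typ c.1 + 2))

theorem mgc_l {l : D.N} {v} (h : v.1 = some l) : mgc D l v = Sum.inr () := dif_pos h
theorem mgc_n {l : D.N} {v} (h : v.1 ≠ some l) : mgc D l v = Sum.inl (⟨v.1, h⟩, v.2) := dif_neg h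

abbrev LD.wt (D : LD) (τ : D.C → Fin 3) : LD := { D with typ := τ }

theorem mg_ctr (l : D.N) (c1 c2 : D.C) (hc : ∀ c, D.pos c = some l ↔ c = c1 ∨ c = c2)
    (τ : D.C → Fin 3) (hτ : τ c1 ≠ τ c2) (hτ' : ∀ c, c ≠ c1 → c ≠ c2 → τ c = D.typ c) :
    ∃ π : Ctr (Lad (D.wt τ)) (Mg D l), π.c = mgc D l := by
  have hfe : ∀ x : (Lad (D.wt τ)).E, x ∉ Set.range (Sum.map id Subtype.val : (Mg D l).E → (Lad (D.wt τ)).E) ↔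
      ∃ c, x = Sum.inr c ∧ D.pos c = some l := by
    rintro (x | c)
    · refine ⟨fun h => absurd ⟨Sum.inl x, rfl⟩ h, ?_⟩
      rintro ⟨c, h, -⟩; cases h
    · constructor
      · intro h
        refine ⟨c, rfl, ?_⟩
        by_contra h'
        exact h ⟨Sum.inr ⟨c, h'⟩, rfl⟩
      · rintro ⟨c', h, h'⟩ ⟨y, hy⟩
        cases h
        rcases y with y | y
        · cases hy
        · have : y.1 = c := by injection hy
          exact y.2 (this ▸ h')
  have hne : c1 ≠ c2 := fun h => hτ (by rw [h])
  refine ⟨⟨mgc D l, Sum.map id Subtype.val, ?_, ?_, ?_, ?_, ?_, ?_⟩, rfl⟩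
  · rintro (⟨⟨t, ht⟩, i⟩ | ⟨⟩)
    · exact ⟨(t, i), mgc_n ht⟩
    · exact ⟨(some l, 0), mgc_l rfl⟩
  · exact Sum.map_injective.2 ⟨Function.injective_id, Subtype.val_injective⟩
  · rintro (x | c)
    · exact Or.inl ⟨rfl, rfl⟩
    · left
      have h1 : c.1 ≠ c1 := fun h => c.2 ((hc _).2 (Or.inl h))
      have h2 : c.1 ≠ c2 := fun h => c.2 ((hc _).2 (Or.inr h))
      have h3 := hτ' c.1 h1 h2
      simp only [Sum.elim_inr, Sum.map_inr, h3, and_self]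
  · rintro ⟨t, i⟩ ⟨s, j⟩ h
    by_cases ht : t = some l
    · by_cases hs : s = some l
      · subst ht hs
        have hm1 : (Sum.inr c1 : (Lad (D.wt τ)).E) ∉ Set.range (Sum.map id Subtype.val : (Mg D l).E → (Lad (D.wt τ)).E) :=
          (hfe _).2 ⟨c1, rfl, (hc _).2 (Or.inl rfl)⟩
        have hm2 : (Sum.inr c2 : (Lad (D.wt τ)).E) ∉ Set.range (Sum.map id Subtype.val : (Mg D l).E → (Lad (D.wt τ)).E) :=
          (hfe _).2 ⟨c2, rfl, (hc _).2 (Or.inr rfl)⟩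
        have p1 : D.pos c1 = some l := (hc _).2 (Or.inl rfl)
        have p2 : D.pos c2 = some l := (hc _).2 (Or.inr rfl)
        have hr : ∀ c, D.pos c = some l → (Sum.inr c : (Lad (D.wt τ)).E) ∉ Set.range (Sum.map id Subtype.val : (Mg D l).E → (Lad (D.wt τ)).E) →
            ∀ i j, ((i = τ c+1 ∧ j = τ c+2) ∨ (i = τ c+2 ∧ j = τ c+1)) →
            SReach (Lad (D.wt τ)) (Set.range (Sum.map id Subtype.val : (Mg D l).E → (Lad (D.wt τ)).E))ᶜ (some l, i) (some l, j) := by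
          rintro c hp hc i j (⟨rfl, rfl⟩ | ⟨rfl, rfl⟩)
          · exact ReflTransGen.single ⟨_, hc, Or.inl ⟨by simp [hp], by simp [hp]⟩⟩
          · exact ReflTransGen.single ⟨_, hc, Or.inr ⟨by simp [hp], by simp [hp]⟩⟩
        rcases fin3_conn (τ c1) (τ c2) hτ i j with h | h | h | ⟨k, h, h'⟩ | ⟨k, h, h'⟩
        · subst h; exact ReflTransGen.refl
        · exact hr c1 p1 hm1 _ _ h
        · exact hr c2 p2 hm2 _ _ h
        · exact (hr c1 p1 hm1 _ _ h).trans (hr c2 p2 hm2 _ _ h')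
        · exact (hr c2 p2 hm2 _ _ h).trans (hr c1 p1 hm1 _ _ h')
      · rw [mgc_l ht, mgc_n hs] at h; cases h
    · by_cases hs : s = some l
      · rw [mgc_n ht, mgc_l hs] at h; cases h
      · rw [mgc_n ht, mgc_n hs] at h
        cases h
        exact ReflTransGen.refl
  · intro x hx
    obtain ⟨c, rfl, h⟩ := (hfe x).1 hx
    rw [mgc_l h, mgc_l h]
  · have h1 : Fintype.card {c : D.C // D.pos c ≠ some l} + 2 = Fintype.card D.C := by
      have h2 : Fintype.card {c : D.C // D.pos c ≠ some l} = Fintype.card D.C - Fintype.card {c : D.C // D.pos c = some l} :=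
        Fintype.card_subtype_compl (fun c => D.pos c = some l)
      have h3 : Fintype.card {c : D.C // D.pos c = some l} = 2 := by
        rw [Fintype.card_subtype]
        have : (Finset.univ.filter fun c => D.pos c = some l) = {c1, c2} := by
          ext c; simp [hc]
        rw [this, Finset.card_pair hne]
      have h4 := Fintype.card_subtype_le (fun c => D.pos c = some l)
      omega
    have h2 : Fintype.card {t : Option D.N // t ≠ some l} = Fintype.card D.N := by
      simp
    simp only [Fintype.card_sum, Fintype.card_prod, h2, Fintype.card_option, Fintype.card_fin,
      Fintype.card_unit]
    omega

theorem mg_val_l (l : D.N) (h0 : ch D (some l) = 0) : valence (Mg D l) (Sum.inr ()) = 3 := by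
  have h1 : ∀ n, D.par n ≠ some l := by
    intro n hn
    have := Finset.card_eq_zero.1 h0
    have h2 : n ∈ (Finset.univ.filter fun m => D.par m = some l) := by simp [hn]
    rw [this] at h2
    simp at h2
  unfold valence
  rw [Fintype.sum_sum_type]
  have h3 : ∀ c : {c : D.C // D.pos c ≠ some l}, incid (Mg D l) (Sum.inr c) (Sum.inr ()) = 0 := by
    intro c
    have a1 : (Mg D l).src (Sum.inr c) ≠ Sum.inr () := by
      show mgc D l _ ≠ _
      rw [mgc_n c.2]; simp
    have a2 : (Mg D l).tgt (Sum.inr c) ≠ Sum.inr () := by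
      show mgc D l _ ≠ _
      rw [mgc_n c.2]; simp
    simp only [incid, if_neg a1, if_neg a2]
  have h4 : ∀ x : D.N × Fin 3, incid (Mg D l) (Sum.inl x) (Sum.inr ()) = if x.1 = l then 1 else 0 := by
    rintro ⟨n, i⟩
    have a2 : (Mg D l).tgt (Sum.inl (n, i)) ≠ Sum.inr () := by
      show mgc D l _ ≠ _
      rw [mgc_n (h1 n)]; simp
    by_cases hn : n = l
    · have a1 : (Mg D l).src (Sum.inl (n, i)) = Sum.inr () := mgc_l (by rw [hn])
      simp only [incid, if_pos a1, if_neg a2, if_pos hn]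
    · have a1 : (Mg D l).src (Sum.inl (n, i)) ≠ Sum.inr () := by
        show mgc D l _ ≠ _
        rw [mgc_n (by simpa using hn)]; simp
      simp only [incid, if_neg a1, if_neg a2, if_neg hn]
  rw [Finset.sum_congr rfl fun x _ => h4 x, Finset.sum_congr rfl fun x _ => h3 x]
  rw [Fintype.sum_prod_type]
  rw [Finset.sum_eq_single l]
  · simp
  · intro b _ hb
    simp [hb]
  · simp

theorem mg_val_n (l : D.N) (τ : D.C → Fin 3) (π : Ctr (Lad (D.wt τ)) (Mg D l)) (hπ : π.c = mgc D l) (v) :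
    ∃ u, valence (Mg D l) (Sum.inl v) = valence (Lad (D.wt τ)) u := by
  refine ⟨(v.1.1, v.2), ?_⟩
  have h := π.valence_eq (Sum.inl v)
  have : (Finset.univ.filter fun u : (Lad (D.wt τ)).V => π.c u = Sum.inl v) = {(v.1.1, v.2)} := by
    ext ⟨t, i⟩
    simp only [Finset.mem_filter, Finset.mem_univ, true_and, Finset.mem_singleton]
    rw [hπ]
    by_cases ht : t = some l
    · rw [mgc_l ht]
      simp only [reduceCtorEq, Prod.mk.injEq, false_iff, not_and]
      intro h; exact absurd (h.symm.trans ht) v.1.2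
    · rw [mgc_n ht]
      simp only [Sum.inl.injEq, Prod.ext_iff, Subtype.ext_iff]
  rw [this] at h
  simp at h
  omega

theorem leaf_change (l : D.N) (h0 : ch D (some l) = 0) (c1 c2 : D.C)
    (hc : ∀ c, D.pos c = some l ↔ c = c1 ∨ c = c2)
    (τ : D.C → Fin 3) (ht : D.typ c1 ≠ D.typ c2) (hτ : τ c1 ≠ τ c2)
    (hτ' : ∀ c, c ≠ c1 → c ≠ c2 → τ c = D.typ c) (h : Good D) (h' : Good (D.wt τ))
    (h3 : ∀ v, valence (Lad D) v ≤ 3) : WGIso (Cell h) (Cell h') := by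
  obtain ⟨π, hπ⟩ := mg_ctr l c1 c2 hc D.typ ht (fun _ _ _ => rfl)
  obtain ⟨π', hπ'⟩ := mg_ctr l c1 c2 hc τ hτ hτ'
  have hv : ∀ v, 2 ≤ valence (Mg D l) v ∧ valence (Mg D l) v ≤ 3 := by
    rintro (v | ⟨⟩)
    · obtain ⟨u, hu⟩ := mg_val_n l D.typ π hπ v
      rw [hu]
      exact ⟨h.val_two u, h3 u⟩
    · rw [mg_val_l l h0]; omega
  obtain ⟨K, q, hr, hs, -, -, hq⟩ := exists_stab _ (Mg D l) rfl (π.connected h.connected)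
    (fun v => (hv v).1) ⟨Sum.inr (), (mg_val_l l h0).ge⟩
  obtain ⟨ρ⟩ := Ctr.ofStab hr
  obtain ⟨σ⟩ := Ctr.stab (St_red h) (π.trans ρ) hs
  obtain ⟨σ'⟩ := Ctr.stab (St_red h') (π'.trans ρ) hs
  have hK : ∀ k, valence K k ≤ 3 := fun k => by rw [hq]; exact (hv _).2
  obtain ⟨i⟩ := σ.iso_of_cubic (St_stable h) hK
  obtain ⟨j⟩ := σ'.iso_of_cubic (St_stable h') hK
  exact ⟨i.trans' j.symm', fun _ => rfl⟩

end TG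

open scoped Classical
namespace TG
open Relation CGraph
variable {G H K : CGraph} {D D' D'' d d' e e' : LD}

def LC (D D' : LD) (t0 : Option D.N) : Prop := ∃ (τ : D.C → Fin 3) (c1 c2 : D.C), D' = D.wt τ ∧
  ch D t0 = 0 ∧ (∀ c, D.pos c = t0 ↔ c = c1 ∨ c = c2) ∧ D.typ c1 ≠ D.typ c2 ∧ τ c1 ≠ τ c2 ∧
  ∀ c, c ≠ c1 → c ≠ c2 → τ c = D.typ c

theorem LC.childL {t0} (h : LC d d' t0) : LC (childLD d e) (childLD d' e) (some (Sum.inl t0)) := by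
  obtain ⟨τ, c1, c2, rfl, h0, hc, h1, h2, h3⟩ := h
  refine ⟨Sum.elim τ e.typ, Sum.inl c1, Sum.inl c2, rfl, (ch_child_inl _).trans h0, ?_, h1, h2, ?_⟩
  · rintro (c | c)
    · simp [hc]
    · simp
  · rintro (c | c) a b
    · exact h3 c (fun h => a (by rw [h])) (fun h => b (by rw [h]))
    · rfl

theorem LC.childR {x} (h : LC e e' (some x)) :
    LC (childLD d e) (childLD d e') (some (Sum.inr x)) := by
  obtain ⟨τ, c1, c2, rfl, h0, hc, h1, h2, h3⟩ := h
  refine ⟨Sum.elim d.typ τ, Sum.inr c1, Sum.inr c2, rfl, (ch_child_inr _).trans h0, ?_, h1, h2, ?_⟩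
  · rintro (c | c)
    · simp
    · simp [hc]
  · rintro (c | c) a b
    · rfl
    · exact h3 c (fun h => a (by rw [h])) (fun h => b (by rw [h]))

theorem LC.rung {x} (p) (h : LC D D' (some x)) : LC (rungLD p D) (rungLD p D') (some x) := by
  obtain ⟨τ, c1, c2, rfl, h0, hc, h1, h2, h3⟩ := h
  refine ⟨fun c => c.elim p τ, some c1, some c2, rfl, h0, ?_, h1, h2, ?_⟩
  · rintro (_ | c)
    · simp
    · simp [hc]
  · rintro (_ | c) a b
    · rfl
    · exact h3 c (fun h => a (by rw [h])) (fun h => b (by rw [h]))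

def nn : Cub → ℕ
  | Cub.leaf _ _ _ => 0
  | Cub.rung _ t => nn t + 1
  | Cub.br s t => nn s + nn t + 2

theorem nn_card (s : Cub) : Fintype.card (DC s).N = nn s := by
  induction s with
  | leaf p q h => rfl
  | rung p t ih => simp only [nn, DC, Fintype.card_option, Fintype.card_sum] at ih ⊢; simp; omega
  | br s t ih ih' =>
    simp only [nn, DC, Fintype.card_option, Fintype.card_sum] at ih ih' ⊢; simp; omega

def Cm (s s' : Cub) : Prop := ∃ D0, Nonempty (Mor (DC s) D0) ∧ Nonempty (Mor (DC s') D0) ∧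
  nn s ≤ Fintype.card D0.N + 1 ∧ nn s = nn s'

def St1 (s s' : Cub) : Prop := Cm s s' ∨ ∃ t0, LC (DC s) (DC s') t0

theorem St1.rung (p) {s s'} (h : St1 s s') : St1 (Cub.rung p s) (Cub.rung p s') := by
  rcases h with ⟨D0, ⟨M⟩, ⟨M'⟩, h1, h2⟩ | ⟨t0, h⟩
  · refine Or.inl ⟨rungLD p (childLD D0 nilLD), ⟨Mor.rung p (Mor.child M (Mor.refl _))⟩,
      ⟨Mor.rung p (Mor.child M' (Mor.refl _))⟩, ?_, ?_⟩
    · simp only [nn, Fintype.card_option, Fintype.card_sum]; omega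
    · simp only [nn]; omega
  · exact Or.inr ⟨_, h.childL.rung p⟩

theorem St1.brl (t) {s s'} (h : St1 s s') : St1 (Cub.br s t) (Cub.br s' t) := by
  rcases h with ⟨D0, ⟨M⟩, ⟨M'⟩, h1, h2⟩ | ⟨t0, h⟩
  · refine Or.inl ⟨childLD D0 (childLD (DC t) nilLD), ⟨Mor.child M (Mor.refl _)⟩,
      ⟨Mor.child M' (Mor.refl _)⟩, ?_, ?_⟩
    · have := nn_card t
      simp only [nn, Fintype.card_option, Fintype.card_sum]; omega
    · simp only [nn]; omega
  · exact Or.inr ⟨_, h.childL⟩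

theorem St1.brr (t) {s s'} (h : St1 s s') : St1 (Cub.br t s) (Cub.br t s') := by
  rcases h with ⟨D0, ⟨M⟩, ⟨M'⟩, h1, h2⟩ | ⟨t0, h⟩
  · refine Or.inl ⟨childLD (DC t) (childLD D0 nilLD),
      ⟨Mor.child (Mor.refl _) (Mor.child M (Mor.refl _))⟩,
      ⟨Mor.child (Mor.refl _) (Mor.child M' (Mor.refl _))⟩, ?_, ?_⟩
    · have := nn_card t
      simp only [nn, Fintype.card_option, Fintype.card_sum]; omega
    · simp only [nn]; omega
  · exact Or.inr ⟨_, h.childL.childR⟩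

def Sm : Cub → Cub → Prop := ReflTransGen St1

theorem Sm.rung (p) {s s'} (h : Sm s s') : Sm (Cub.rung p s) (Cub.rung p s') :=
  ReflTransGen.lift (Cub.rung p) (fun _ _ h => St1.rung p h) _ _ h
theorem Sm.brl (t) {s s'} (h : Sm s s') : Sm (Cub.br s t) (Cub.br s' t) :=
  ReflTransGen.lift (fun s => Cub.br s t) (fun _ _ h => St1.brl t h) _ _ h
theorem Sm.brr (t) {s s'} (h : Sm s s') : Sm (Cub.br t s) (Cub.br t s') :=
  ReflTransGen.lift (Cub.br t) (fun _ _ h => St1.brr t h) _ _ h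
theorem Sm.of {s s'} (h : Cm s s') : Sm s s' := ReflTransGen.single (Or.inl h)
theorem Sm.tr {s s' s''} (h : Sm s s') (h' : Sm s' s'') : Sm s s'' := ReflTransGen.trans h h'
theorem Cm.symm {s s'} (h : Cm s s') : Cm s' s := by
  obtain ⟨D0, h1, h2, h3, h4⟩ := h
  exact ⟨D0, h2, h1, by omega, h4.symm⟩

theorem sm_leaf (p q h p' q' h') : Sm (Cub.leaf p q h) (Cub.leaf p' q' h') := by
  refine ReflTransGen.single (Or.inr ⟨none, fun c => c.elim p' (fun c => c.elim q' Empty.elim), none, some none, ?_,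
    ?_, ?_, h, h', ?_⟩)
  · rfl
  · exact ch_nil _
  · rintro (_ | _ | c)
    · simp
    · simp
    · exact c.elim
  · rintro (_ | _ | c) a b
    · exact absurd rfl a
    · exact absurd rfl b
    · exact c.elim

theorem cm_past (t s p) : Cm (Cub.br t (Cub.rung p s)) (Cub.rung p (Cub.br t s)) := by
  refine ⟨rungLD p (childLD (DC t) (childLD (DC s) nilLD)),
    ⟨(Mor.child (Mor.refl _) (Mor.flat _)).trans (Mor.cr p _ _)⟩, ⟨Mor.rung p (Mor.flat _)⟩, ?_, ?_⟩
  · have h1 := nn_card t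
    have h2 := nn_card s
    simp only [nn, Fintype.card_option, Fintype.card_sum]
    omega
  · simp only [nn]; omega

theorem cm_brleaf (t p q h) : Cm (Cub.br t (Cub.leaf p q h)) (Cub.rung p (Cub.rung q t)) := by
  refine ⟨rungLD p (rungLD q (childLD (DC t) nilLD)),
    ⟨(Mor.child (Mor.refl _) (Mor.flat _)).trans ((Mor.cr p _ _).trans (Mor.rung p (Mor.cr q _ _)))⟩,
    ⟨Mor.rung p (Mor.flat _)⟩, ?_, ?_⟩
  · have h1 := nn_card t
    simp only [nn, Fintype.card_option, Fintype.card_sum]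
    omega
  · simp only [nn]

theorem cm_leaf (p q r h h') : Cm (Cub.rung p (Cub.leaf q r h)) (Cub.rung q (Cub.leaf p r h')) := by
  refine ⟨rungLD p (rungLD q (rungLD r nilLD)), ⟨Mor.rung p (Mor.flat _)⟩,
    ⟨(Mor.rung q (Mor.flat _)).trans (Mor.rr q p _)⟩, ?_, ?_⟩
  · simp only [nn]; exact Nat.le_add_left _ _
  · simp only [nn]

theorem sm_two (t) (p q p' q' : Fin 3) (h : p ≠ q) (h' : p' ≠ q') :
    Sm (Cub.rung p (Cub.rung q t)) (Cub.rung p' (Cub.rung q' t)) :=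
  ((Sm.of (cm_brleaf t p q h).symm).tr ((sm_leaf p q h p' q' h').brr t)).tr
    (Sm.of (cm_brleaf t p' q' h'))

def chn : ℕ → Cub
  | 0 => Cub.leaf 0 1 (by decide)
  | k + 1 => Cub.rung 0 (chn k)

theorem fin3_third : ∀ p : Fin 3, p ≠ 0 → ∃ r : Fin 3, r ≠ 0 ∧ r ≠ p := by decide

theorem sm_rung (p : Fin 3) (k : ℕ) : Sm (Cub.rung p (chn k)) (chn (k+1)) := by
  induction k with
  | zero =>
    by_cases hp : p = 0
    · subst hp; exact ReflTransGen.refl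
    obtain ⟨r, hr, hr'⟩ := fin3_third p hp
    exact (((sm_leaf _ _ _ 0 r hr.symm).rung p).tr (Sm.of (cm_leaf p 0 r hr.symm hr'.symm))).tr
      ((sm_leaf _ _ _ _ _ _).rung 0)
  | succ k ih =>
    by_cases hp : p = 0
    · subst hp; exact ReflTransGen.refl
    exact (sm_two (chn k) p 0 0 p hp (Ne.symm hp)).tr (ih.rung 0)

theorem sm_br (j k : ℕ) : Sm (Cub.br (chn j) (chn k)) (chn (j + k + 2)) := by
  induction k with
  | zero =>
    exact (Sm.of (cm_brleaf (chn j) 0 1 (by decide))).tr ((sm_rung 1 j).rung 0)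
  | succ k ih =>
    exact (Sm.of (cm_past (chn j) (chn k) 0)).tr (ih.rung 0)

theorem sm_all (s : Cub) : Sm s (chn (nn s)) := by
  induction s with
  | leaf p q h => exact sm_leaf _ _ _ _ _ _
  | rung p t ih => exact (ih.rung p).tr (sm_rung p _)
  | br s t ih ih' => exact ((ih.brl t).tr (ih'.brr _)).tr (sm_br _ _)

theorem rel_left {s s'} (t : Cub) (h : St1 s s') : Rel (EC s t) (EC s' t) := by
  refine ⟨EC_max _ _, EC_max _ _, ?_⟩
  rcases h with ⟨D0, ⟨M⟩, ⟨M'⟩, h1, h2⟩ | ⟨t0, h⟩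
  · let N : Mor (E2 s t) (childLD D0 (DC t)) := Mor.child M (Mor.refl _)
    let N' : Mor (E2 s' t) (childLD D0 (DC t)) := Mor.child M' (Mor.refl _)
    have hg : Good (childLD D0 (DC t)) := N.good (E2_good s t) ⟨Sum.inl none⟩
    have a1 := nn_card s
    have a2 := nn_card s'
    have a3 : Fintype.card D0.N ≤ nn s := by
      rw [← a1]; exact Fintype.card_le_of_injective _ M.ν_inj
    by_cases hc : nn s = Fintype.card D0.N
    · right
      obtain ⟨i⟩ := N.iso (by simp only [Fintype.card_option, Fintype.card_sum]; omega)
      obtain ⟨j⟩ := N'.iso (by simp only [Fintype.card_option, Fintype.card_sum]; omega)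
      exact cell_iso (i.trans' j.symm') _ _
    · left
      refine ⟨Cell hg, N.single _ _ ?_, N'.single _ _ ?_⟩ <;>
        simp only [Fintype.card_option, Fintype.card_sum] <;> omega
  · right
    have h1 : LC (E2 s t) (E2 s' t) (some (Sum.inl t0)) := h.childL
    obtain ⟨τ, c1, c2, hD, h0, hc, h1, h2, h3⟩ := h1
    have key : ∀ D' (hD' : Good D'), D' = (E2 s t).wt τ → WGIso (EC s t) (Cell hD') := by
      rintro _ hD' rfl
      exact leaf_change _ h0 c1 c2 hc τ h1 h2 h3 _ _ (E2_cub s t)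
    exact key _ _ hD

theorem rtg_left {s s'} (t : Cub) (h : Sm s s') : ReflTransGen Rel (EC s t) (EC s' t) :=
  ReflTransGen.lift (fun s => EC s t) (fun _ _ h => rel_left t h) _ _ h

theorem rel_swap (s t : Cub) : Rel (EC s t) (EC t s) :=
  ⟨EC_max _ _, EC_max _ _, Or.inr (cell_iso (reroot _ _).some _ _)⟩

theorem rel_shift (p s t) : Rel (EC (Cub.rung p s) t) (EC s (Cub.rung p t)) := by
  refine ⟨EC_max _ _, EC_max _ _, Or.inr ?_⟩
  obtain ⟨i⟩ := reroot (DC (Cub.rung p s)) (DC t)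
  let M : Mor (childLD (DC t) (rungLD p (childLD (DC s) nilLD)))
      (childLD (DC s) (rungLD p (childLD (DC t) nilLD))) :=
    (Mor.cr p _ _).trans ((Mor.rung p (Mor.cc _ _ _)).trans (Mor.rc p _ _))
  obtain ⟨j⟩ := M.iso (by simp only [Fintype.card_option, Fintype.card_sum]; omega)
  exact cell_iso (i.trans' j) _ _

theorem rtg_chn (j k : ℕ) : ReflTransGen Rel (EC (chn j) (chn k)) (EC (chn 0) (chn (j + k))) := by
  induction j generalizing k with
  | zero => rw [Nat.zero_add]
  | succ j ih =>
    have := (ReflTransGen.single (rel_shift 0 (chn j) (chn k))).trans (ih (k+1))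
    rwa [show j + (k+1) = j + 1 + k by omega] at this

theorem rtg_canon (s t : Cub) : ReflTransGen Rel (EC s t) (EC (chn 0) (chn (nn s + nn t))) := by
  have := ((rtg_left t (sm_all s)).trans (ReflTransGen.single (rel_swap _ _))).trans
    ((rtg_left _ (sm_all t)).trans (rtg_chn _ _))
  rwa [Nat.add_comm] at this

theorem EC_genus (s t : Cub) : wgenus (EC s t).G (EC s t).w = nn s + nn t + 2 := by
  have h := St_card (E2_good s t)
  have h1 : Fintype.card (E2 s t).C = nn s + nn t + 4 := by
    have a := DC_card s
    have b := DC_card t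
    have a1 := nn_card s
    have a2 := nn_card t
    simp only [Fintype.card_sum]
    omega
  unfold wgenus
  show Fintype.card (St (E2_good s t)).E + 1 + (∑ v : (St (E2_good s t)).V, 0) -
    Fintype.card (St (E2_good s t)).V = _
  simp only [Finset.sum_const_zero]
  omega

theorem wgenus_iso {X Y : WGraph} (h : WGIso X Y) : wgenus X.G X.w = wgenus Y.G Y.w := by
  obtain ⟨i, hi⟩ := h
  unfold wgenus
  rw [Fintype.card_congr i.vEquiv, Fintype.card_congr i.eEquiv, ← Equiv.sum_comp i.vEquiv Y.w]
  simp only [hi]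

/-- The theorem, given that every maximal cell is a ladder cell. -/
theorem final_of (key : ∀ X : WGraph, MaximalTrigonal X → 3 ≤ wgenus X.G X.w →
      ∃ (D : LD) (h : Good D), WGIso (Cell h) X)
    (g : ℕ) (hg : 3 ≤ g) (X Y : WGraph)
    (hX : MaximalTrigonal X) (hY : MaximalTrigonal Y)
    (hgX : wgenus X.G X.w = g) (hgY : wgenus Y.G Y.w = g) : ReflTransGen Rel X Y := by
  have h1 : ∀ X : WGraph, MaximalTrigonal X → wgenus X.G X.w = g →
      ReflTransGen Rel X (EC (chn 0) (chn (g - 2))) := by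
    intro X hX hgX
    obtain ⟨D, h, i⟩ := key X hX (by omega)
    obtain ⟨s, t, j⟩ := max_form hX h i
    have h2 := rtg_canon s t
    have h3 := EC_genus s t
    rw [wgenus_iso j] at h3
    have h4 : nn s + nn t = g - 2 := by omega
    rw [h4] at h2
    exact ReflTransGen.head ⟨hX, EC_max _ _, Or.inr (wg_symm j)⟩ h2
  refine (h1 X hX hgX).trans ?_
  have := h1 Y hY hgY
  rw [← reflTransGen_swap] at this
  exact ReflTransGen.mono (fun a b h => rel_symm h) _ _ this

end TG

open scoped Classical
namespace TG
open Relation CGraph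
variable {G H K : CGraph} {D D' D'' d d' e e' : LD}

theorem cell_of_ctr (h : Good D) (T : TrigonalType) (hT : MaximalTrigonal ⟨T.G, T.w⟩)
    (π : Ctr (Lad D) H) (hS : ClassClosed (ladMor D) (Set.range π.fe)ᶜ)
    (hH : StabReduces0 H (withLoops T.G T.w)) : WGIso (Cell h) ⟨T.G, T.w⟩ := by
  refine hT.2 _ (cell_trig h) ⟨TT h, wg_refl _, (Set.range π.fe)ᶜ, hS, H, π.toCD, T,
    withLoops T.G T.w, wg_refl _, tt_stable T, ?_, T.stab⟩
  have := π.toCD_zero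
  exact this ▸ stab_iso (withLoopsZero _) hH

/-- rooted trees -/
structure RT : Type 1 where
  N : Type
  fN : Fintype N
  par : N → Option N
  rk : N → ℕ
  rk_lt : ∀ n m, par n = some m → rk m < rk n

attribute [instance] RT.fN

namespace RT
variable (R : RT)

/-- `t` is a descendant of `n` -/
def Desc (n : R.N) (t : Option R.N) : Prop :=
  ReflTransGen (fun s s' => ∃ m, s = some m ∧ R.par m = s') t (some n)

def inc (n : R.N) (t : Option R.N) : Prop := t = some n ∨ R.par n = t

variable {R}

theorem desc_none {n : R.N} : ¬ R.Desc n none := by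
  intro h
  rcases ReflTransGen.cases_head h with h | ⟨c, ⟨m, hm, -⟩, -⟩
  · cases h
  · cases hm

theorem desc_self {n : R.N} : R.Desc n (some n) := ReflTransGen.refl

theorem desc_some {n m : R.N} : R.Desc n (some m) ↔ m = n ∨ R.Desc n (R.par m) := by
  constructor
  · intro h
    rcases ReflTransGen.cases_head h with h | ⟨c, ⟨k, hk, rfl⟩, h2⟩
    · left; exact Option.some_injective _ h
    · right; cases hk; exact h2
  · rintro (rfl | h)
    · exact desc_self
    · exact ReflTransGen.head ⟨m, rfl, rfl⟩ h

theorem desc_trans {n m : R.N} {t} (h : R.Desc m t) (h' : R.Desc n (some m)) : R.Desc n t :=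
  ReflTransGen.trans h h'

theorem desc_rk {n m : R.N} (h : R.Desc n (some m)) : R.rk n ≤ R.rk m := by
  have : ∀ t, R.Desc n t → ∀ m, t = some m → R.rk n ≤ R.rk m := by
    intro t ht
    induction ht using ReflTransGen.head_induction_on with
    | refl => rintro m h; cases h; exact le_rfl
    | head h _ ih =>
      rintro m rfl
      obtain ⟨k, hk, rfl⟩ := h
      cases hk
      cases hp : R.par m with
      | none => rename_i h'; rw [hp] at h'; exact absurd h' desc_none
      | some k => have := ih k hp; have := R.rk_lt m k hp; omega
  exact this _ h _ rfl

theorem desc_antisymm {n m : R.N} (h : R.Desc n (some m)) (h' : R.Desc m (some n)) : n = m := by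
  rcases desc_some.1 h with h1 | h1
  · exact h1.symm
  · cases hp : R.par m with
    | none => rw [hp] at h1; exact absurd h1 desc_none
    | some k =>
      rw [hp] at h1
      have := desc_rk h1; have := desc_rk h'; have := R.rk_lt m k hp; omega

theorem desc_par {n : R.N} : ¬ R.Desc n (R.par n) := by
  intro h
  cases hp : R.par n with
  | none => rw [hp] at h; exact desc_none h
  | some k =>
    rw [hp] at h
    have := desc_rk h; have := R.rk_lt n k hp; omega

/-- comparability -/
theorem desc_comp {n m : R.N} {t} (h : R.Desc n t) (h' : R.Desc m t) :
    R.Desc n (some m) ∨ R.Desc m (some n) := by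
  induction h using ReflTransGen.head_induction_on with
  | refl => right; exact h'
  | head h h2 ih =>
    obtain ⟨k, rfl, rfl⟩ := h
    rcases desc_some.1 h' with rfl | h3
    · left; exact desc_some.2 (Or.inr h2)
    · exact ih h3

/-- the child towards a descendant -/
theorem desc_child {n m : R.N} (h : R.Desc n (some m)) (hne : n ≠ m) :
    ∃ k, R.par k = some n ∧ R.Desc k (some m) := by
  have : ∀ t, R.Desc n t → t ≠ some n → ∃ k, R.par k = some n ∧ R.Desc k t := by
    intro t ht
    induction ht using ReflTransGen.head_induction_on with
    | refl => intro h; exact absurd rfl h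
    | head h h2 ih =>
      intro _
      obtain ⟨k, rfl, rfl⟩ := h
      by_cases hp : R.par k = some n
      · exact ⟨k, hp, desc_self⟩
      · obtain ⟨j, hj, hj'⟩ := ih hp
        exact ⟨j, hj, desc_some.2 (Or.inr hj')⟩
  exact this _ h (fun h => hne (Option.some_injective _ h).symm)

theorem root_child (m : R.N) : ∃ k, R.par k = none ∧ R.Desc k (some m) := by
  have : ∀ r, ∀ m : R.N, R.rk m = r → ∃ k, R.par k = none ∧ R.Desc k (some m) := by
    intro r
    induction r using Nat.strong_induction_on with
    | _ r ih =>
      intro m hm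
      cases hp : R.par m with
      | none => exact ⟨m, hp, desc_self⟩
      | some j =>
        obtain ⟨k, hk, hk'⟩ := ih _ (hm ▸ R.rk_lt m j hp) j rfl
        exact ⟨k, hk, desc_some.2 (Or.inr (hp ▸ hk'))⟩
  exact this _ m rfl

/-- separation is witnessed at `t` -/
theorem sep_inc {m : R.N} {t a b : Option R.N} (h1 : ¬ (R.Desc m t ↔ R.Desc m a))
    (h2 : ¬ (R.Desc m t ↔ R.Desc m b)) :
    ∃ n, R.inc n t ∧ ¬ (R.Desc n t ↔ R.Desc n a) ∧ ¬ (R.Desc n t ↔ R.Desc n b) := by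
  by_cases ht : R.Desc m t
  · have ha : ¬ R.Desc m a := by tauto
    have hb : ¬ R.Desc m b := by tauto
    cases t with
    | none => exact absurd ht desc_none
    | some k =>
      refine ⟨k, Or.inl rfl, ?_, ?_⟩
      · intro h; exact ha (desc_trans (h.1 desc_self) ht)
      · intro h; exact hb (desc_trans (h.1 desc_self) ht)
  · have ha : R.Desc m a := by tauto
    have hb : R.Desc m b := by tauto
    by_cases hc : ∃ k, R.par k = t ∧ R.Desc k (some m)
    · obtain ⟨k, rfl, hk⟩ := hc
      refine ⟨k, Or.inr rfl, ?_, ?_⟩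
      · intro h; exact desc_par (h.2 (desc_trans ha hk))
      · intro h; exact desc_par (h.2 (desc_trans hb hk))
    · cases t with
      | none => exact absurd (root_child m) hc
      | some k =>
        have hkm : ¬ R.Desc k (some m) := by
          intro h
          by_cases hne : k = m
          · subst hne; exact ht desc_self
          · exact hc (desc_child h hne)
        refine ⟨k, Or.inl rfl, ?_, ?_⟩
        · intro h
          rcases desc_comp ha (h.1 desc_self) with h3 | h3
          · exact ht h3
          · exact hkm h3
        · intro h
          rcases desc_comp hb (h.1 desc_self) with h3 | h3
          · exact ht h3
          · exact hkm h3

/-- only the edge `n` itself crosses `n` -/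
theorem desc_edge {n m : R.N} : ¬ (R.Desc n (some m) ↔ R.Desc n (R.par m)) ↔ n = m := by
  constructor
  · intro h
    rw [desc_some] at h
    by_contra hne
    exact h ⟨fun h => h.resolve_left (Ne.symm hne), Or.inr⟩
  · rintro rfl h
    exact desc_par (h.1 desc_self)

end RT
end TG

open scoped Classical
namespace TG
open Relation CGraph
variable {G H K : CGraph} {D D' D'' d d' e e' : LD}

/-- crossing incidence -/
noncomputable def cc (G : CGraph) (U : G.V → Prop) (v : G.V) : ℕ :=
  ∑ e : G.E, if e ∈ cut G U then incid G e v else 0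

theorem cut_card (U : G.V → Prop) : (cut G U).card = ∑ e : G.E, if e ∈ cut G U then 1 else 0 := by
  simp

theorem same_cut {j : H.V → G.V} {e : H.E} {e' : G.E} (h : sameEndsMapC H G j e e')
    (U : G.V → Prop) : e ∈ cut H (fun v => U (j v)) ↔ e' ∈ cut G U := by
  rw [mem_cut, mem_cut]
  rcases h with ⟨a, b⟩ | ⟨a, b⟩ <;> rw [a, b]
  rw [iff_comm (a := U _)]

theorem same_incid {j : H.V → G.V} (hj : Function.Injective j) {e : H.E} {e' : G.E}
    (h : sameEndsMapC H G j e e') (v : H.V) : incid H e v = incid G e' (j v) := by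
  unfold incid
  rcases h with ⟨a, b⟩ | ⟨a, b⟩ <;> rw [← a, ← b] <;> simp only [hj.eq_iff]
  rw [add_comm]

structure W {𝒱 N : Type} (side inc : N → 𝒱 → Prop) (G : CGraph) (f : G.V → 𝒱) : Prop where
  le3 : ∀ n, (cut G fun v => side n (f v)).card ≤ 3
  pos : ∀ n v, (cut G fun v => side n (f v)).card = 3 → inc n (f v) →
    1 ≤ cc G (fun v => side n (f v)) v
  eq : ∀ n n' v, (cut G fun v => side n (f v)).card = 3 → (cut G fun v => side n' (f v)).card = 3 →
    inc n (f v) → inc n' (f v) →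
    cc G (fun v => side n (f v)) v = cc G (fun v => side n' (f v)) v
  pass : ∀ n n' t e, (cut G fun v => side n (f v)).card = 3 →
    (cut G fun v => side n' (f v)).card = 3 → inc n t → inc n' t →
    f (G.src e) ≠ t → f (G.tgt e) ≠ t → e ∈ cut G (fun v => side n (f v)) →
    e ∈ cut G (fun v => side n' (f v))
  fib : ∀ t, (Finset.univ.filter fun v => f v = t).card ≤ 3

variable {𝒱 N : Type} {side inc : N → 𝒱 → Prop}

theorem W.iso {f : G.V → 𝒱} (h : W side inc G f) (i : CIso H G) :
    W side inc H (fun v => f (i.vEquiv v)) := by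
  have hc : ∀ n, (cut H fun v => side n (f (i.vEquiv v))).card = (cut G fun v => side n (f v)).card := by
    intro n
    exact cut_iso i (fun v => side n (f v))
  have hcc : ∀ n v, cc H (fun v => side n (f (i.vEquiv v))) v =
      cc G (fun v => side n (f v)) (i.vEquiv v) := by
    intro n v
    unfold cc
    refine Fintype.sum_equiv i.eEquiv _ _ fun e => ?_
    rw [same_incid i.vEquiv.injective (i.ends e) v]
    have := same_cut (i.ends e) (fun v => side n (f v))
    simp only [this]
  refine ⟨fun n => ?_, fun n v a b => ?_, fun n n' v a b c d => ?_, fun n n' t e a b c d x y z => ?_,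
    fun t => ?_⟩
  · rw [hc]; exact h.le3 n
  · rw [hcc]; rw [hc] at a; exact h.pos n _ a b
  · rw [hcc, hcc]; rw [hc] at a b; exact h.eq n n' _ a b c d
  · rw [hc] at a b
    have h1 := same_cut (i.ends e) (fun v => side n (f v))
    have h2 := same_cut (i.ends e) (fun v => side n' (f v))
    refine h2.2 (h.pass n n' t _ a b c d ?_ ?_ (h1.1 z))
    · rcases i.ends e with ⟨p, q⟩ | ⟨p, q⟩
      · rw [← p]; exact x
      · rw [← q]; exact y
    · rcases i.ends e with ⟨p, q⟩ | ⟨p, q⟩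
      · rw [← q]; exact y
      · rw [← p]; exact x
  · refine le_trans (le_of_eq ?_) (h.fib t)
    refine Finset.card_bij (fun v _ => i.vEquiv v) ?_ ?_ ?_
    · intro a ha; simpa using ha
    · intro a _ b _ hab; exact i.vEquiv.injective hab
    · intro b hb; exact ⟨i.vEquiv.symm b, by simpa using hb, by simp⟩

theorem fib_le {f : G.V → 𝒱} (h : ∀ t, (Finset.univ.filter fun v => f v = t).card ≤ 3)
    (j : H.V → G.V) (hj : Function.Injective j) (t : 𝒱) :
    (Finset.univ.filter fun v => f (j v) = t).card ≤ 3 := by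
  refine le_trans ?_ (h t)
  refine Finset.card_le_card_of_injOn j ?_ hj.injOn
  intro v hv; simpa using hv

theorem W.leaf (h' : LeafStep0 G H) :
    ∃ j : H.V → G.V, ∀ (𝒱 N : Type) (side inc : N → 𝒱 → Prop) (f : G.V → 𝒱),
      W side inc G f → W side inc H (fun v => f (j v)) := by
  obtain ⟨v₀, e₀, hv, hi, fv, fe, he⟩ := h'
  refine ⟨fun v => (fv v).1, fun 𝒱 N side inc f h => ?_⟩
  have hj : Function.Injective fun v => (fv v).1 := fun a b hab => fv.injective (Subtype.ext hab)
  have hcut : ∀ U : G.V → Prop, (cut G U).card = (if e₀ ∈ cut G U then 1 else 0) +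
      (cut H fun v => U (fv v).1).card := by
    intro U
    rw [cut_card, cut_card, Fintype.sum_eq_add_sum_subtype_ne _ e₀]
    congr 1
    refine (Fintype.sum_equiv fe _ _ fun e => ?_).symm
    have := same_cut (he e) U
    simp only [this]
  have hcc : ∀ U : G.V → Prop, e₀ ∉ cut G U → ∀ v, cc H (fun v => U (fv v).1) v = cc G U (fv v).1 := by
    intro U h0 v
    unfold cc
    rw [Fintype.sum_eq_add_sum_subtype_ne _ e₀, if_neg h0, zero_add]
    refine (Fintype.sum_equiv fe _ _ fun e => ?_)
    have := same_cut (he e) U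
    simp only [this]
    rw [same_incid hj (he e) v]
  have full : ∀ n, (cut H fun v => side n (f (fv v).1)).card = 3 →
      (cut G fun v => side n (f v)).card = 3 ∧ e₀ ∉ cut G fun v => side n (f v) := by
    intro n hn
    have h1 := hcut (fun v => side n (f v))
    have h2 := h.le3 n
    by_cases hx : e₀ ∈ cut G fun v => side n (f v)
    · rw [if_pos hx] at h1; omega
    · rw [if_neg hx] at h1; exact ⟨by omega, hx⟩
  refine ⟨fun n => ?_, fun n v a b => ?_, fun n n' v a b c d => ?_, fun n n' t e a b c d x y z => ?_,
    fib_le h.fib _ hj⟩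
  · have h1 := hcut (fun v => side n (f v))
    have h2 := h.le3 n
    change (cut H fun v => side n (f (fv v).1)).card ≤ 3
    omega
  · obtain ⟨a, a'⟩ := full n a
    have := hcc _ a' v
    rw [this]
    exact h.pos n _ a b
  · obtain ⟨a, a'⟩ := full n a
    obtain ⟨b, b'⟩ := full n' b
    have e1 := hcc _ a' v
    have e2 := hcc _ b' v
    rw [e1, e2]
    exact h.eq n n' _ a b c d
  · obtain ⟨a, a'⟩ := full n a
    obtain ⟨b, b'⟩ := full n' b
    have h1 := same_cut (he e) (fun v => side n (f v))
    have h2 := same_cut (he e) (fun v => side n' (f v))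
    refine h2.2 (h.pass n n' t _ a b c d ?_ ?_ (h1.1 z))
    · rcases he e with ⟨p, q⟩ | ⟨p, q⟩
      · rw [← p]; exact x
      · rw [← q]; exact y
    · rcases he e with ⟨p, q⟩ | ⟨p, q⟩
      · rw [← q]; exact y
      · rw [← p]; exact x

theorem sum_two {α : Type*} [Fintype α] (e₁ e₂ : α) [Fintype {e // e ≠ e₁ ∧ e ≠ e₂}]
    (h : e₁ ≠ e₂) (F : α → ℕ) :
    ∑ e, F e = F e₁ + F e₂ + ∑ e : {e // e ≠ e₁ ∧ e ≠ e₂}, F e := by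
  rw [Fintype.sum_eq_add_sum_subtype_ne _ e₁, add_assoc]
  congr 1
  rw [Fintype.sum_eq_add_sum_subtype_ne _ (⟨e₂, h.symm⟩ : {e // e ≠ e₁})]
  congr 1
  refine Fintype.sum_equiv ⟨fun x => ⟨x.1.1, x.1.2, fun h => x.2 (Subtype.ext h)⟩,
    fun x => ⟨⟨x.1, x.2.1⟩, fun h => x.2.2 (congrArg Subtype.val h)⟩, fun _ => rfl, fun _ => rfl⟩ _ _ ?_
  intro x; rfl

theorem pair_incid {e : G.E} {a b : G.V} (_hab : a ≠ b)
    (h : (G.src e = a ∧ G.tgt e = b) ∨ (G.src e = b ∧ G.tgt e = a)) (v : G.V) :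
    incid G e v = (if a = v then 1 else 0) + (if b = v then 1 else 0) := by
  unfold incid
  rcases h with ⟨p, q⟩ | ⟨p, q⟩ <;> rw [p, q]
  rw [add_comm]

theorem pair_cut {e : G.E} {a b : G.V}
    (h : (G.src e = a ∧ G.tgt e = b) ∨ (G.src e = b ∧ G.tgt e = a)) (U : G.V → Prop) :
    e ∈ cut G U ↔ ¬ (U a ↔ U b) := by
  rw [mem_cut]
  rcases h with ⟨p, q⟩ | ⟨p, q⟩ <;> rw [p, q]
  rw [iff_comm (a := U _)]

set_option maxHeartbeats 1000000 in
theorem W.series (h' : SeriesStep0 G H) :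
    ∃ j : H.V → G.V, ∀ (𝒱 N : Type) (side inc : N → 𝒱 → Prop) (f : G.V → 𝒱),
      W side inc G f → W side inc H (fun v => f (j v)) := by
  obtain ⟨v₀, e₁, e₂, u₁, u₂, h12, hv, hu₁, hu₂, h1, h2, fv, ebar, fe, hb, he⟩ := h'
  rw [Set.pair_eq_pair_iff] at h1 h2 hb
  refine ⟨fun v => (fv v).1, fun 𝒱 N side inc f h => ?_⟩
  have hj : Function.Injective fun v => (fv v).1 := fun a b hab => fv.injective (Subtype.ext hab)
  have c1 := pair_cut h1
  have c2 := pair_cut h2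
  have i1 := pair_incid hu₁.symm h1
  have i2 := pair_incid hu₂.symm h2
  have cb : ∀ U : G.V → Prop, ebar ∈ cut H (fun v => U (fv v).1) ↔ ¬ (U u₁ ↔ U u₂) := by
    intro U
    rw [mem_cut]
    rcases hb with ⟨p, q⟩ | ⟨p, q⟩ <;> rw [p, q]
    rw [iff_comm (a := U _)]
  have xb : ∀ U : G.V → Prop, ebar ∈ cut H (fun v => U (fv v).1) ↔
      ¬ (e₁ ∈ cut G U ↔ e₂ ∈ cut G U) := by
    intro U
    rw [cb, c1, c2]
    by_cases a : U u₁ <;> by_cases b : U u₂ <;> by_cases c : U v₀ <;> simp [a, b, c]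
  have ib : ∀ v, incid H ebar v = (if u₁ = (fv v).1 then 1 else 0) + (if u₂ = (fv v).1 then 1 else 0) := by
    intro v
    unfold incid
    rcases hb with ⟨p, q⟩ | ⟨p, q⟩ <;> rw [← p, ← q] <;> simp only [hj.eq_iff, Subtype.val_inj, fv.injective.eq_iff]
    rw [add_comm]
  have hcut : ∀ U : G.V → Prop, (cut G U).card + (if ebar ∈ cut H (fun v => U (fv v).1) then 1 else 0) =
      (if e₁ ∈ cut G U then 1 else 0) + (if e₂ ∈ cut G U then 1 else 0) +
      (cut H fun v => U (fv v).1).card := by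
    intro U
    rw [cut_card, cut_card, sum_two e₁ e₂ h12, Fintype.sum_eq_add_sum_subtype_ne (α := H.E) _ ebar]
    have := (Fintype.sum_equiv fe (fun e => if e.1 ∈ cut H (fun v => U (fv v).1) then 1 else 0)
      (fun e => if e.1 ∈ cut G U then 1 else 0) fun e => ?_)
    · rw [this]; ring
    · have := same_cut (he e) U
      simp only [this]
  have hcc : ∀ U : G.V → Prop, ¬ (e₁ ∈ cut G U ∧ e₂ ∈ cut G U) → ∀ v,
      cc H (fun v => U (fv v).1) v = cc G U (fv v).1 +
        ((if e₁ ∈ cut G U ∧ u₂ = (fv v).1 then 1 else 0) +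
         (if e₂ ∈ cut G U ∧ u₁ = (fv v).1 then 1 else 0)) := by
    intro U h0 v
    unfold cc
    rw [sum_two e₁ e₂ h12, Fintype.sum_eq_add_sum_subtype_ne (α := H.E) _ ebar]
    have := (Fintype.sum_equiv fe (fun e => if e.1 ∈ cut H (fun v => U (fv v).1) then incid H e.1 v else 0)
      (fun e => if e.1 ∈ cut G U then incid G e.1 (fv v).1 else 0) fun e => ?_)
    · rw [this, ib, i1, i2, if_neg (fv v).2.symm]
      have a1 : ebar ∈ cut H (fun v => U (fv v).1) ↔ (e₁ ∈ cut G U ∨ e₂ ∈ cut G U) := by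
        rw [xb]
        by_cases p : e₁ ∈ cut G U <;> by_cases q : e₂ ∈ cut G U
        · exact absurd ⟨p, q⟩ h0
        all_goals simp [p, q]
      by_cases p : e₁ ∈ cut G U
      · have q : e₂ ∉ cut G U := fun q => h0 ⟨p, q⟩
        rw [if_pos (a1.2 (Or.inl p))]
        simp only [p, q, if_true, if_false, true_and, false_and]
        omega
      · by_cases q : e₂ ∈ cut G U
        · rw [if_pos (a1.2 (Or.inr q))]
          simp only [p, q, if_true, if_false, true_and, false_and]
          omega
        · rw [if_neg (fun x => (a1.1 x).elim p q)]
          simp only [p, q, if_false, false_and]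
          omega
    · have := same_cut (he e) U
      simp only [this]
      rw [same_incid hj (he e) v]
  have full : ∀ n, (cut H fun v => side n (f (fv v).1)).card = 3 →
      (cut G fun v => side n (f v)).card = 3 ∧
      ¬ (e₁ ∈ cut G (fun v => side n (f v)) ∧ e₂ ∈ cut G (fun v => side n (f v))) ∧
      (ebar ∈ cut H (fun v => side n (f (fv v).1)) ↔
        (e₁ ∈ cut G (fun v => side n (f v)) ∨ e₂ ∈ cut G (fun v => side n (f v)))) := by
    intro n hn
    have h1 := hcut (fun v => side n (f v))
    have h2 := h.le3 n
    have b := xb (fun v => side n (f v))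
    by_cases p : e₁ ∈ cut G fun v => side n (f v) <;> by_cases q : e₂ ∈ cut G fun v => side n (f v)
    · rw [if_pos p, if_pos q, if_neg (fun x => b.1 x (iff_of_true p q))] at h1; omega
    · have c := b.2 (fun x => q (x.1 p))
      rw [if_pos p, if_neg q, if_pos c] at h1
      exact ⟨by omega, fun x => q x.2, ⟨fun _ => Or.inl p, fun _ => c⟩⟩
    · have c := b.2 (fun x => p (x.2 q))
      rw [if_neg p, if_pos q, if_pos c] at h1
      exact ⟨by omega, fun x => p x.1, ⟨fun _ => Or.inr q, fun _ => c⟩⟩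
    · have c := fun x => b.1 x (iff_of_false p q)
      rw [if_neg p, if_neg q, if_neg c] at h1
      exact ⟨by omega, fun x => p x.1, ⟨fun x => absurd x c, fun x => (x.elim p q).elim⟩⟩
  have at0 : ∀ n, (cut G fun v => side n (f v)).card = 3 → inc n (f v₀) →
      e₁ ∈ cut G (fun v => side n (f v)) ∨ e₂ ∈ cut G (fun v => side n (f v)) := by
    intro n hn hi
    have h1 := h.pos n v₀ hn hi
    by_contra hcon
    push Not at hcon
    have h2 : cc G (fun v => side n (f v)) v₀ = 0 := by
      unfold cc
      rw [sum_two e₁ e₂ h12, if_neg hcon.1, if_neg hcon.2]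
      have hs := hv
      unfold valence at hs
      rw [sum_two e₁ e₂ h12, i1, i2, if_pos rfl] at hs
      have : ∑ e : {e : G.E // e ≠ e₁ ∧ e ≠ e₂}, incid G e.1 v₀ = 0 := by omega
      rw [Finset.sum_eq_zero_iff] at this
      rw [zero_add, zero_add]
      refine Finset.sum_eq_zero fun e he => ?_
      rw [this e he]; simp
    omega
  have key1 : ∀ n n', (cut H fun v => side n (f (fv v).1)).card = 3 →
      (cut H fun v => side n' (f (fv v).1)).card = 3 → inc n (f u₂) → inc n' (f u₂) →
      e₁ ∈ cut G (fun v => side n (f v)) → e₁ ∈ cut G (fun v => side n' (f v)) := by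
    intro n n' hn hn' hi hi' hx
    obtain ⟨a, a', -⟩ := full n hn
    obtain ⟨b, b', -⟩ := full n' hn'
    by_cases p : f v₀ = f u₂
    · have := at0 n' b (p ▸ hi')
      rcases this with h | h
      · exact h
      · exact absurd h (by rw [c2, p]; simp)
    · by_cases q : f u₁ = f u₂
      · exfalso
        rw [c1, q] at hx
        exact a' ⟨(c1 _).2 (by rw [q]; exact hx), (c2 _).2 hx⟩
      · refine h.pass n n' (f u₂) e₁ a b hi hi' ?_ ?_ hx <;>
          rcases h1 with ⟨h1, h1'⟩ | ⟨h1, h1'⟩ <;> simp only [h1, h1'] <;> assumption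
  have key2 : ∀ n n', (cut H fun v => side n (f (fv v).1)).card = 3 →
      (cut H fun v => side n' (f (fv v).1)).card = 3 → inc n (f u₁) → inc n' (f u₁) →
      e₂ ∈ cut G (fun v => side n (f v)) → e₂ ∈ cut G (fun v => side n' (f v)) := by
    intro n n' hn hn' hi hi' hx
    obtain ⟨a, a', -⟩ := full n hn
    obtain ⟨b, b', -⟩ := full n' hn'
    by_cases p : f v₀ = f u₁
    · have := at0 n' b (p ▸ hi')
      rcases this with h | h
      · exact absurd h (by rw [c1, p]; simp)
      · exact h
    · by_cases q : f u₂ = f u₁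
      · exfalso
        rw [c2, q] at hx
        exact a' ⟨(c1 _).2 hx, (c2 _).2 (by rw [q]; exact hx)⟩
      · refine h.pass n n' (f u₁) e₂ a b hi hi' ?_ ?_ hx <;>
          rcases h2 with ⟨h1, h1'⟩ | ⟨h1, h1'⟩ <;> simp only [h1, h1'] <;> assumption
  refine ⟨fun n => ?_, fun n v a b => ?_, fun n n' v a b c d => ?_, fun n n' t e a b c d x y z => ?_,
    fib_le h.fib _ hj⟩
  · have h1 := hcut (fun v => side n (f v))
    have h2 := h.le3 n
    have b := xb (fun v => side n (f v))
    change (cut H fun v => side n (f (fv v).1)).card ≤ 3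
    by_cases p : ebar ∈ cut H (fun v => side n (f (fv v).1))
    · rw [if_pos p] at h1
      by_cases q : e₁ ∈ cut G fun v => side n (f v)
      · rw [if_pos q] at h1; omega
      · have : e₂ ∈ cut G fun v => side n (f v) := by
          by_contra q'
          exact b.1 p (iff_of_false q q')
        rw [if_pos this] at h1; omega
    · rw [if_neg p] at h1; omega
  · obtain ⟨a, a', -⟩ := full n a
    have e1 := hcc _ a' v
    rw [e1]
    have : 1 ≤ cc G (fun v => side n (f v)) (fv v).1 := h.pos n _ a b
    omega
  · have k1 := key1 n n' a b
    have k1' := key1 n' n b a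
    have k2 := key2 n n' a b
    have k2' := key2 n' n b a
    obtain ⟨a, a', -⟩ := full n a
    obtain ⟨b, b', -⟩ := full n' b
    have e1 := hcc _ a' v
    have e2 := hcc _ b' v
    rw [e1, e2, h.eq n n' _ a b c d]
    congr 1
    have p1 : (e₁ ∈ cut G (fun v => side n (f v)) ∧ u₂ = (fv v).1) ↔
        (e₁ ∈ cut G (fun v => side n' (f v)) ∧ u₂ = (fv v).1) := by
      refine and_congr_left fun hx => ?_
      rw [hx] at k1 k1'
      exact ⟨k1 c d, k1' d c⟩
    have p2 : (e₂ ∈ cut G (fun v => side n (f v)) ∧ u₁ = (fv v).1) ↔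
        (e₂ ∈ cut G (fun v => side n' (f v)) ∧ u₁ = (fv v).1) := by
      refine and_congr_left fun hx => ?_
      rw [hx] at k2 k2'
      exact ⟨k2 c d, k2' d c⟩
    simp only [p1, p2]
  · obtain ⟨a, a', a''⟩ := full n a
    obtain ⟨b, b', b''⟩ := full n' b
    by_cases hbar : e = ebar
    · subst hbar
      change f (fv (H.src e)).1 ≠ t at x
      change f (fv (H.tgt e)).1 ≠ t at y
      have x1 : f u₁ ≠ t ∧ f u₂ ≠ t := by
        rcases hb with ⟨p, q⟩ | ⟨p, q⟩ <;> rw [p] at x <;> rw [q] at y <;> exact ⟨by assumption, by assumption⟩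
      refine b''.2 ?_
      by_cases p : f v₀ = t
      · exact at0 n' b (p ▸ d)
      · rcases a''.1 z with z | z
        · left
          refine h.pass n n' t e₁ a b c d ?_ ?_ z <;>
          rcases h1 with ⟨h1, h1'⟩ | ⟨h1, h1'⟩ <;> simp only [h1, h1'] <;> tauto
        · right
          refine h.pass n n' t e₂ a b c d ?_ ?_ z <;>
          rcases h2 with ⟨h1, h1'⟩ | ⟨h1, h1'⟩ <;> simp only [h1, h1'] <;> tauto
    · have he := he ⟨e, hbar⟩
      have h1 := same_cut he (fun v => side n (f v))
      have h2 := same_cut he (fun v => side n' (f v))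
      refine h2.2 (h.pass n n' t _ a b c d ?_ ?_ (h1.1 z))
      · rcases he with ⟨p, q⟩ | ⟨p, q⟩
        · rw [← p]; exact x
        · rw [← q]; exact y
      · rcases he with ⟨p, q⟩ | ⟨p, q⟩
        · rw [← q]; exact y
        · rw [← p]; exact x

theorem W.stab (h : StabReduces0 G H) :
    ∃ j : H.V → G.V, ∀ (𝒱 N : Type) (side inc : N → 𝒱 → Prop) (f : G.V → 𝒱),
      W side inc G f → W side inc H (fun v => f (j v)) := by
  induction h with
  | refl => exact ⟨id, fun _ _ _ _ _ h => h⟩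
  | tail _ h ih =>
    obtain ⟨j, hj⟩ := ih
    rcases h with h | h | ⟨⟨i⟩⟩
    · obtain ⟨j', hj'⟩ := W.leaf h
      exact ⟨fun v => j (j' v), fun _ _ _ _ _ h => hj' _ _ _ _ _ (hj _ _ _ _ _ h)⟩
    · obtain ⟨j', hj'⟩ := W.series h
      exact ⟨fun v => j (j' v), fun _ _ _ _ _ h => hj' _ _ _ _ _ (hj _ _ _ _ _ h)⟩
    · exact ⟨fun v => j (i.symm'.vEquiv v), fun _ _ _ _ _ h => (hj _ _ _ _ _ h).iso i.symm'⟩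
end TG

open scoped Classical
namespace TG
open Relation CGraph
variable {G H K : CGraph} {D D' D'' d d' e e' : LD}

theorem RT.par_ne {R : RT} (n : R.N) : R.par n ≠ some n := by
  intro h
  have := R.rk_lt n n h
  omega

theorem tree_rt (T : CGraph) (hT : IsTree T) (r : T.V) :
    ∃ (R : RT) (ι : T.V ≃ Option R.N) (pe : R.N ≃ T.E), ι r = none ∧
      ∀ n, (ι (T.src (pe n)) = some n ∧ ι (T.tgt (pe n)) = R.par n) ∨
        (ι (T.tgt (pe n)) = some n ∧ ι (T.src (pe n)) = R.par n) := by
  obtain ⟨hc, hcard⟩ := hT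
  obtain ⟨-, hc⟩ := connected_iff.1 hc
  obtain ⟨rk, hrk⟩ := bfs_exists (fun u v => ∃ e ∈ (Set.univ : Set T.E),
    (T.src e = u ∧ T.tgt e = v) ∨ (T.src e = v ∧ T.tgt e = u)) r
  have h1 : ∀ v : {v // v ≠ r}, ∃ (u : T.V) (e : T.E), rk u < rk v.1 ∧
      ((T.src e = u ∧ T.tgt e = v.1) ∨ (T.src e = v.1 ∧ T.tgt e = u)) := by
    intro v
    obtain ⟨u, -, ⟨e, -, he⟩, hlt⟩ := hrk v.1 (hc r v.1) v.2
    exact ⟨u, e, hlt, he⟩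
  choose u ed hlt hed using h1
  let ι : T.V ≃ Option {v // v ≠ r} := (Equiv.optionSubtypeNe r).symm
  have hι : ∀ x : {v // v ≠ r}, ι x.1 = some x := by
    intro x
    rw [Equiv.symm_apply_eq]
    simp
  have hinj : Function.Injective ed := by
    intro a b hab
    have ha := hed a
    have hb := hed b
    rw [hab] at ha
    have la := hlt a
    have lb := hlt b
    apply Subtype.ext
    rcases ha with ⟨p, q⟩ | ⟨p, q⟩ <;> rcases hb with ⟨p', q'⟩ | ⟨p', q'⟩
    · rw [← q, ← q']
    · rw [← p, p'] at la; rw [← q', q] at lb; omega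
    · rw [← q, q'] at la; rw [← p', p] at lb; omega
    · rw [← p, ← p']
  have hbij : Function.Bijective ed := by
    rw [Fintype.bijective_iff_injective_and_card]
    refine ⟨hinj, ?_⟩
    have := Fintype.card_congr ι
    rw [Fintype.card_option] at this
    omega
  refine ⟨⟨{v // v ≠ r}, inferInstance, fun n => ι (u n), fun n => rk n.1, ?_⟩, ι,
    Equiv.ofBijective ed hbij, ?_, ?_⟩
  · intro n m h
    rw [← hι m] at h
    have := ι.injective h
    rw [← this]; exact hlt n
  · rw [Equiv.symm_apply_eq]; simp
  · intro n
    rcases hed n with ⟨p, q⟩ | ⟨p, q⟩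
    · right
      simp only [Equiv.ofBijective_apply]
      rw [p, q]; exact ⟨hι n, rfl⟩
    · left
      simp only [Equiv.ofBijective_apply]
      rw [p, q]; exact ⟨hι n, rfl⟩

set_option maxHeartbeats 1000000 in
theorem base_W {Q : CGraph} (φ : CMorphism G Q) (ha : φ.Harmonic) (hn : φ.Nondegenerate)
    (hd : φ.HasDegree 3) (R : RT) (ι : Q.V ≃ Option R.N) (pe : R.N ≃ Q.E)
    (hpe : ∀ n, (ι (Q.src (pe n)) = some n ∧ ι (Q.tgt (pe n)) = R.par n) ∨
        (ι (Q.tgt (pe n)) = some n ∧ ι (Q.src (pe n)) = R.par n)) :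
    W R.Desc R.inc G (fun v => ι (φ.vMap v)) := by
  have hends : ∀ (e : G.E) (n : R.N), φ.eMap e = Sum.inl (pe n) →
      (ι (φ.vMap (G.src e)) = some n ∧ ι (φ.vMap (G.tgt e)) = R.par n) ∨
      (ι (φ.vMap (G.src e)) = R.par n ∧ ι (φ.vMap (G.tgt e)) = some n) := by
    intro e n h
    rcases φ.edge_ok e _ h with ⟨p, q⟩ | ⟨p, q⟩ <;> rw [p, q] <;> rcases hpe n with ⟨x, y⟩ | ⟨x, y⟩ <;>
      simp [x, y]
  have hinc : ∀ n v, R.inc n (ι (φ.vMap v)) ↔ Incident Q (pe n) (φ.vMap v) := by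
    intro n v
    unfold RT.inc Incident
    rw [← ι.injective.eq_iff, ← ι.injective.eq_iff]
    rcases hpe n with ⟨x, y⟩ | ⟨x, y⟩ <;> rw [x, y]
    · rw [eq_comm (a := some n)]
    · rw [eq_comm (a := some n), or_comm]
  have hcut : ∀ n e, e ∈ cut G (fun v => R.Desc n (ι (φ.vMap v))) ↔ φ.eMap e = Sum.inl (pe n) := by
    intro n e
    rw [mem_cut]
    cases he : φ.eMap e with
    | inr v' =>
      obtain ⟨p, q⟩ := φ.contract_ok e v' he
      rw [p, q]; simp
    | inl e' =>
      obtain ⟨m, rfl⟩ := pe.surjective e'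
      have : (Sum.inl (pe m) : Q.E ⊕ Q.V) = Sum.inl (pe n) ↔ n = m := by
        rw [Sum.inl.injEq, pe.injective.eq_iff, eq_comm]
      rw [this, ← RT.desc_edge (R := R)]
      rcases hends e m he with ⟨p, q⟩ | ⟨p, q⟩ <;> rw [p, q]
      rw [iff_comm (a := R.Desc n (some m))]
  have hmu : ∀ e n, φ.eMap e = Sum.inl (pe n) → 1 ≤ φ.mu e := by
    intro e n h
    have := mt (φ.mu_zero e).1 (by rintro ⟨v', h'⟩; rw [h] at h'; cases h')
    omega
  have hle : ∀ n e, (if e ∈ cut G (fun v => R.Desc n (ι (φ.vMap v))) then 1 else 0) ≤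
      (if φ.eMap e = Sum.inl (pe n) then φ.mu e else 0) := by
    intro n e
    by_cases h : φ.eMap e = Sum.inl (pe n)
    · rw [if_pos ((hcut n e).2 h), if_pos h]; exact hmu e n h
    · rw [if_neg (mt (hcut n e).1 h), if_neg h]
  have hfull : ∀ n, (cut G (fun v => R.Desc n (ι (φ.vMap v)))).card = 3 →
      ∀ e, φ.eMap e = Sum.inl (pe n) → φ.mu e = 1 := by
    intro n h e he
    rw [cut_card, ← hd (pe n)] at h
    have := (Finset.sum_eq_sum_iff_of_le (fun e _ => hle n e)).1 h e (Finset.mem_univ e)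
    rw [if_pos ((hcut n e).2 he), if_pos he] at this
    exact this.symm
  have hcc : ∀ n, (cut G (fun v => R.Desc n (ι (φ.vMap v)))).card = 3 → ∀ v,
      cc G (fun v => R.Desc n (ι (φ.vMap v))) v = φ.locDeg v (pe n) := by
    intro n h v
    unfold cc CMorphism.locDeg
    refine Finset.sum_congr rfl fun e _ => ?_
    by_cases he : φ.eMap e = Sum.inl (pe n)
    · rw [if_pos ((hcut n e).2 he), if_pos he, hfull n h e he, one_mul]
    · rw [if_neg (mt (hcut n e).1 he), if_neg he]
  have hpos : ∀ n v, R.inc n (ι (φ.vMap v)) → 1 ≤ φ.locDeg v (pe n) := by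
    intro n v h
    obtain ⟨e', h1, h2⟩ := hn v
    rw [ha v (pe n) e' ((hinc n v).1 h) h1]
    exact h2
  refine ⟨fun n => ?_, fun n v a b => ?_, fun n n' v a b c d => ?_, fun n n' t e a b c d x y z => ?_,
    fun t => ?_⟩
  · rw [cut_card, ← hd (pe n)]
    exact Finset.sum_le_sum fun e _ => hle n e
  · rw [hcc n a]; exact hpos n v b
  · rw [hcc n a, hcc n' b]
    exact ha v _ _ ((hinc n v).1 c) ((hinc n' v).1 d)
  · exfalso
    rcases hends e n ((hcut n e).1 z) with ⟨p, q⟩ | ⟨p, q⟩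
    · rw [p] at x; rw [q] at y
      rcases c with c | c
      · exact x c.symm
      · exact y c
    · rw [p] at x; rw [q] at y
      rcases c with c | c
      · exact y c.symm
      · exact x c
  · suffices hs : (Finset.univ.filter fun v => ι (φ.vMap v) = t).card ≤ 3 by convert hs
    rcases (Finset.univ.filter fun v => ι (φ.vMap v) = t).eq_empty_or_nonempty with h0 | ⟨v0, h0⟩
    · rw [h0]; simp
    · simp only [Finset.mem_filter, Finset.mem_univ, true_and] at h0
      obtain ⟨e', h1, h2⟩ := hn v0
      obtain ⟨n, rfl⟩ := pe.surjective e'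
      have hi := (hinc n v0).2 h1
      rw [h0] at hi
      calc (Finset.univ.filter fun v => ι (φ.vMap v) = t).card
          = ∑ v ∈ Finset.univ.filter (fun v => ι (φ.vMap v) = t), 1 := by simp
        _ ≤ ∑ v ∈ Finset.univ.filter (fun v => ι (φ.vMap v) = t), φ.locDeg v (pe n) := by
            refine Finset.sum_le_sum fun v hv => hpos n v ?_
            simp only [Finset.mem_filter, Finset.mem_univ, true_and] at hv
            rw [hv]; exact hi
        _ = ∑ e : G.E, ∑ v ∈ Finset.univ.filter (fun v => ι (φ.vMap v) = t),
              (if φ.eMap e = Sum.inl (pe n) then φ.mu e * incid G e v else 0) := by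
            unfold CMorphism.locDeg
            rw [Finset.sum_comm]
        _ ≤ ∑ e : G.E, (if φ.eMap e = Sum.inl (pe n) then φ.mu e else 0) := by
            refine Finset.sum_le_sum fun e _ => ?_
            by_cases he : φ.eMap e = Sum.inl (pe n)
            · simp only [if_pos he]
              rw [← Finset.mul_sum]
              refine le_trans (Nat.mul_le_mul_left _ ?_) (le_of_eq (mul_one _))
              unfold incid
              rw [Finset.sum_add_distrib, Finset.sum_ite_eq, Finset.sum_ite_eq]
              simp only [Finset.mem_filter, Finset.mem_univ, true_and]
              have hne := RT.par_ne n
              rcases hends e n he with ⟨p, q⟩ | ⟨p, q⟩ <;> rw [p, q]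
              · by_cases h5 : some n = t
                · simp only [if_pos h5, if_neg (show ¬ R.par n = t by rw [← h5]; exact hne)]; omega
                · simp only [if_neg h5]; split_ifs <;> omega
              · by_cases h5 : some n = t
                · simp only [if_pos h5, if_neg (show ¬ R.par n = t by rw [← h5]; exact hne)]; omega
                · simp only [if_neg h5]; split_ifs <;> omega
            · simp only [if_neg he]; simp
        _ = 3 := hd (pe n)
end TG

open scoped Classical
namespace TG
open Relation CGraph
variable {G H K : CGraph} {D D' D'' d d' e e' : LD}

namespace RT
variable {R : RT}

theorem quad {m n : R.N} {a b c d : Option R.N}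
    (h1 : R.Desc m a ↔ R.Desc m b) (h2 : ¬ (R.Desc m a ↔ R.Desc m c)) (h3 : R.Desc m c ↔ R.Desc m d)
    (h4 : R.Desc n a ↔ R.Desc n c) (h5 : ¬ (R.Desc n a ↔ R.Desc n b))
    (h6 : R.Desc n b ↔ R.Desc n d) : False := by
  have key : ∀ x y z : Option R.N, R.Desc m x → R.Desc n x → R.Desc m y → ¬ R.Desc n y →
      ¬ R.Desc m z → R.Desc n z → False := by
    intro x y z a1 a2 a3 a4 a5 a6
    rcases desc_comp a1 a2 with h | h
    · exact a5 (desc_trans a6 h)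
    · exact a4 (desc_trans a3 h)
  by_cases p : R.Desc m a <;> by_cases q : R.Desc n a <;> simp only [p, q, true_iff, false_iff, not_not] at h1 h2 h4 h5 <;> simp only [h1, h2, h4, h5, true_iff, false_iff, not_true, not_false_iff] at h3 h6
  · exact key a b c p q h1 h5 h2 h4
  · exact key b a d h1 h5 p q h3 h6
  · exact key c d a h2 h4 h3 h6 p q
  · exact key d c b h3 h6 h2 h4 h1 h5

theorem sep_ex {t a : Option R.N} (h : t ≠ a) : ∃ n, R.inc n t ∧ ¬ (R.Desc n t ↔ R.Desc n a) := by
  have : ∃ m, ¬ (R.Desc m t ↔ R.Desc m a) := by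
    cases t with
    | none =>
      cases a with
      | none => exact absurd rfl h
      | some k => exact ⟨k, fun h' => desc_none (h'.2 desc_self)⟩
    | some k =>
      by_cases hk : R.Desc k a
      · cases a with
        | none => exact absurd hk desc_none
        | some j =>
          refine ⟨j, fun h' => h ?_⟩
          rw [desc_antisymm hk (h'.2 desc_self)]
      · exact ⟨k, fun h' => hk (h'.1 desc_self)⟩
  obtain ⟨m, hm⟩ := this
  obtain ⟨n, h1, h2, -⟩ := sep_inc hm hm
  exact ⟨n, h1, h2⟩

/-- the other end -/
theorem inc_other {n : R.N} {t : Option R.N} (h : R.inc n t) :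
    ∃ s, R.inc n s ∧ s ≠ t ∧ (∀ x, R.inc n x ↔ x = t ∨ x = s) ∧
      ∀ m, ¬ (R.Desc m t ↔ R.Desc m s) ↔ m = n := by
  rcases h with rfl | rfl
  · refine ⟨R.par n, Or.inr rfl, par_ne n, fun x => ?_, fun m => desc_edge⟩
    unfold inc; rw [eq_comm (a := R.par n)]
  · refine ⟨some n, Or.inl rfl, (par_ne n).symm, fun x => ?_, fun m => ?_⟩
    · unfold inc; rw [eq_comm (a := R.par n), or_comm]
    · rw [iff_comm (a := R.Desc m (R.par n))]; exact desc_edge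

theorem first_unique {m n : R.N} {a b : Option R.N} (hm : R.inc m a) (hn : R.inc n a)
    (h1 : ¬ (R.Desc m a ↔ R.Desc m b)) (h2 : ¬ (R.Desc n a ↔ R.Desc n b)) : m = n := by
  by_contra hne
  obtain ⟨s, -, -, -, hs⟩ := inc_other hm
  obtain ⟨t, -, -, -, ht⟩ := inc_other hn
  have hs1 := hs n
  have hs2 := (hs m).2 rfl
  have ht1 := ht m
  have ht2 := (ht n).2 rfl
  have e1 : R.Desc n a ↔ R.Desc n s := not_not.1 (mt hs1.1 (Ne.symm hne))
  have e2 : R.Desc m a ↔ R.Desc m t := not_not.1 (mt ht1.1 hne)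
  refine quad (m := m) (n := n) (a := a) (b := t) (c := s) (d := b) e2 hs2 ?_ e1 ht2 ?_
  · by_cases p : R.Desc m a <;> by_cases q : R.Desc m b <;> by_cases r : R.Desc m s <;> simp_all
  · by_cases p : R.Desc n a <;> by_cases q : R.Desc n b <;> by_cases r : R.Desc n t <;> simp_all

end RT

theorem W.transfer {𝒱 N 𝒱' N' : Type} {side inc : N → 𝒱 → Prop} {f : G.V → 𝒱}
    (h : W side inc G f) (side' inc' : N' → 𝒱' → Prop) (f' : G.V → 𝒱') (emb : 𝒱' → 𝒱)
    (he : Function.Injective emb) (hf : ∀ x, emb (f' x) = f x)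
    (h1 : ∀ n, ∃ n', ∀ x, side' n (f' x) ↔ side n' (f x))
    (h2 : ∀ n t, inc' n t → ∃ n', inc n' (emb t) ∧ ∀ x, side' n (f' x) ↔ side n' (f x)) :
    W side' inc' G f' := by
  have h3 : ∀ n t, inc' n t → ∃ n', inc n' (emb t) ∧
      (fun x => side' n (f' x)) = (fun x => side n' (f x)) := by
    intro n t hi
    obtain ⟨n', a, b⟩ := h2 n t hi
    exact ⟨n', a, funext fun x => propext (b x)⟩
  refine ⟨fun n => ?_, fun n v a b => ?_, fun n n' v a b c d => ?_, fun n n' t e a b c d x y z => ?_,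
    fun t => ?_⟩
  · obtain ⟨n', hn⟩ := h1 n
    rw [show (fun x => side' n (f' x)) = (fun x => side n' (f x)) from funext fun x => propext (hn x)]
    exact h.le3 n'
  · obtain ⟨m, hi, hm⟩ := h3 n _ b
    rw [hf] at hi
    rw [hm] at a ⊢
    exact h.pos m v a hi
  · obtain ⟨m, hi, hm⟩ := h3 n _ c
    obtain ⟨m', hi', hm'⟩ := h3 n' _ d
    rw [hf] at hi hi'
    rw [hm] at a ⊢
    rw [hm'] at b ⊢
    exact h.eq m m' v a b hi hi'
  · obtain ⟨m, hi, hm⟩ := h3 n _ c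
    obtain ⟨m', hi', hm'⟩ := h3 n' _ d
    rw [hm] at a z
    rw [hm'] at b ⊢
    exact h.pass m m' (emb t) e a b hi hi' (by rw [← hf]; exact he.ne x) (by rw [← hf]; exact he.ne y) z
  · have := h.fib (emb t)
    have e1 : (Finset.univ.filter fun v => f v = emb t) = (Finset.univ.filter fun v => f' v = t) := by
      ext v
      simp only [Finset.mem_filter, Finset.mem_univ, true_and]
      rw [← hf, he.eq_iff]
    rw [e1] at this
    exact this

/-- one removal -/
theorem remove (R : RT) (f : G.V → Option R.N) (h : W R.Desc R.inc G f) (hr : ∃ x, f x = none)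
    (b : R.N) (hb : ∀ x, f x ≠ some b) (hc : ∀ m m', R.par m = some b → R.par m' = some b → m = m') :
    ∃ (R' : RT) (f' : G.V → Option R'.N), W R'.Desc R'.inc G f' ∧ (∃ x, f' x = none) ∧
      Fintype.card R'.N < Fintype.card R.N := by
  let emb : Option {n : R.N // n ≠ b} → Option R.N := Option.map Subtype.val
  have hemb : Function.Injective emb := Option.map_injective Subtype.val_injective
  have hpre : ∀ t : Option R.N, t ≠ some b → ∃ t', emb t' = t := by
    intro t ht
    cases t with
    | none => exact ⟨none, rfl⟩
    | some k => exact ⟨some ⟨k, fun h => ht (by rw [h])⟩, rfl⟩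
  let q : {n : R.N // n ≠ b} → Option R.N := fun n => if R.par n.1 = some b then R.par b else R.par n.1
  have hq : ∀ n, q n ≠ some b := by
    intro n
    by_cases hp : R.par n.1 = some b
    · simp only [q, if_pos hp]; exact RT.par_ne b
    · simp only [q, if_neg hp]; exact hp
  choose par' hpar' using fun n => hpre (q n) (hq n)
  choose f' hf' using fun x => hpre (f x) (hb x)
  have hrk : ∀ n m, par' n = some m → R.rk m.1 < R.rk n.1 := by
    intro n m h
    have h1 := hpar' n
    rw [h] at h1
    by_cases hp : R.par n.1 = some b
    · simp only [q, if_pos hp] at h1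
      have := R.rk_lt _ _ h1.symm
      have := R.rk_lt _ _ hp
      omega
    · simp only [q, if_neg hp] at h1
      exact R.rk_lt _ _ h1.symm
  let R' : RT := ⟨{n : R.N // n ≠ b}, inferInstance, par', fun n => R.rk n.1, hrk⟩
  have hD : ∀ (n : R'.N) (t : Option R'.N), R'.Desc n t ↔ R.Desc n.1 (emb t) := by
    intro n
    have : ∀ r, ∀ m : R'.N, R'.rk m = r → (R'.Desc n (some m) ↔ R.Desc n.1 (emb (some m))) := by
      intro r
      induction r using Nat.strong_induction_on with
      | _ r ih =>
        intro m hm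
        have h0 : R'.Desc n (R'.par m) ↔ R.Desc n.1 (emb (R'.par m)) := by
          cases hp : R'.par m with
          | none => exact iff_of_false RT.desc_none RT.desc_none
          | some k => exact ih _ (hm ▸ R'.rk_lt m k hp) k rfl
        rw [RT.desc_some, h0]
        show m = n ∨ R.Desc n.1 (emb (par' m)) ↔ R.Desc n.1 (some m.1)
        rw [hpar', RT.desc_some, Subtype.ext_iff]
        refine or_congr Iff.rfl ?_
        by_cases hp : R.par m.1 = some b
        · simp only [q, if_pos hp]
          rw [hp, RT.desc_some]
          exact ⟨Or.inr, fun h => h.resolve_left n.2.symm⟩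
        · simp only [q, if_neg hp]
    intro t
    cases t with
    | none => exact iff_of_false RT.desc_none RT.desc_none
    | some m => exact this _ m rfl
  refine ⟨R', f', h.transfer _ _ f' emb hemb hf' ?_ ?_, ?_, ?_⟩
  · intro n
    exact ⟨n.1, fun x => by rw [hD, hf']⟩
  · rintro n t (rfl | rfl)
    · exact ⟨n.1, Or.inl rfl, fun x => by rw [hD, hf']⟩
    · by_cases hp : R.par n.1 = some b
      · refine ⟨b, Or.inr ?_, fun x => ?_⟩
        · show R.par b = emb (par' n)
          rw [hpar']; simp only [q, if_pos hp]
        · rw [hD, hf']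
          constructor
          · intro hx
            exact RT.desc_trans hx (RT.desc_some.2 (Or.inr (hp ▸ RT.desc_self)))
          · intro hx
            cases hfx : f x with
            | none => rw [hfx] at hx; exact absurd hx RT.desc_none
            | some m =>
              rw [hfx] at hx
              obtain ⟨k, hk, hk'⟩ := RT.desc_child hx (fun h => hb x (by rw [hfx, h]))
              rw [hc _ _ hp hk]; exact hk'
      · refine ⟨n.1, Or.inr ?_, fun x => by rw [hD, hf']⟩
        show R.par n.1 = emb (par' n)
        rw [hpar']; simp only [q, if_neg hp]
  · obtain ⟨x, hx⟩ := hr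
    refine ⟨x, hemb ?_⟩
    rw [hf', hx]; rfl
  · show Fintype.card {n : R.N // n ≠ b} < _
    exact Fintype.card_subtype_lt (x := b) (by simp)

theorem reduce (k : ℕ) : ∀ (R : RT) (f : G.V → Option R.N), Fintype.card R.N = k →
    W R.Desc R.inc G f → (∃ x, f x = none) →
    ∃ (R' : RT) (f' : G.V → Option R'.N), W R'.Desc R'.inc G f' ∧ (∃ x, f' x = none) ∧
      ∀ n, (∃ x, f' x = some n) ∨ ∃ m m', m ≠ m' ∧ R'.par m = some n ∧ R'.par m' = some n := by
  induction k using Nat.strong_induction_on with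
  | _ k ih =>
    intro R f hk h hr
    by_cases hc : ∀ n, (∃ x, f x = some n) ∨ ∃ m m', m ≠ m' ∧ R.par m = some n ∧ R.par m' = some n
    · exact ⟨R, f, h, hr, hc⟩
    · push Not at hc
      obtain ⟨b, hb, hb'⟩ := hc
      obtain ⟨R', f', h1, h2, h3⟩ := remove R f h hr b hb (fun m m' p q => by
        by_contra hne
        exact hb' m m' hne p q)
      exact ih _ (hk ▸ h3) R' f' rfl h1 h2

theorem full_cut (R : RT) (f : G.V → Option R.N) (htec : ThreeEdgeConnected G)
    (h : W R.Desc R.inc G f) (hr : ∃ x, f x = none)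
    (hc : ∀ n, (∃ x, f x = some n) ∨ ∃ m m', m ≠ m' ∧ R.par m = some n ∧ R.par m' = some n) (n : R.N) :
    (cut G fun v => R.Desc n (f v)).card = 3 := by
  refine le_antisymm (h.le3 n) ?_
  refine tec_iff.1 htec (fun v => R.Desc n (f v)) ?_ ?_
  · obtain ⟨n', hn', hmax⟩ := Finset.exists_max_image
      (Finset.univ.filter fun m : R.N => R.Desc n (some m)) R.rk ⟨n, by simp [RT.desc_self]⟩
    simp only [Finset.mem_filter, Finset.mem_univ, true_and] at hn' hmax
    rcases hc n' with ⟨x, hx⟩ | ⟨m, -, -, hm, -⟩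
    · exact ⟨x, by rw [hx]; exact hn'⟩
    · have := hmax m (RT.desc_some.2 (Or.inr (hm ▸ hn')))
      have := R.rk_lt _ _ hm
      omega
  · obtain ⟨x, hx⟩ := hr
    exact ⟨x, by rw [hx]; exact RT.desc_none⟩
end TG

open scoped Classical
namespace TG
open Relation CGraph
variable {G H K : CGraph} {D D' D'' d d' e e' : LD}

structure Sb (R : RT) (H : CGraph) (f : H.V → Option R.N) : Prop where
  c3 : ∀ n, (cut H fun v => R.Desc n (f v)).card = 3
  pos : ∀ n v, R.inc n (f v) → 1 ≤ cc H (fun v => R.Desc n (f v)) v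
  eq : ∀ n n' v, R.inc n (f v) → R.inc n' (f v) →
    cc H (fun v => R.Desc n (f v)) v = cc H (fun v => R.Desc n' (f v)) v
  pass : ∀ n n' t e, R.inc n t → R.inc n' t → f (H.src e) ≠ t → f (H.tgt e) ≠ t →
    e ∈ cut H (fun v => R.Desc n (f v)) → e ∈ cut H (fun v => R.Desc n' (f v))
  loopless : ∀ e, H.src e ≠ H.tgt e
  val2 : ∀ v, 2 ≤ valence H v
  cov : ∀ n, (∃ v, f v = some n ∧ 3 ≤ valence H v) ∨
    ∃ m m', m ≠ m' ∧ R.par m = some n ∧ R.par m' = some n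
  root : ∃ v, f v = none ∧ 3 ≤ valence H v

/-- subdivision of an edge -/
noncomputable abbrev Sub (H : CGraph) (ε : H.E) : CGraph where
  V := Option H.V
  E := Option H.E
  fV := inferInstance
  fE := inferInstance
  dV := inferInstance
  dE := inferInstance
  src := fun e => match e with
    | none => none
    | some e => some (H.src e)
  tgt := fun e => match e with
    | none => some (H.tgt ε)
    | some e => if e = ε then none else some (H.tgt e)

def subF {𝒱 : Type} (f : H.V → 𝒱) (t : 𝒱) (ε : H.E) : (Sub H ε).V → 𝒱
  | none => t
  | some v => f v

variable {ε : H.E}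

theorem sub_incid_none_none : incid (Sub H ε) none none = 1 := by
  simp [incid]
theorem sub_incid_none_some (v : H.V) : incid (Sub H ε) none (some v) = if H.tgt ε = v then 1 else 0 := by
  simp [incid]
theorem sub_incid_eps_none : incid (Sub H ε) (some ε) none = 1 := by
  simp [incid]
theorem sub_incid_eps_some (v : H.V) : incid (Sub H ε) (some ε) (some v) = if H.src ε = v then 1 else 0 := by
  simp [incid]
theorem sub_incid_ne_none {e : H.E} (h : e ≠ ε) : incid (Sub H ε) (some e) none = 0 := by
  simp [incid, h]
theorem sub_incid_ne_some {e : H.E} (h : e ≠ ε) (v : H.V) :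
    incid (Sub H ε) (some e) (some v) = incid H e v := by
  simp [incid, h]

theorem sub_val_none : valence (Sub H ε) none = 2 := by
  unfold valence
  rw [Fintype.sum_option, sub_incid_none_none, Finset.sum_eq_single ε, sub_incid_eps_none]
  · intro e _ h; exact sub_incid_ne_none h
  · intro h; exact absurd (Finset.mem_univ _) h

theorem sub_val_some (v : H.V) : valence (Sub H ε) (some v) = valence H v := by
  unfold valence
  rw [Fintype.sum_option, Fintype.sum_eq_add_sum_subtype_ne _ ε,
    Fintype.sum_eq_add_sum_subtype_ne (fun e => incid H e v) ε, sub_incid_none_some, sub_incid_eps_some, ← add_assoc]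
  congr 1
  · unfold incid; rw [add_comm]
  · exact Finset.sum_congr rfl fun e _ => sub_incid_ne_some e.2 v

theorem sub_step (hl : ∀ e, H.src e ≠ H.tgt e) : SeriesStep0 (Sub H ε) H := by
  refine ⟨none, some ε, none, some (H.src ε), some (H.tgt ε), by simp, sub_val_none, by simp, by simp,
    ?_, ?_, ⟨fun v => ⟨some v, by simp⟩, fun v => v.1.get (by
      obtain ⟨v, hv⟩ := v; cases v with
      | none => exact absurd rfl hv
      | some v => rfl), fun v => rfl, ?_⟩, ε,
      ⟨fun e => ⟨some e.1, by simpa using e.2, by simp⟩, fun e => ⟨e.1.get (by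
      obtain ⟨v, hv⟩ := e; cases v with
      | none => exact absurd rfl hv.2
      | some v => rfl), ?_⟩, fun _ => rfl, ?_⟩, ?_, ?_⟩
  · simp [Set.pair_comm]
  · simp
  · rintro ⟨_ | v, hv⟩
    · exact absurd rfl hv
    · rfl
  · obtain ⟨_ | v, hv⟩ := e
    · exact absurd rfl hv.2
    · simpa using hv.1
  · rintro ⟨_ | v, hv⟩
    · exact absurd rfl hv.2
    · rfl
  · rfl
  · intro e
    left
    refine ⟨rfl, ?_⟩
    show some (H.tgt e.1) = if e.1 = ε then none else some (H.tgt e.1)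
    rw [if_neg e.2]

theorem sub_cut_ne {𝒱 : Type} (f : H.V → 𝒱) (t : 𝒱) (U : 𝒱 → Prop) {e : H.E} (h : e ≠ ε) :
    some e ∈ cut (Sub H ε) (fun v => U (subF f t ε v)) ↔ e ∈ cut H (fun v => U (f v)) := by
  rw [mem_cut, mem_cut]
  simp only [if_neg h]; rfl

theorem sub_cut_eps {𝒱 : Type} (f : H.V → 𝒱) (t : 𝒱) (U : 𝒱 → Prop) :
    some ε ∈ cut (Sub H ε) (fun v => U (subF f t ε v)) ↔ ¬ (U (f (H.src ε)) ↔ U t) := by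
  rw [mem_cut]
  simp only [if_true]; rfl

theorem sub_cut_none {𝒱 : Type} (f : H.V → 𝒱) (t : 𝒱) (U : 𝒱 → Prop) :
    none ∈ cut (Sub H ε) (fun v => U (subF f t ε v)) ↔ ¬ (U t ↔ U (f (H.tgt ε))) := by
  rw [mem_cut]; rfl

theorem sub_sb {R : RT} {f : H.V → Option R.N} (h : Sb R H f) {n₀ : R.N} {t₀ : Option R.N}
    (hn : R.inc n₀ (f (H.src ε))) (hcr : ¬ (R.Desc n₀ (f (H.src ε)) ↔ R.Desc n₀ (f (H.tgt ε))))
    (ht : ∀ x, R.inc n₀ x ↔ x = f (H.src ε) ∨ x = t₀)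
    (hs : ∀ m, ¬ (R.Desc m (f (H.src ε)) ↔ R.Desc m t₀) ↔ m = n₀)
    (hne : t₀ ≠ f (H.src ε)) (hb : f (H.tgt ε) ≠ t₀) : Sb R (Sub H ε) (subF f t₀ ε) := by
  have hab : f (H.src ε) ≠ f (H.tgt ε) := fun h' => hcr (by rw [h'])
  have cE : ∀ m, some ε ∈ cut (Sub H ε) (fun v => R.Desc m (subF f t₀ ε v)) ↔ m = n₀ := by
    intro m
    rw [← hs m]
    exact sub_cut_eps f t₀ (R.Desc m)
  have cN : ∀ m, none ∈ cut (Sub H ε) (fun v => R.Desc m (subF f t₀ ε v)) ↔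
      (m ≠ n₀ ∧ ε ∈ cut H (fun v => R.Desc m (f v))) := by
    intro m
    refine (sub_cut_none f t₀ (R.Desc m)).trans ?_
    rw [mem_cut]
    by_cases hm : m = n₀
    · subst hm
      have := (hs m).2 rfl
      refine iff_of_false (fun h' => ?_) (fun h' => h'.1 rfl)
      by_cases p : R.Desc m (f (H.src ε)) <;> by_cases q : R.Desc m (f (H.tgt ε)) <;>
        by_cases r : R.Desc m t₀ <;> simp_all
    · have : R.Desc m (f (H.src ε)) ↔ R.Desc m t₀ := not_not.1 (mt (hs m).1 hm)
      rw [this]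
      exact ⟨fun x => ⟨hm, x⟩, fun x => x.2⟩
  have c0 : ε ∈ cut H (fun v => R.Desc n₀ (f v)) := mem_cut.2 hcr
  have hin : ∀ m, R.inc m (f (H.src ε)) → ε ∈ cut H (fun v => R.Desc m (f v)) → m = n₀ := by
    intro m hm hx
    exact RT.first_unique hm hn (mem_cut.1 hx) hcr
  have hcard : ∀ m, (cut (Sub H ε) (fun v => R.Desc m (subF f t₀ ε v))).card =
      (cut H (fun v => R.Desc m (f v))).card := by
    intro m
    rw [cut_card, cut_card, Fintype.sum_option, Fintype.sum_eq_add_sum_subtype_ne _ ε,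
      Fintype.sum_eq_add_sum_subtype_ne (fun e => if e ∈ cut H (fun v => R.Desc m (f v)) then 1 else 0) ε,
      ← add_assoc]
    congr 1
    · by_cases hm : m = n₀
      · subst hm
        rw [if_pos ((cE m).2 rfl), if_neg (mt (cN m).1 (fun x => x.1 rfl)), if_pos c0]
      · rw [if_neg (mt (cE m).1 hm)]
        by_cases p : ε ∈ cut H (fun v => R.Desc m (f v))
        · rw [if_pos ((cN m).2 ⟨hm, p⟩), if_pos p]
        · rw [if_neg (mt (cN m).1 (fun x => p x.2)), if_neg p]
    · refine Finset.sum_congr rfl fun e _ => ?_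
      have := sub_cut_ne f t₀ (R.Desc m) e.2
      by_cases p : e.1 ∈ cut H (fun v => R.Desc m (f v))
      · rw [if_pos p, if_pos (this.2 p)]
      · rw [if_neg p, if_neg (mt this.1 p)]
  have hccs : ∀ m v, R.inc m (f v) → cc (Sub H ε) (fun v => R.Desc m (subF f t₀ ε v)) (some v) =
      cc H (fun v => R.Desc m (f v)) v := by
    intro m v hi
    unfold cc
    rw [Fintype.sum_option, Fintype.sum_eq_add_sum_subtype_ne _ ε,
      Fintype.sum_eq_add_sum_subtype_ne (fun e => if e ∈ cut H (fun v => R.Desc m (f v)) then incid H e v else 0) ε,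
      ← add_assoc]
    congr 1
    · rw [sub_incid_none_some, sub_incid_eps_some]
      unfold incid
      by_cases hm : m = n₀
      · subst hm
        rw [if_pos ((cE m).2 rfl), if_neg (mt (cN m).1 (fun x => x.1 rfl)), if_pos c0]
        have : H.tgt ε ≠ v := by
          rintro rfl
          rcases (ht _).1 hi with h' | h'
          · exact hab h'.symm
          · exact hb h'
        rw [if_neg this]; omega
      · rw [if_neg (mt (cE m).1 hm)]
        by_cases p : ε ∈ cut H (fun v => R.Desc m (f v))
        · rw [if_pos ((cN m).2 ⟨hm, p⟩), if_pos p]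
          have : H.src ε ≠ v := by
            rintro rfl
            exact hm (hin m hi p)
          rw [if_neg this]; omega
        · rw [if_neg (mt (cN m).1 (fun x => p x.2)), if_neg p]
    · refine Finset.sum_congr rfl fun e _ => ?_
      have := sub_cut_ne f t₀ (R.Desc m) e.2
      rw [sub_incid_ne_some e.2]
      by_cases p : e.1 ∈ cut H (fun v => R.Desc m (f v))
      · rw [if_pos p, if_pos (this.2 p)]
      · rw [if_neg p, if_neg (mt this.1 p)]
  have hccn : ∀ m, R.inc m t₀ → cc (Sub H ε) (fun v => R.Desc m (subF f t₀ ε v)) none = 1 := by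
    intro m hi
    have p : ε ∈ cut H (fun v => R.Desc m (f v)) :=
      h.pass n₀ m t₀ ε ((ht _).2 (Or.inr rfl)) hi hne.symm hb c0
    unfold cc
    rw [Fintype.sum_option, Fintype.sum_eq_add_sum_subtype_ne _ ε, ← add_assoc]
    rw [sub_incid_none_none, sub_incid_eps_none, Finset.sum_eq_zero]
    · by_cases hm : m = n₀
      · subst hm
        rw [if_pos ((cE m).2 rfl), if_neg (mt (cN m).1 (fun x => x.1 rfl))]; rfl
      · rw [if_neg (mt (cE m).1 hm), if_pos ((cN m).2 ⟨hm, p⟩)]; rfl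
    · intro e _
      rw [sub_incid_ne_none e.2]; simp
  refine ⟨fun n => by rw [hcard]; exact h.c3 n, ?_, ?_, ?_, ?_, ?_, ?_, ?_⟩
  · rintro n (_ | v) hi
    · rw [hccn n hi]
    · rw [hccs n v hi]; exact h.pos n v hi
  · rintro n n' (_ | v) hi hi'
    · rw [hccn n hi, hccn n' hi']
    · rw [hccs n v hi, hccs n' v hi']; exact h.eq n n' v hi hi'
  · rintro n n' t (_ | e) hi hi' x y z
    · change t₀ ≠ t at x
      change f (H.tgt ε) ≠ t at y
      obtain ⟨z1, z2⟩ := (cN n).1 z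
      have hta : f (H.src ε) ≠ t := by
        rintro rfl
        exact z1 (hin n hi z2)
      refine (cN n').2 ⟨?_, h.pass n n' t ε hi hi' hta y z2⟩
      rintro rfl
      rcases (ht t).1 hi' with h' | h'
      · exact hta h'.symm
      · exact x h'.symm
    · by_cases he : e = ε
      · subst he
        change f (H.src e) ≠ t at x
        have y' : t₀ ≠ t := by simpa [subF] using y
        have := (cE n).1 z
        subst this
        rcases (ht t).1 hi with h' | h'
        · exact absurd h'.symm x
        · exact absurd h'.symm y'
      · change f (H.src e) ≠ t at x
        have y' : f (H.tgt e) ≠ t := by simpa [he, subF] using y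
        exact (sub_cut_ne f t₀ (R.Desc n') he).2 (h.pass n n' t e hi hi' x y'
          ((sub_cut_ne f t₀ (R.Desc n) he).1 z))
  · rintro (_ | e)
    · simp
    · by_cases he : e = ε
      · simp [he]
      · simp [he, h.loopless e]
  · rintro (_ | v)
    · rw [sub_val_none]
    · rw [sub_val_some]; exact h.val2 v
  · intro n
    rcases h.cov n with ⟨v, hv, hv'⟩ | hc
    · exact Or.inl ⟨some v, hv, by rw [sub_val_some]; exact hv'⟩
    · exact Or.inr hc
  · obtain ⟨v, hv, hv'⟩ := h.root
    exact ⟨some v, hv, by rw [sub_val_some]; exact hv'⟩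

/-- every edge is vertical or joins neighbouring fibres -/
def Honest (R : RT) (H : CGraph) (f : H.V → Option R.N) : Prop :=
  ∀ e, f (H.src e) ≠ f (H.tgt e) → ∃ n, R.inc n (f (H.src e)) ∧ R.inc n (f (H.tgt e))

noncomputable def nv (R : RT) (H : CGraph) (f : H.V → Option R.N) : Finset H.E :=
  Finset.univ.filter fun e => f (H.src e) ≠ f (H.tgt e)

theorem nv_le {R : RT} {f : H.V → Option R.N} (h : Sb R H f) :
    (nv R H f).card ≤ 3 * Fintype.card R.N := by
  have : nv R H f ⊆ Finset.univ.biUnion fun n => cut H (fun v => R.Desc n (f v)) := by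
    intro e he
    simp only [nv, Finset.mem_filter, Finset.mem_univ, true_and] at he
    obtain ⟨n, -, hn⟩ := RT.sep_ex he
    simp only [Finset.mem_biUnion, Finset.mem_univ, true_and]
    exact ⟨n, mem_cut.2 hn⟩
  refine (Finset.card_le_card this).trans (Finset.card_biUnion_le.trans ?_)
  simp only [h.c3, Finset.sum_const, Finset.card_univ, smul_eq_mul]
  omega

theorem subdivide {R : RT} (k : ℕ) : ∀ (H : CGraph) (f : H.V → Option R.N), Sb R H f →
    3 * Fintype.card R.N - (nv R H f).card = k →
    ∃ (H' : CGraph) (f' : H'.V → Option R.N), Sb R H' f' ∧ Honest R H' f' ∧ StabReduces0 H' H := by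
  induction k using Nat.strong_induction_on with
  | _ k ih =>
    intro H f h hk
    by_cases hh : Honest R H f
    · exact ⟨H, f, h, hh, ReflTransGen.refl⟩
    · unfold Honest at hh
      push Not at hh
      obtain ⟨ε, hε, hno⟩ := hh
      obtain ⟨n₀, hn, hcr⟩ := RT.sep_ex hε
      obtain ⟨t₀, h1, h2, h3, h4⟩ := RT.inc_other hn
      have hb : f (H.tgt ε) ≠ t₀ := fun h' => hno n₀ hn (h' ▸ h1)
      have hS := sub_sb h hn hcr h3 h4 h2 hb
      have hlt : (nv R H f).card + 1 ≤ (nv R (Sub H ε) (subF f t₀ ε)).card := by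
        have : insert none ((nv R H f).image some) ⊆ nv R (Sub H ε) (subF f t₀ ε) := by
          intro e he
          simp only [Finset.mem_insert, Finset.mem_image, nv, Finset.mem_filter, Finset.mem_univ,
            true_and] at he ⊢
          rcases he with rfl | ⟨e, he, rfl⟩
          · exact hb.symm
          · by_cases hx : e = ε
            · subst hx
              simpa [subF] using h2.symm
            · simpa [subF, hx] using he
        have h5 := Finset.card_le_card this
        rw [Finset.card_insert_of_notMem (by simp), Finset.card_image_of_injective _ (Option.some_injective _)] at h5
        exact h5
      have hb1 := nv_le hS
      obtain ⟨H', f', a, b, c⟩ := ih _ (by omega) (Sub H ε) (subF f t₀ ε) hS rfl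
      exact ⟨H', f', a, b, c.tail (Or.inr (Or.inl (sub_step h.loopless)))⟩
end TG

open scoped Classical
namespace TG
open Relation CGraph
variable {G H K : CGraph} {D D' D'' d d' e e' : LD}

theorem rec_exists {α : Type} (R : RT) (a0 : α) (s : R.N → α → α) :
    ∃ F : Option R.N → α, F none = a0 ∧ ∀ n, F (some n) = s n (F (R.par n)) := by
  obtain ⟨A, hA, hN⟩ : ∃ A : ℕ → Option R.N → α, (∀ k n, A (k + 1) (some n) = s n (A k (R.par n))) ∧
      ∀ k, A k none = a0 := by
    refine ⟨fun k => Nat.rec (fun _ => a0) (fun _ r t => match t with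
      | none => a0
      | some n => s n (r (R.par n))) k, fun k n => rfl, fun k => ?_⟩
    cases k <;> rfl
  have hs : ∀ k j t, (∀ n, t = some n → R.rk n < k ∧ R.rk n < j) → A k t = A j t := by
    intro k
    induction k with
    | zero =>
      intro j t h
      cases t with
      | none => rw [hN, hN]
      | some n => have := (h n rfl).1; omega
    | succ k ih =>
      intro j t h
      cases t with
      | none => exact (hN _).trans (hN _).symm
      | some n =>
        cases j with
        | zero => have := (h n rfl).2; omega
        | succ j =>
          rw [hA, hA, ih j]
          intro m hm
          have := R.rk_lt n m hm
          have := h n rfl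
          omega
  refine ⟨fun t => match t with
    | none => a0
    | some n => A (R.rk n + 1) (some n), rfl, fun n => ?_⟩
  show A (R.rk n + 1) (some n) = _
  rw [hA]
  congr 1
  cases hp : R.par n with
  | none => exact hN _
  | some m =>
    show A (R.rk n) (some m) = A (R.rk m + 1) (some m)
    refine hs _ _ _ fun k hk => ?_
    cases hk
    have := R.rk_lt n m hp
    omega

def Joins (H : CGraph) (e : H.E) (a b : H.V) : Prop :=
  (H.src e = a ∧ H.tgt e = b) ∨ (H.src e = b ∧ H.tgt e = a)

theorem Joins.symm {e : H.E} {a b : H.V} (h : Joins H e a b) : Joins H e b a := Or.symm h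

theorem honest_ends {R : RT} {f : H.V → Option R.N} (hh : Honest R H f) {n : R.N} {e : H.E}
    (he : e ∈ cut H fun v => R.Desc n (f v)) :
    ∃ a b, f a = some n ∧ f b = R.par n ∧ Joins H e a b := by
  rw [mem_cut] at he
  have hne : f (H.src e) ≠ f (H.tgt e) := fun h => he (by rw [h])
  obtain ⟨m, h1, h2⟩ := hh e hne
  obtain ⟨s, -, -, h3, h4⟩ := RT.inc_other h1
  have h5 : f (H.tgt e) = s := ((h3 _).1 h2).resolve_left hne.symm
  rw [h5] at he
  have := (h4 n).1 he
  subst this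
  rcases h1 with h1 | h1
  · rcases h2 with h2 | h2
    · exact absurd (h1.trans h2.symm) hne
    · exact ⟨_, _, h1, h2.symm, Or.inl ⟨rfl, rfl⟩⟩
  · rcases h2 with h2 | h2
    · exact ⟨_, _, h2, h1.symm, Or.inr ⟨rfl, rfl⟩⟩
    · exact absurd (h1.symm.trans h2) hne

theorem cc_card {U : H.V → Prop} {𝒱 : Type} {f : H.V → 𝒱} {t s : 𝒱} (hts : t ≠ s)
    (p q : {e // e ∈ cut H U} → H.V) (hp : ∀ e, f (p e) = t) (hq : ∀ e, f (q e) = s)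
    (hj : ∀ e, Joins H e.1 (p e) (q e)) (v : H.V) (hv : f v = t) :
    cc H U v = Fintype.card {e // p e = v} := by
  unfold cc
  rw [← Finset.sum_filter, Finset.filter_mem_eq_inter, Finset.univ_inter, ← Finset.sum_coe_sort,
    Fintype.card_subtype, Finset.card_filter]
  refine Finset.sum_congr rfl fun e _ => ?_
  have hne : p e ≠ q e := fun h => hts (by rw [← hp e, ← hq e, h])
  have hqv : q e ≠ v := fun h => hts (by rw [← hq e, h, hv])
  rw [pair_incid hne (hj e) v, if_neg hqv]
  split_ifs <;> rfl

theorem labels {R : RT} {f : H.V → Option R.N} (h : Sb R H f) (hh : Honest R H f) (hN : Nonempty R.N) :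
    ∃ (lam : Option R.N → Fin 3 → H.V) (b : R.N → Fin 3 → H.E),
      (∀ t i, f (lam t i) = t) ∧
      (∀ n t v, R.inc n t → f v = t →
        cc H (fun v => R.Desc n (f v)) v = Fintype.card {i // lam t i = v}) ∧
      ∀ n, Function.Injective (b n) ∧ (∀ e, e ∈ cut H (fun v => R.Desc n (f v)) ↔ ∃ i, b n i = e) ∧
        ∀ i, Joins H (b n i) (lam (some n) i) (lam (R.par n) i) := by
  choose top bot htop hbot hj using fun (n : R.N) (e : {e // e ∈ cut H (fun v => R.Desc n (f v))}) =>
    honest_ends hh e.2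
  have ctop : ∀ n v, f v = some n → cc H (fun v => R.Desc n (f v)) v =
      Fintype.card {e // top n e = v} := fun n v hv =>
    cc_card (RT.par_ne n).symm (top n) (bot n) (htop n) (hbot n) (hj n) v hv
  have cbot : ∀ n v, f v = R.par n → cc H (fun v => R.Desc n (f v)) v =
      Fintype.card {e // bot n e = v} := fun n v hv =>
    cc_card (RT.par_ne n) (bot n) (top n) (hbot n) (htop n) (fun e => (hj n e).symm) v hv
  let Lbl : Option R.N → (Fin 3 → H.V) → Prop := fun t l => (∀ i, f (l i) = t) ∧
    ∀ n v, R.inc n t → f v = t → cc H (fun v => R.Desc n (f v)) v = Fintype.card {i // l i = v}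
  have mk : ∀ (n : R.N) (t : Option R.N) (hi : R.inc n t)
      (p : {e // e ∈ cut H (fun v => R.Desc n (f v))} → H.V) (hp : ∀ e, f (p e) = t)
      (hc : ∀ v, f v = t → cc H (fun v => R.Desc n (f v)) v = Fintype.card {e // p e = v})
      (b : Fin 3 ≃ {e // e ∈ cut H (fun v => R.Desc n (f v))}), Lbl t (fun i => p (b i)) := by
    intro n t hi p hp hc b
    refine ⟨fun i => hp _, fun n' v hi' hv => ?_⟩
    rw [h.eq n' n v (hv ▸ hi') (hv ▸ hi), hc v hv]
    exact (Fintype.card_congr (b.subtypeEquiv fun i => Iff.rfl)).symm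
  have step : ∀ (n : R.N) (l : Fin 3 → H.V), ∃ (l' : Fin 3 → H.V) (b : Fin 3 → H.E), Lbl (R.par n) l →
      Lbl (some n) l' ∧ Function.Injective b ∧
      (∀ e, e ∈ cut H (fun v => R.Desc n (f v)) ↔ ∃ i, b i = e) ∧ ∀ i, Joins H (b i) (l' i) (l i) := by
    intro n l
    by_cases hl : Lbl (R.par n) l
    · have hcard : ∀ v, Fintype.card {i // l i = v} = Fintype.card {e // bot n e = v} := by
        intro v
        by_cases hv : f v = R.par n
        · rw [← cbot n v hv, hl.2 n v (Or.inr rfl) hv]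
        · have e1 : IsEmpty {i // l i = v} := ⟨fun i => hv (by rw [← i.2, hl.1])⟩
          have e2 : IsEmpty {e // bot n e = v} := ⟨fun i => hv (by rw [← i.2, hbot])⟩
          simp
      let b := Equiv.ofFiberEquiv (f := l) (g := bot n) (fun v => Fintype.equivOfCardEq (hcard v))
      have hb : ∀ i, bot n (b i) = l i := fun i => Equiv.ofFiberEquiv_map _ i
      refine ⟨fun i => top n (b i), fun i => (b i).1, fun _ => ⟨?_, ?_, ?_, ?_⟩⟩
      · exact mk n (some n) (Or.inl rfl) (top n) (htop n) (ctop n) b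
      · exact Subtype.val_injective.comp b.injective
      · intro e
        constructor
        · intro he
          obtain ⟨i, hi⟩ := b.surjective ⟨e, he⟩
          exact ⟨i, congrArg Subtype.val hi⟩
        · rintro ⟨i, rfl⟩; exact (b i).2
      · intro i
        rw [← hb i]; exact hj n (b i)
    · obtain ⟨v, -⟩ := h.root
      have : Nonempty H.E := by
        by_contra hE
        rw [not_nonempty_iff] at hE
        have := h.val2 v
        simp [valence] at this
      exact ⟨fun _ => v, fun _ => this.some, fun h => absurd h hl⟩
  choose s bb hs using step
  have h0 : ∃ l0, Lbl none l0 := by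
    obtain ⟨k, hk, -⟩ := RT.root_child hN.some
    have hc : Fintype.card (Fin 3) = Fintype.card {e // e ∈ cut H (fun v => R.Desc k (f v))} := by
      rw [Fintype.card_coe, h.c3 k, Fintype.card_fin]
    have b := Fintype.equivOfCardEq hc
    refine ⟨_, mk k none (Or.inr hk) (bot k) (fun e => by rw [hbot, hk]) (fun v hv => ?_) b⟩
    exact cbot k v (hv.trans hk.symm)
  obtain ⟨l0, hl0⟩ := h0
  obtain ⟨F, hF0, hF⟩ := rec_exists R l0 s
  have hG : ∀ r, ∀ m : R.N, R.rk m = r → Lbl (some m) (F (some m)) := by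
    intro r
    induction r using Nat.strong_induction_on with
    | _ r ih =>
      intro m hm
      rw [hF]
      refine (hs m _ ?_).1
      cases hp : R.par m with
      | none => rw [hF0]; exact hl0
      | some k => exact ih _ (hm ▸ R.rk_lt m k hp) k rfl
  have hG' : ∀ t, Lbl t (F t) := by
    intro t
    cases t with
    | none => rw [hF0]; exact hl0
    | some m => exact hG _ m rfl
  refine ⟨F, fun n => bb n (F (R.par n)), fun t i => (hG' t).1 i, fun n t v hi hv => (hG' t).2 n v hi hv, fun n => ?_⟩
  obtain ⟨-, a, b, c⟩ := hs n _ (hG' (R.par n))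
  refine ⟨a, b, fun i => ?_⟩
  rw [hF]; exact c i
end TG

open scoped Classical
namespace TG
open Relation CGraph
variable {G H K : CGraph} {D D' D'' d d' e e' : LD}

theorem fin3_pair : ∀ i j : Fin 3, i ≠ j → ∃ p : Fin 3, (p + 1 = i ∧ p + 2 = j) ∨ (p + 1 = j ∧ p + 2 = i) := by
  decide

theorem fin3_ne : ∀ p : Fin 3, p + 1 ≠ p ∧ p + 2 ≠ p ∧ p + 1 ≠ p + 2 := by decide

theorem fin3_least (P : Fin 3 → Prop) (i : Fin 3) (h : P i) : ∃ j ≤ i, P j ∧ ∀ k < j, ¬ P k := by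
  obtain ⟨j, hj, hm⟩ := Finset.exists_min_image (Finset.univ.filter P) id ⟨i, by simpa⟩
  simp only [Finset.mem_filter, Finset.mem_univ, true_and, id] at hj hm
  exact ⟨j, hm i h, hj, fun k hk hP => absurd (hm k hP) (not_le.2 hk)⟩

/-- a repeated label -/
def Rep {α : Type} (l : Fin 3 → α) (i : Fin 3) : Prop := ∃ j < i, l j = l i

theorem rep_typ {α : Type} {l : Fin 3 → α} {i : Fin 3} (h : Rep l i) :
    ∃ p j : Fin 3, j < i ∧ l j = l i ∧ ¬ Rep l j ∧ ((p + 1 = i ∧ p + 2 = j) ∨ (p + 1 = j ∧ p + 2 = i)) := by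
  obtain ⟨k, hk, hkl⟩ := h
  obtain ⟨j, hj, hP, hm⟩ := fin3_least (fun j => l j = l i) k hkl
  obtain ⟨p, hp⟩ := fin3_pair i j (by omega)
  refine ⟨p, j, lt_of_le_of_lt hj hk, hP, ?_, hp⟩
  rintro ⟨q, hq, hql⟩
  exact hm q hq (hql.trans hP)

theorem not_rep_inj {α : Type} {l : Fin 3 → α} {i j : Fin 3} (hi : ¬ Rep l i) (hj : ¬ Rep l j)
    (h : l i = l j) : i = j := by
  by_contra hne
  rcases lt_or_gt_of_ne hne with hl | hl
  · exact hj ⟨i, hl, h⟩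
  · exact hi ⟨j, hl, h.symm⟩

theorem rep_ex {α : Type} (l : Fin 3 → α) (i : Fin 3) : ∃ j, ¬ Rep l j ∧ l j = l i := by
  by_cases h : Rep l i
  · obtain ⟨p, j, -, h1, h2, -⟩ := rep_typ h
    exact ⟨j, h2, h1⟩
  · exact ⟨i, h, rfl⟩

theorem card_split {α β : Type} [Fintype α] [Fintype β] (c : α → β) (hs : Function.Surjective c)
    (P : α → Prop) (h1 : ∀ x y, ¬ P x → ¬ P y → c x = c y → x = y) (h2 : ∀ x, ∃ y, ¬ P y ∧ c y = c x) :
    Fintype.card α = Fintype.card β + Fintype.card {x // P x} := by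
  have e : {x // ¬ P x} ≃ β := Equiv.ofBijective (fun x => c x.1) ⟨fun x y h => Subtype.ext (h1 _ _ x.2 y.2 h),
    fun b => by
      obtain ⟨a, rfl⟩ := hs b
      obtain ⟨y, hy, hc⟩ := h2 a
      exact ⟨⟨y, hy⟩, hc⟩⟩
  rw [← Fintype.card_congr e, ← Fintype.card_sum]
  exact Fintype.card_congr ((Equiv.sumComm _ _).trans (Equiv.sumCompl P)).symm

theorem tv_inc (t : Option D.N) : tv D t = (Finset.univ.filter fun n => t = some n ∨ D.par n = t).card := by
  rw [Finset.card_filter]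
  refine Finset.sum_congr rfl fun n _ => ?_
  split_ifs with h
  · exact tr_incid (h.imp_left Eq.symm)
  · by_contra h0
    exact h ((incid_pos.1 (Nat.one_le_iff_ne_zero.2 h0)).imp_left Eq.symm)

theorem inc_cut {R : RT} {f : H.V → Option R.N} {n : R.N} {e : H.E} (hne : f (H.src e) ≠ f (H.tgt e))
    (h1 : R.inc n (f (H.src e))) (h2 : R.inc n (f (H.tgt e))) : e ∈ cut H fun v => R.Desc n (f v) := by
  obtain ⟨s, -, -, h3, h4⟩ := RT.inc_other h1
  have h5 : f (H.tgt e) = s := ((h3 _).1 h2).resolve_left hne.symm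
  rw [mem_cut, h5]
  exact (h4 n).2 rfl

theorem val_le {R : RT} {f : H.V → Option R.N} (hh : Honest R H f) (v : H.V)
    (hv : ∀ e, f (H.src e) = f (H.tgt e) → ¬ Incident H e v)
    (h1 : ∀ n, R.inc n (f v) → cc H (fun v => R.Desc n (f v)) v = 1) :
    valence H v ≤ (Finset.univ.filter fun n => R.inc n (f v)).card := by
  have h2 : ∑ n ∈ Finset.univ.filter (fun n => R.inc n (f v)), cc H (fun v => R.Desc n (f v)) v =
      (Finset.univ.filter fun n => R.inc n (f v)).card := by
    rw [Finset.card_eq_sum_ones]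
    exact Finset.sum_congr rfl fun n hn => h1 n (by simpa using hn)
  rw [← h2]
  unfold valence cc
  rw [Finset.sum_comm]
  refine Finset.sum_le_sum fun e _ => ?_
  by_cases he : Incident H e v
  · have hne : f (H.src e) ≠ f (H.tgt e) := fun h => hv e h he
    obtain ⟨n, ha, hb⟩ := hh e hne
    have hn : R.inc n (f v) := by
      rcases he with he | he <;> rw [← he] <;> assumption
    have := Finset.single_le_sum (f := fun n => if e ∈ cut H (fun v => R.Desc n (f v)) then incid H e v else 0)
      (s := Finset.univ.filter (fun n => R.inc n (f v))) (fun _ _ => Nat.zero_le _) (a := n) (by simpa using hn)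
    refine le_trans ?_ this
    rw [if_pos (inc_cut hne ha hb)]
  · have : incid H e v = 0 := by
      by_contra h0; exact he (incid_pos.1 (Nat.one_le_iff_ne_zero.2 h0))
    rw [this]; exact Nat.zero_le _

theorem ladder_ctr {R : RT} {f : H.V → Option R.N} (h : Sb R H f) (hh : Honest R H f) (hN : Nonempty R.N) :
    ∃ (D : LD) (_ : Good D) (π : Ctr (Lad D) H), ClassClosed (ladMor D) (Set.range π.fe)ᶜ := by
  obtain ⟨lam, b, hf, hcc, hb⟩ := labels h hh hN
  have hinc : ∀ t : Option R.N, ∃ n, R.inc n t := by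
    intro t
    cases t with
    | some n => exact ⟨n, Or.inl rfl⟩
    | none => obtain ⟨k, hk, -⟩ := RT.root_child hN.some; exact ⟨k, Or.inr hk⟩
  have hsur : ∀ v, ∃ i, lam (f v) i = v := by
    intro v
    obtain ⟨n, hn⟩ := hinc (f v)
    have h1 := h.pos n v hn
    rw [hcc n _ v hn rfl] at h1
    obtain ⟨i, hi⟩ := Fintype.card_pos_iff.1 h1
    exact ⟨i, hi⟩
  have hvt : ∀ e : {e // f (H.src e) = f (H.tgt e)}, ∃ p : Fin 3,
      Joins H e.1 (lam (f (H.src e.1)) (p + 1)) (lam (f (H.src e.1)) (p + 2)) := by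
    rintro ⟨e, he⟩
    obtain ⟨i, hi⟩ := hsur (H.src e)
    obtain ⟨j, hj⟩ := hsur (H.tgt e)
    rw [← he] at hj
    have hij : i ≠ j := fun hij => h.loopless e (by rw [← hi, ← hj, hij])
    obtain ⟨p, ⟨h1, h2⟩ | ⟨h1, h2⟩⟩ := fin3_pair i j hij
    · exact ⟨p, Or.inl ⟨by rw [h1, hi], by rw [h2, hj]⟩⟩
    · exact ⟨p, Or.inr ⟨by rw [h2, hi], by rw [h1, hj]⟩⟩
  choose tp htp using hvt
  choose mp mj hmlt hmeq hmrep hmp using fun x : {x : Option R.N × Fin 3 // Rep (lam x.1) x.2} => rep_typ x.2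
  let D : LD := {
    N := R.N
    C := {e // f (H.src e) = f (H.tgt e)} ⊕ {x : Option R.N × Fin 3 // Rep (lam x.1) x.2}
    fN := inferInstance
    fC := inferInstance
    par := R.par
    rk := R.rk
    rk_lt := R.rk_lt
    pos := Sum.elim (fun e => f (H.src e.1)) (fun x => x.1.1)
    typ := Sum.elim tp mp }
  have touch : ∀ t i, tv D t < valence H (lam t i) → ∃ c, D.pos c = t ∧ D.typ c ≠ i := by
    intro t i hlt
    by_contra hno
    push Not at hno
    have hn1 : ∀ e : {e // f (H.src e) = f (H.tgt e)}, f (H.src e.1) = t → tp e = i := fun e => hno (Sum.inl e)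
    have hn2 : ∀ x : {x : Option R.N × Fin 3 // Rep (lam x.1) x.2}, x.1.1 = t → mp x = i := fun e => hno (Sum.inr e)
    have huni : ∀ j, lam t j = lam t i → j = i := by
      intro j hj
      by_contra hne
      have key : ∃ k, Rep (lam t) k ∧ lam t k = lam t i ∧ (k = i ∨ ¬ Rep (lam t) i) := by
        by_cases hi : Rep (lam t) i
        · exact ⟨i, hi, rfl, Or.inl rfl⟩
        · have : Rep (lam t) j := by
            by_contra hj'
            exact hne (not_rep_inj hj' hi hj)
          exact ⟨j, this, hj, Or.inr hi⟩
      obtain ⟨k, hk, hki, ho⟩ := key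
      have q1 := hn2 ⟨(t, k), hk⟩ rfl
      have q2 := hmp ⟨(t, k), hk⟩
      have q3 := hmeq ⟨(t, k), hk⟩
      have q4 := hmrep ⟨(t, k), hk⟩
      rw [q1] at q2
      have q5 := fin3_ne i
      rcases ho with ho | ho
      · subst ho
        rcases q2 with ⟨q, -⟩ | ⟨-, q⟩
        · exact q5.1 q
        · exact q5.2.1 q
      · have := not_rep_inj q4 ho (q3.trans hki)
        rcases q2 with ⟨-, q⟩ | ⟨q, -⟩
        · exact q5.2.1 (q.trans this)
        · exact q5.1 (q.trans this)
    have hle : valence H (lam t i) ≤ (Finset.univ.filter fun n => R.inc n (f (lam t i))).card := by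
      refine val_le hh _ ?_ ?_
      · intro e he hin
        have hft : f (H.src e) = t := by
          rcases hin with hin | hin
          · rw [hin, hf]
          · rw [he, hin, hf]
        have q1 := htp ⟨e, he⟩
        rw [hn1 ⟨e, he⟩ hft] at q1
        simp only [hft] at q1
        have q5 := fin3_ne i
        rcases q1 with ⟨q1, q2⟩ | ⟨q1, q2⟩ <;> rcases hin with hin | hin
        · exact q5.1 (huni _ (q1.symm.trans hin))
        · exact q5.2.1 (huni _ (q2.symm.trans hin))
        · exact q5.2.1 (huni _ (q1.symm.trans hin))
        · exact q5.1 (huni _ (q2.symm.trans hin))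
      · intro n hn
        rw [hf] at hn
        rw [hcc n t _ hn (hf t i), Fintype.card_eq_one_iff]
        exact ⟨⟨i, rfl⟩, fun y => Subtype.ext (huni _ y.2)⟩
    rw [hf] at hle
    have hq := tv_inc (D := D) t
    have : (Finset.univ.filter fun n => R.inc n t).card = tv D t := by
      rw [hq]; congr 1; ext n; simp only [Finset.mem_filter]; exact Iff.rfl
    omega
  have hgood : Good D := by
    refine ⟨hN, fun t ht => ?_, fun t ht => ?_⟩
    · obtain ⟨c, hc, -⟩ := touch t 0 (by rw [ht]; exact h.val2 _)
      obtain ⟨c', hc', hne⟩ := touch t (D.typ c) (by rw [ht]; exact h.val2 _)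
      exact ⟨c, c', hc, hc', hne.symm⟩
    · have : ∃ v, f v = t ∧ 3 ≤ valence H v := by
        cases t with
        | none => exact h.root
        | some n =>
          refine (h.cov n).resolve_right ?_
          rintro ⟨m, m', hne, h1, h2⟩
          rw [tv_some] at ht
          have : 2 ≤ (Finset.univ.filter fun m => D.par m = some n).card := by
            refine Finset.one_lt_card.2 ⟨m, ?_, m', ?_, hne⟩
            · simpa using h1
            · simpa using h2
          omega
      obtain ⟨v, rfl, hv⟩ := this
      obtain ⟨i, hi⟩ := hsur v
      obtain ⟨c, hc, -⟩ := touch (f v) i (by rw [ht, hi]; exact hv)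
      exact ⟨c, hc⟩
  let g : (R.N × Fin 3) ⊕ {e // f (H.src e) = f (H.tgt e)} → H.E := Sum.elim (fun x => b x.1 x.2) (fun e => e.1)
  have hends : ∀ n i, (f (H.src (b n i)) = some n ∧ f (H.tgt (b n i)) = R.par n) ∨
      (f (H.src (b n i)) = R.par n ∧ f (H.tgt (b n i)) = some n) := by
    intro n i
    rcases (hb n).2.2 i with ⟨q1, q2⟩ | ⟨q1, q2⟩ <;> rw [q1, q2, hf, hf] <;> simp
  have hnv : ∀ n i, f (H.src (b n i)) ≠ f (H.tgt (b n i)) := by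
    intro n i
    have := RT.par_ne n
    rcases hends n i with ⟨q1, q2⟩ | ⟨q1, q2⟩ <;> rw [q1, q2]
    · exact this.symm
    · exact this
  have hg : Function.Bijective g := by
    constructor
    · have cr : ∀ n m i j, b n i = b m j → n = m := by
        intro n m i j hbb
        have q1 := hends n i
        have q2 := hends m j
        rw [hbb] at q1
        by_contra hne
        have a1 : ¬ (R.par n = some m ∧ R.par m = some n) := by
          rintro ⟨a, b⟩
          have := R.rk_lt _ _ a
          have := R.rk_lt _ _ b
          omega
        rcases q1 with ⟨q1, q3⟩ | ⟨q1, q3⟩ <;> rcases q2 with ⟨q2, q4⟩ | ⟨q2, q4⟩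
        · exact hne (Option.some.inj (q1.symm.trans q2))
        · exact a1 ⟨q3.symm.trans q4, q2.symm.trans q1⟩
        · exact a1 ⟨q1.symm.trans q2, q4.symm.trans q3⟩
        · exact hne (Option.some.inj (q3.symm.trans q4))
      rintro (⟨n, i⟩ | e) (⟨m, j⟩ | e') hxy
      · change b n i = b m j at hxy
        have := cr _ _ _ _ hxy
        subst this
        rw [(hb n).1 hxy]
      · change b n i = e'.1 at hxy
        exact absurd (hxy ▸ e'.2) (hnv n i)
      · change e.1 = b m j at hxy
        exact absurd (hxy ▸ e.2) (hnv m j)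
      · exact congrArg Sum.inr (Subtype.ext hxy)
    · intro e
      by_cases he : f (H.src e) = f (H.tgt e)
      · exact ⟨Sum.inr ⟨e, he⟩, rfl⟩
      · obtain ⟨n, h1, h2⟩ := hh e he
        obtain ⟨i, hi⟩ := ((hb n).2.1 e).1 (inc_cut he h1 h2)
        exact ⟨Sum.inl (n, i), hi⟩
  let φ := Equiv.ofBijective g hg
  let em : (R.N × Fin 3) ⊕ {e // f (H.src e) = f (H.tgt e)} → (Lad D).E := Sum.elim Sum.inl (fun e => Sum.inr (Sum.inl e))
  have hem : Function.Injective em := by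
    rintro (a | a) (b | b) hab
    · exact congrArg Sum.inl (Sum.inl.inj hab)
    · cases hab
    · cases hab
    · exact congrArg Sum.inr (Sum.inl.inj (Sum.inr.inj hab))
  have hrange : ∀ x : (Lad D).E, x ∈ (Set.range fun e => em (φ.symm e))ᶜ ↔ ∃ m, x = Sum.inr (Sum.inr m) := by
    intro x
    rw [Set.mem_compl_iff]
    constructor
    · intro hx
      rcases x with x | (x | x)
      · exact absurd ⟨φ (Sum.inl x), by simp [em]⟩ hx
      · exact absurd ⟨φ (Sum.inr x), by simp [em]⟩ hx
      · exact ⟨x, rfl⟩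
    · rintro ⟨m, rfl⟩ ⟨e, he⟩
      dsimp only at he
      generalize φ.symm e = y at he
      rcases y with y | y
      · cases he
      · cases he
  let c : (Lad D).V → H.V := fun x => lam x.1 x.2
  have hmerge : ∀ m : {x : Option R.N × Fin 3 // Rep (lam x.1) x.2},
      Joins (Lad D) (Sum.inr (Sum.inr m)) (m.1.1, m.1.2) (m.1.1, mj m) := by
    intro m
    rcases hmp m with ⟨q1, q2⟩ | ⟨q1, q2⟩
    · exact Or.inl ⟨Prod.ext rfl q1, Prod.ext rfl q2⟩
    · exact Or.inr ⟨Prod.ext rfl q1, Prod.ext rfl q2⟩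
  have hcsurj : Function.Surjective c := by
    intro v
    obtain ⟨i, hi⟩ := hsur v
    exact ⟨(f v, i), hi⟩
  let π : Ctr (Lad D) H := {
    c := c
    fe := fun e => em (φ.symm e)
    surj := hcsurj
    inj := hem.comp φ.symm.injective
    ends := by
      intro e
      obtain ⟨y, rfl⟩ := φ.surjective e
      rw [Equiv.symm_apply_apply]
      rcases y with ⟨n, i⟩ | e
      · exact (hb n).2.2 i
      · exact htp e
    fib := by
      have hr : ∀ t i, ∃ j, ¬ Rep (lam t) j ∧ lam t j = lam t i ∧
          SReach (Lad D) (Set.range fun e => em (φ.symm e))ᶜ (t, i) (t, j) := by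
        intro t i
        by_cases hi : Rep (lam t) i
        · refine ⟨mj ⟨(t, i), hi⟩, hmrep ⟨(t, i), hi⟩, hmeq ⟨(t, i), hi⟩, ?_⟩
          exact ReflTransGen.single ⟨Sum.inr (Sum.inr ⟨(t, i), hi⟩), (hrange _).2 ⟨_, rfl⟩, hmerge _⟩
        · exact ⟨i, hi, rfl, ReflTransGen.refl⟩
      rintro ⟨t, i⟩ ⟨s, j⟩ hc
      change lam t i = lam s j at hc
      have hts : t = s := by rw [← hf t i, hc, hf]
      subst hts
      obtain ⟨i', h1, h2, h3⟩ := hr t i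
      obtain ⟨j', h1', h2', h3'⟩ := hr t j
      have := not_rep_inj h1 h1' (h2.trans (hc.trans h2'.symm))
      subst this
      exact sreach_trans h3 (sreach_symm h3')
    drop := by
      intro x hx
      obtain ⟨m, rfl⟩ := (hrange x).1 hx
      have := hmeq m
      rcases hmerge m with ⟨q1, q2⟩ | ⟨q1, q2⟩ <;> rw [q1, q2]
      · exact this.symm
      · exact this
    card := by
      have k1 := card_split c hcsurj (fun x => Rep (lam x.1) x.2) (by
        rintro ⟨t, i⟩ ⟨s, j⟩ h1 h2 hc
        change lam t i = lam s j at hc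
        have hts : t = s := by rw [← hf t i, hc, hf]
        subst hts
        exact Prod.ext rfl (not_rep_inj h1 h2 hc)) (by
        rintro ⟨t, i⟩
        obtain ⟨j, h1, h2⟩ := rep_ex (lam t) i
        exact ⟨(t, j), h1, h2⟩)
      have k2 := Fintype.card_congr φ
      have k3 : Fintype.card (Lad D).E = Fintype.card ((R.N × Fin 3) ⊕ {e // f (H.src e) = f (H.tgt e)}) +
          Fintype.card {x : Option R.N × Fin 3 // Rep (lam x.1) x.2} := by
        rw [← Fintype.card_sum]
        exact Fintype.card_congr (Equiv.sumAssoc _ _ _).symm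
      rw [k3, k2]
      have k4 : Fintype.card (Lad D).V = Fintype.card H.V + Fintype.card {x : Option R.N × Fin 3 // Rep (lam x.1) x.2} := by
        convert k1
      rw [k4]
      ring }
  refine ⟨D, hgood, π, ?_⟩
  intro x y hxy
  rw [show (Set.range π.fe) = Set.range fun e => em (φ.symm e) from rfl, hrange, hrange]
  rcases x with x | x <;> rcases y with y | y
  · simp
  · simp [classMap, ladMor] at hxy
  · simp [classMap, ladMor] at hxy
  · have : x = y := by simpa [classMap, ladMor] using hxy
    rw [this]
end TG

open scoped Classical
namespace TG
open Relation CGraph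
variable {G H K : CGraph} {D D' D'' d d' e e' : LD}

theorem fin3_cases : ∀ p i : Fin 3, i = p ∨ i = p + 1 ∨ i = p + 2 := by decide

theorem fin3_add : ∀ p : Fin 3, p + 1 + 1 = p + 2 ∧ p + 1 + 2 = p ∧ p + 2 + 1 = p ∧ p + 2 + 2 = p + 1 := by decide

theorem small_typ (hl : ∀ e, H.src e ≠ H.tgt e) (hv : ∀ v, 3 ≤ valence H v)
    (hE : 4 ≤ Fintype.card H.E) (l : Fin 3 → H.V) (hs : Function.Surjective l) :
    ∃ typ : H.E → Fin 3, (∀ e, Joins H e (l (typ e + 1)) (l (typ e + 2))) ∧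
      ∀ i, ∃ x y, x ≠ y ∧ typ x ≠ i ∧ typ y ≠ i := by
  by_cases hi : Function.Injective l
  · have h1 : ∀ e, ∃ p : Fin 3, Joins H e (l (p + 1)) (l (p + 2)) := by
      intro e
      obtain ⟨i, hi⟩ := hs (H.src e)
      obtain ⟨j, hj⟩ := hs (H.tgt e)
      have hij : i ≠ j := fun hij => hl e (by rw [← hi, ← hj, hij])
      obtain ⟨p, ⟨h1, h2⟩ | ⟨h1, h2⟩⟩ := fin3_pair i j hij
      · exact ⟨p, Or.inl ⟨by rw [h1, hi], by rw [h2, hj]⟩⟩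
      · exact ⟨p, Or.inr ⟨by rw [h2, hi], by rw [h1, hj]⟩⟩
    choose typ ht using h1
    refine ⟨typ, ht, fun i => ?_⟩
    have h2 : valence H (l i) ≤ 2 * (Finset.univ.filter fun e => typ e ≠ i).card := by
      rw [Finset.card_filter, Finset.mul_sum]
      refine Finset.sum_le_sum fun e _ => ?_
      split_ifs with h
      · exact incid_le e _
      · push Not at h
        by_contra h0
        have h3 := incid_pos.1 (Nat.one_le_iff_ne_zero.2 (fun h4 => h0 (by rw [h4]; simp)))
        have h4 := ht e
        have h5 := fin3_ne i
        rw [h] at h4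
        rcases h4 with ⟨q1, q2⟩ | ⟨q1, q2⟩ <;> rcases h3 with h3 | h3
        · exact h5.1 (hi (q1.symm.trans h3))
        · exact h5.2.1 (hi (q2.symm.trans h3))
        · exact h5.2.1 (hi (q1.symm.trans h3))
        · exact h5.1 (hi (q2.symm.trans h3))
    have h3 := hv (l i)
    obtain ⟨x, hx, y, hy, hxy⟩ := Finset.one_lt_card.1 (show 1 < (Finset.univ.filter fun e => typ e ≠ i).card by omega)
    simp only [Finset.mem_filter, Finset.mem_univ, true_and] at hx hy
    exact ⟨x, y, hxy, hx, hy⟩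
  · obtain ⟨p, hp⟩ : ∃ p : Fin 3, l (p + 1) = l (p + 2) := by
      simp only [Function.Injective] at hi
      push Not at hi
      obtain ⟨i, j, h1, h2⟩ := hi
      obtain ⟨p, ⟨h3, h4⟩ | ⟨h3, h4⟩⟩ := fin3_pair i j h2
      · exact ⟨p, by rw [h3, h4, h1]⟩
      · exact ⟨p, by rw [h3, h4, h1]⟩
    have hends : ∀ e, Joins H e (l p) (l (p + 1)) := by
      have h1 : ∀ v, v = l p ∨ v = l (p + 1) := by
        intro v
        obtain ⟨i, rfl⟩ := hs v
        rcases fin3_cases p i with rfl | rfl | rfl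
        · exact Or.inl rfl
        · exact Or.inr rfl
        · exact Or.inr hp.symm
      intro e
      have h2 := hl e
      rcases h1 (H.src e) with h3 | h3 <;> rcases h1 (H.tgt e) with h4 | h4
      · exact absurd (h3.trans h4.symm) h2
      · exact Or.inl ⟨h3, h4⟩
      · exact Or.inr ⟨h3, h4⟩
      · exact absurd (h3.trans h4.symm) h2
    obtain ⟨A, -, hA⟩ := Finset.exists_subset_card_eq (s := (Finset.univ : Finset H.E)) (n := 2) (by simp; omega)
    have hB : 2 ≤ (Finset.univ \ A : Finset H.E).card := by
      rw [Finset.card_sdiff_of_subset (Finset.subset_univ _), hA, Finset.card_univ]; omega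
    obtain ⟨x, y, hx, hy, hxy⟩ := Finset.one_lt_card_iff.1 (show 1 < A.card by omega)
    obtain ⟨z, w, hz, hw, hzw⟩ := Finset.one_lt_card_iff.1 (show 1 < (Finset.univ \ A : Finset H.E).card by omega)
    simp only [Finset.mem_sdiff, Finset.mem_univ, true_and] at hz hw
    have ha := fin3_add p
    have hn := fin3_ne p
    refine ⟨fun e => if e ∈ A then p + 1 else p + 2, fun e => ?_, fun i => ?_⟩
    · dsimp only
      split_ifs
      · rw [ha.1, ha.2.1, ← hp]; exact (hends e).symm
      · rw [ha.2.2.1, ha.2.2.2]; exact hends e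
    · by_cases h : p + 1 = i
      · refine ⟨z, w, hzw, ?_, ?_⟩ <;> rw [← h]
        · dsimp only; rw [if_neg hz]; exact hn.2.2.symm
        · dsimp only; rw [if_neg hw]; exact hn.2.2.symm
      · refine ⟨x, y, hxy, ?_, ?_⟩
        · dsimp only; rw [if_pos hx]; exact h
        · dsimp only; rw [if_pos hy]; exact h

theorem small_ctr (hl : ∀ e, H.src e ≠ H.tgt e) (hv : ∀ v, 3 ≤ valence H v)
    (hE : 4 ≤ Fintype.card H.E) (hV : Fintype.card H.V ≤ 3) :
    ∃ (D : LD) (_ : Good D) (π : Ctr (Lad D) H), ClassClosed (ladMor D) (Set.range π.fe)ᶜ := by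
  obtain ⟨l, hs⟩ : ∃ l : Fin 3 → H.V, Function.Surjective l := by
    obtain ⟨j⟩ := Function.Embedding.nonempty_of_card_le (α := H.V) (β := Fin 3) (by simpa using hV)
    have e0 : Nonempty H.E := Fintype.card_pos_iff.1 (by omega)
    have : Nonempty H.V := ⟨H.src e0.some⟩
    exact ⟨Function.invFun j, Function.invFun_surjective j.injective⟩
  obtain ⟨typ, ht, htwo⟩ := small_typ hl hv hE l hs
  obtain ⟨a, a', hne, haa⟩ := Fintype.exists_ne_map_eq_of_card_lt typ (by simp; omega)
  obtain ⟨x, y, hxy, hx, hy⟩ := htwo (typ a)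
  choose mp mj hmlt hmeq hmrep hmp using fun x : {x : Fin 3 // Rep l x} => rep_typ x.2
  let D : LD := {
    N := Unit
    C := H.E ⊕ {x : Fin 3 // Rep l x}
    fN := inferInstance
    fC := inferInstance
    par := fun _ => none
    rk := fun _ => 0
    rk_lt := fun n m h => by cases h
    pos := Sum.elim (fun e => if e = a ∨ e = x then none else some ()) (fun x => none)
    typ := Sum.elim typ mp }
  have g1 : ∀ t : Option Unit, ∃ c c' : D.C, D.pos c = t ∧ D.pos c' = t ∧ D.typ c ≠ D.typ c' := by
    rintro (_ | ⟨⟨⟩⟩)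
    · exact ⟨Sum.inl a, Sum.inl x, if_pos (Or.inl rfl), if_pos (Or.inr rfl), hx.symm⟩
    · refine ⟨Sum.inl a', Sum.inl y, if_neg ?_, if_neg ?_, ?_⟩
      · rintro (h | h)
        · exact hne h.symm
        · exact hx (by rw [← h, haa])
      · rintro (h | h)
        · exact hy (by rw [h])
        · exact hxy h.symm
      · show typ a' ≠ typ y
        rw [← haa]; exact hy.symm
  have hgood : Good D := ⟨⟨()⟩, fun t _ => g1 t, fun t _ => by
    obtain ⟨c, -, hc, -⟩ := g1 t; exact ⟨c, hc⟩⟩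
  let F : H.E → (Lad D).E := fun e => Sum.inr (Sum.inl e)
  have hrange : ∀ x : (Lad D).E, x ∈ (Set.range F)ᶜ ↔ (∃ m, x = Sum.inl m) ∨ ∃ m, x = Sum.inr (Sum.inr m) := by
    intro x
    rw [Set.mem_compl_iff]
    constructor
    · intro hx
      rcases x with x | (x | x)
      · exact Or.inl ⟨x, rfl⟩
      · exact absurd ⟨x, rfl⟩ hx
      · exact Or.inr ⟨x, rfl⟩
    · rintro (⟨m, rfl⟩ | ⟨m, rfl⟩) ⟨e, he⟩
      · cases he
      · cases he
  let c : (Lad D).V → H.V := fun x => l x.2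
  have hmerge : ∀ m : {x : Fin 3 // Rep l x},
      Joins (Lad D) (Sum.inr (Sum.inr m)) (none, m.1) (none, mj m) := by
    intro m
    rcases hmp m with ⟨q1, q2⟩ | ⟨q1, q2⟩
    · exact Or.inl ⟨Prod.ext rfl q1, Prod.ext rfl q2⟩
    · exact Or.inr ⟨Prod.ext rfl q1, Prod.ext rfl q2⟩
  have hcsurj : Function.Surjective c := by
    intro v
    obtain ⟨i, hi⟩ := hs v
    exact ⟨(none, i), hi⟩
  let π : Ctr (Lad D) H := {
    c := c
    fe := F
    surj := hcsurj
    inj := fun e e' h => Sum.inl.inj (Sum.inr.inj h)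
    ends := ht
    fib := by
      have h0 : ∀ t i, SReach (Lad D) (Set.range F)ᶜ (t, i) (none, i) := by
        rintro (_ | ⟨⟨⟩⟩) i
        · exact ReflTransGen.refl
        · exact ReflTransGen.single ⟨Sum.inl ((), i), (hrange _).2 (Or.inl ⟨_, rfl⟩), Or.inl ⟨rfl, rfl⟩⟩
      have hr : ∀ i, ∃ j, ¬ Rep l j ∧ l j = l i ∧
          SReach (Lad D) (Set.range F)ᶜ (none, i) (none, j) := by
        intro i
        by_cases hi : Rep l i
        · refine ⟨mj ⟨i, hi⟩, hmrep ⟨i, hi⟩, hmeq ⟨i, hi⟩, ?_⟩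
          exact ReflTransGen.single ⟨Sum.inr (Sum.inr ⟨i, hi⟩), (hrange _).2 (Or.inr ⟨_, rfl⟩), hmerge _⟩
        · exact ⟨i, hi, rfl, ReflTransGen.refl⟩
      rintro ⟨t, i⟩ ⟨s, j⟩ hc
      change l i = l j at hc
      obtain ⟨i', h1, h2, h3⟩ := hr i
      obtain ⟨j', h1', h2', h3'⟩ := hr j
      have := not_rep_inj h1 h1' (h2.trans (hc.trans h2'.symm))
      subst this
      exact sreach_trans (h0 t i) (sreach_trans h3 (sreach_symm (sreach_trans (h0 s j) h3')))
    drop := by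
      intro x hx
      rcases (hrange x).1 hx with ⟨m, rfl⟩ | ⟨m, rfl⟩
      · rfl
      · have := hmeq m
        rcases hmerge m with ⟨q1, q2⟩ | ⟨q1, q2⟩ <;> rw [q1, q2]
        · exact this.symm
        · exact this
    card := by
      have k1 := card_split l hs (Rep l) (fun i j h1 h2 hc => not_rep_inj h1 h2 hc) (rep_ex l)
      have k3 : Fintype.card (Lad D).E = 3 + (Fintype.card H.E + Fintype.card {x : Fin 3 // Rep l x}) := by
        have : Fintype.card ((Unit × Fin 3) ⊕ (H.E ⊕ {x : Fin 3 // Rep l x})) = 3 + (Fintype.card H.E + Fintype.card {x : Fin 3 // Rep l x}) := by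
          rw [Fintype.card_sum, Fintype.card_sum]; simp
        rw [← this]
      have k4 : Fintype.card (Lad D).V = 6 := by
        have : Fintype.card (Option Unit × Fin 3) = 6 := by simp
        rw [← this]
      rw [k3, k4]
      rw [Fintype.card_fin] at k1
      omega }
  refine ⟨D, hgood, π, ?_⟩
  intro x y hxy
  rw [show (Set.range π.fe) = Set.range F from rfl, hrange, hrange]
  rcases x with x | x <;> rcases y with y | y
  · simp
  · simp [classMap, ladMor] at hxy
  · simp [classMap, ladMor] at hxy
  · have : x = y := by simpa [classMap, ladMor] using hxy
    rw [this]

theorem key (X : WGraph) (hX : MaximalTrigonal X) (hg : 3 ≤ wgenus X.G X.w) :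
    ∃ (D : LD) (h : Good D), WGIso (Cell h) X := by
  obtain ⟨T, hT⟩ := hX.1
  have hM : MaximalTrigonal ⟨T.G, T.w⟩ := max_iso hX (wg_symm hT)
  obtain ⟨hw, hloop⟩ := max_simple T hM
  suffices hh : ∃ (D : LD) (h : Good D), WGIso (Cell h) ⟨T.G, T.w⟩ by
    obtain ⟨D, h, i⟩ := hh
    exact ⟨D, h, wg_trans i hT⟩
  obtain ⟨Z, hZ⟩ : ∃ Z, Z = withLoops T.G T.w := ⟨_, rfl⟩
  have hst : StabReduces0 T.Gphi Z := hZ ▸ T.stab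
  have htec : ThreeEdgeConnected Z := hZ ▸ (tec_withLoops _).2 T.threeEC
  have hval : ∀ v, 3 ≤ valence Z v := by subst hZ; exact tt_stable T
  have hZl : ∀ e, Z.src e ≠ Z.tgt e := by
    subst hZ
    rintro (e | ⟨v, i⟩)
    · exact hloop e
    · have := i.2; have := hw v; omega
  have hZE : Fintype.card Z.E = Fintype.card T.G.E := by
    subst hZ
    have : IsEmpty (Σ v : T.G.V, Fin (T.w v)) := ⟨fun q => by have := q.2.2; have := hw q.1; omega⟩
    exact Fintype.card_congr (Equiv.sumEmpty _ _)
  have hZV : Fintype.card Z.V = Fintype.card T.G.V := by subst hZ; rfl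
  have hgen : 2 + Fintype.card Z.V ≤ Fintype.card Z.E := by
    obtain ⟨i, hi⟩ := hT
    have e1 := Fintype.card_congr i.vEquiv
    have e2 := Fintype.card_congr i.eEquiv
    have e3 : ∑ v : X.G.V, X.w v = 0 := Finset.sum_eq_zero fun v _ => by
      obtain ⟨u, rfl⟩ := i.vEquiv.surjective v
      exact (hi u).trans (hw u)
    unfold wgenus at hg
    rw [e3] at hg
    change Fintype.card T.G.V = _ at e1
    change Fintype.card T.G.E = _ at e2
    omega
  suffices hh : ∃ (H : CGraph) (_ : StabReduces0 H Z) (D : LD) (_ : Good D) (π : Ctr (Lad D) H),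
      ClassClosed (ladMor D) (Set.range π.fe)ᶜ by
    obtain ⟨H, hH, D, h, π, hπ⟩ := hh
    exact ⟨D, h, cell_of_ctr h T hM π hπ (hZ ▸ hH)⟩
  have hV2 := tt_card T
  rw [← hZV] at hV2
  obtain ⟨x0⟩ : Nonempty Z.V := Fintype.card_pos_iff.1 (by omega)
  obtain ⟨j, hj⟩ := W.stab hst
  obtain ⟨R0, ι, pe, hr, hpe⟩ := tree_rt T.T T.treeT (T.phi.vMap (j x0))
  have hW0 := hj _ _ _ _ _ (base_W T.phi T.harm T.nondeg T.deg3 R0 ι pe hpe)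
  obtain ⟨R, f, hW, hroot, hcov⟩ := reduce _ R0 _ rfl hW0 ⟨x0, hr⟩
  have h3 := full_cut R f htec hW hroot hcov
  by_cases hN : Nonempty R.N
  · have hSb : Sb R Z f := by
      refine ⟨h3, fun n v hi => hW.pos n v (h3 n) hi, fun n n' v => hW.eq n n' v (h3 n) (h3 n'),
        fun n n' t e => hW.pass n n' t e (h3 n) (h3 n'), hZl, fun v => by have := hval v; omega, ?_, ?_⟩
      · intro n
        rcases hcov n with ⟨x, hx⟩ | h
        · exact Or.inl ⟨x, hx, hval x⟩
        · exact Or.inr h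
      · obtain ⟨x, hx⟩ := hroot
        exact ⟨x, hx, hval x⟩
    obtain ⟨H, f', h1, h2, h4⟩ := subdivide _ Z f hSb rfl
    exact ⟨H, h4, ladder_ctr h1 h2 hN⟩
  · refine ⟨Z, ReflTransGen.refl, small_ctr hZl hval (by omega) ?_⟩
    have h5 := hW.fib none
    refine le_trans (le_of_eq ?_) h5
    rw [← Finset.card_univ]
    congr 1
    ext v
    simp only [Finset.mem_filter, Finset.mem_univ, true_and, true_iff]
    cases hf : f v with
    | none => rfl
    | some n => exact absurd ⟨n⟩ hN
end TG

/-- The moduli space of `3`-edge connected tropical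
trigonal curves of genus `g ≥ 3` is connected through codimension `1`: any two
maximal cells are joined by a chain of maximal cells in which consecutive ones
share a common codimension-one face, obtained by contracting a single
equivalence class of edges. -/
theorem trigonal_moduli_connected_through_codim_one
    (g : ℕ) (hg : 3 ≤ g) (X Y : WGraph)
    (hX : MaximalTrigonal X) (hY : MaximalTrigonal Y)
    (hgX : wgenus X.G X.w = g) (hgY : wgenus Y.G Y.w = g) :
    Relation.ReflTransGen
      (fun A B => MaximalTrigonal A ∧ MaximalTrigonal B ∧
        (AdjacentCells A B ∨ WGIso A B))
      X Y := by
  exact TG.final_of TG.key g hg X Y hX hY hgX hgY
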